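/- Let π⁰ be any 𝒪_L-submodule of π(α) which generates π(α) over L, is stable under GL₂(ℚ_p), and is finitely generated as a module over the group ring 𝒪_L[GL₂(ℚ_p)] (such π⁰ exist). Let Π̂ := (lim_n π⁰/π_L^n π⁰) ⊗_{𝒪_L} L be the completion of π(α) with respect to π⁰. Then the canonical map π(α) → B(α)/L(α) (inclusion followed by the quotient map) extends to a GL₂(ℚ_p)-equivariant topological isomorphism of Banach spaces Π̂ ≅ B(α)/L(α). The same statement holds with β in place of α throughout. -/

import Mathlib

open Filter Topology Classical

noncomputable section

namespace Paper

variable (p : ℕ) [Fact p.Prime]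
variable (L : Type) [NontriviallyNormedField L] [NormedAlgebra ℚ_[p] L]

/-- The canonical embedding `ℚ_p → L`. -/
noncomputable def iotaL : ℚ_[p] → L := algebraMap ℚ_[p] L

/-- The binomial coefficient `binom(z, n) = z(z-1)⋯(z-n+1)/n!` of a `p`-adic
integer, computed in `ℚ_p`. -/
noncomputable def binomQ (z : ℤ_[p]) (n : ℕ) : ℚ_[p] :=
  (∏ i ∈ Finset.range n, ((z : ℚ_[p]) - (i : ℚ_[p]))) / (n.factorial : ℚ_[p])

/-- The Mahler coefficients `a_n(f) = ∑_{i=0}^n (-1)^i binom(n,i) f(n-i)`. -/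
noncomputable def mahlerCoeff (f : ℤ_[p] → L) (n : ℕ) : L :=
  ∑ i ∈ Finset.range (n + 1), (-1 : L) ^ i * (n.choose i : L) * f (((n - i : ℕ) : ℤ_[p]))

/-- `f : ℤ_p → L` is of class `C^r` : the scaled Mahler coefficients
`n^r a_n(f)` tend to `0`, and `f` is the sum of its Mahler expansion. -/
def IsCr (r : ℝ) (f : ℤ_[p] → L) : Prop :=
  Tendsto (fun n : ℕ => (n : ℝ) ^ r * ‖mahlerCoeff p L f n‖) atTop (nhds 0) ∧
  ∀ z : ℤ_[p], HasSum (fun n : ℕ => mahlerCoeff p L f n * iotaL p L (binomQ p z n)) (f z)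

/-- The norm `‖f‖_r = sup_n (n+1)^r ‖a_n(f)‖` on `C^r(ℤ_p, L)`. -/
noncomputable def crNorm (r : ℝ) (f : ℤ_[p] → L) : ℝ :=
  ⨆ n : ℕ, ((n : ℝ) + 1) ^ r * ‖mahlerCoeff p L f n‖

/-- A continuous (= bounded) linear functional on `C^r(ℤ_p, L)`, i.e. a tempered
distribution of order `r`. -/
structure CrDual (r : ℝ) where
  toFun : (ℤ_[p] → L) → L
  map_add' : ∀ f g : ℤ_[p] → L, IsCr p L r f → IsCr p L r g →
    toFun (f + g) = toFun f + toFun g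
  map_smul' : ∀ (c : L) (f : ℤ_[p] → L), IsCr p L r f → toFun (c • f) = c * toFun f
  bound' : ∃ C : ℝ, ∀ f : ℤ_[p] → L, IsCr p L r f → ‖toFun f‖ ≤ C * crNorm p L r f

/-- The function `z ↦ 1_{a + pⁿℤ_p}(z) (z - a)^j`. -/
noncomputable def indPoly (a : ℤ_[p]) (n : ℕ) (j : ℕ) : ℤ_[p] → L := fun z =>
  if ‖z - a‖ ≤ (p : ℝ) ^ (-(n : ℤ)) then (iotaL p L ((z : ℚ_[p]) - (a : ℚ_[p]))) ^ j else 0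

/-- The norm `‖μ‖_{r,d} = sup_{a, 0 ≤ j ≤ d, n} p^{n(j-r)} ‖∫_{a+pⁿℤ_p} (z-a)^j dμ‖`. -/
noncomputable def dualNormRD (r : ℝ) (d : ℕ) (μ : CrDual p L r) : ℝ :=
  ⨆ (a : ℤ_[p]) (j : Fin (d + 1)) (n : ℕ),
    (p : ℝ) ^ ((n : ℝ) * (((j : ℕ) : ℝ) - r)) * ‖μ.toFun (indPoly p L a n j)‖

/-- `f : ℤ_p → L` is locally polynomial of local degree at most `d`. -/
def IsLocPoly (d : ℕ) (f : ℤ_[p] → L) : Prop :=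
  ∃ n : ℕ, ∀ a : ℤ_[p], ∃ P : Polynomial L, P.natDegree ≤ d ∧
    ∀ z : ℤ_[p], ‖z - a‖ ≤ (p : ℝ) ^ (-(n : ℤ)) → f z = Polynomial.eval (iotaL p L (z : ℚ_[p])) P

/-- A linear functional on `Pol^d(ℤ_p, L)`. -/
structure PolDual (d : ℕ) where
  toFun : (ℤ_[p] → L) → L
  map_add' : ∀ f g : ℤ_[p] → L, IsLocPoly p L d f → IsLocPoly p L d g →
    toFun (f + g) = toFun f + toFun g
  map_smul' : ∀ (c : L) (f : ℤ_[p] → L), IsLocPoly p L d f → toFun (c • f) = c * toFun f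

/-- The valuation `val(x) = -log_p ‖x‖` on `L`, normalized by `val(p) = 1`. -/
noncomputable def valL (x : L) : ℝ := -Real.logb p ‖x‖

/-- `g : ℤ_p → L` is a class-`C^{val α}` extension of
`z ↦ (αp/β)^{val z} z^{k-2} f(1/z)` from `ℤ_p ∖ {0}` to `ℤ_p`. -/
def Ext2 (k : ℕ) (α β : L) (f : ℚ_[p] → L) (g : ℤ_[p] → L) : Prop :=
  IsCr p L (valL p L α) g ∧ ∀ z : ℤ_[p], z ≠ 0 →
    g z = (α * (p : L) / β) ^ ((z : ℚ_[p]).valuation) *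
      (iotaL p L (z : ℚ_[p])) ^ (k - 2) * f (((z : ℚ_[p]))⁻¹)

/-- Membership in the Banach space `B(α)`. -/
def MemB (k : ℕ) (α β : L) (f : ℚ_[p] → L) : Prop :=
  IsCr p L (valL p L α) (fun z : ℤ_[p] => f ((p : ℚ_[p]) * (z : ℚ_[p]))) ∧
  ∃ g : ℤ_[p] → L, Ext2 p L k α β f g

/-- The extension `f₂` of `z ↦ (αp/β)^{val z} z^{k-2} f(1/z)` to `ℤ_p`
(it is unique when it exists). -/
noncomputable def ext2 (k : ℕ) (α β : L) (f : ℚ_[p] → L) : ℤ_[p] → L :=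
  if h : ∃ g : ℤ_[p] → L, Ext2 p L k α β f g then h.choose else 0

/-- The norm `‖f‖ = max(‖f₁‖_{val α}, ‖f₂‖_{val α})` on `B(α)`. -/
noncomputable def bNorm (k : ℕ) (α β : L) (f : ℚ_[p] → L) : ℝ :=
  max (crNorm p L (valL p L α) (fun z : ℤ_[p] => f ((p : ℚ_[p]) * (z : ℚ_[p]))))
      (crNorm p L (valL p L α) (ext2 p L k α β f))

/-- Determinant of a 2×2 matrix. -/
noncomputable def det2 (m : Matrix (Fin 2) (Fin 2) ℚ_[p]) : ℚ_[p] :=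
  m 0 0 * m 1 1 - m 0 1 * m 1 0

/-- The action of `g = (a b; c d) ∈ GL₂(ℚ_p)` on `B(α)`:
`(g·f)(z) = α^{-val(ad-bc)} (αp/β)^{val(-cz+a)} (-cz+a)^{k-2} f((dz-b)/(-cz+a))`,
the value at the pole `-cz+a = 0` being the one prescribed by the extension `f₂`. -/
noncomputable def gAct (k : ℕ) (α β : L) (m : Matrix (Fin 2) (Fin 2) ℚ_[p])
    (f : ℚ_[p] → L) : ℚ_[p] → L := fun z =>
  if -(m 1 0) * z + m 0 0 = 0 then
    α ^ (-(det2 p m).valuation) * (α * (p : L) / β) ^ ((det2 p m / m 1 0).valuation) *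
      (iotaL p L (det2 p m / m 1 0)) ^ (k - 2) * ext2 p L k α β f 0
  else
    α ^ (-(det2 p m).valuation) * (α * (p : L) / β) ^ ((-(m 1 0) * z + m 0 0).valuation) *
      (iotaL p L (-(m 1 0) * z + m 0 0)) ^ (k - 2) *
      f ((m 1 1 * z - m 0 1) / (-(m 1 0) * z + m 0 0))

/-- The monomial function `z ↦ z^j` on `ℚ_p`. -/
noncomputable def monomialFun (j : ℕ) : ℚ_[p] → L := fun z => (iotaL p L z) ^ j

/-- The function `z ↦ (αp/β)^{val(z-a)} (z-a)^{k-2-j}` (extended by `0` at `z = a`). -/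
noncomputable def specFun (k : ℕ) (α β : L) (a : ℚ_[p]) (j : ℕ) : ℚ_[p] → L := fun z =>
  if z = a then 0 else
    (α * (p : L) / β) ^ ((z - a).valuation) * (iotaL p L (z - a)) ^ (k - 2 - j)

/-- The generators of `L(α)` : the functions `z^j` and
`(αp/β)^{val(z-a)}(z-a)^{k-2-j}` for `0 ≤ j < val(α)` and `a ∈ ℚ_p`. -/
def lGen (k : ℕ) (α β : L) : Set (ℚ_[p] → L) :=
  {f | ∃ j : ℕ, (j : ℝ) < valL p L α ∧
    (f = monomialFun p L j ∨ ∃ a : ℚ_[p], f = specFun p L k α β a j)}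

/-- Membership in `L(α)`, the closure in `B(α)` of the span of the special
functions. -/
def MemLalpha (k : ℕ) (α β : L) (f : ℚ_[p] → L) : Prop :=
  MemB p L k α β f ∧ ∀ ε : ℝ, 0 < ε →
    ∃ g ∈ Submodule.span L (lGen p L k α β), bNorm p L k α β (f - g) < ε

/-- The quotient (semi)norm on `Π(V) = B(α)/L(α)`. -/
noncomputable def qNorm (k : ℕ) (α β : L) (f : ℚ_[p] → L) : ℝ :=
  sInf {x : ℝ | ∃ g : ℚ_[p] → L, MemLalpha p L k α β g ∧ x = bNorm p L k α β (f - g)}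

/-- `h : ℚ_p → L` is locally constant. -/
def LocConst (h : ℚ_[p] → L) : Prop :=
  ∀ x : ℚ_[p], ∃ n : ℕ, ∀ y : ℚ_[p], ‖y - x‖ ≤ (p : ℝ) ^ (-(n : ℤ)) → h y = h x

/-- `h` belongs to the smooth induced representation: `h` is locally constant and
`z ↦ (αp/β)^{val z} h(1/z)` extends to a locally constant function on `ℚ_p`. -/
def IndCond (α β : L) (h : ℚ_[p] → L) : Prop :=
  LocConst p L h ∧ ∃ h' : ℚ_[p] → L, LocConst p L h' ∧
    ∀ z : ℚ_[p], z ≠ 0 → h' z = (α * (p : L) / β) ^ z.valuation * h z⁻¹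

/-- The generators `z ↦ P(z) h(z)` of the locally algebraic representation `π(α)`. -/
def piGen (k : ℕ) (α β : L) : Set (ℚ_[p] → L) :=
  {f | ∃ (P : Polynomial L) (h : ℚ_[p] → L), P.natDegree ≤ k - 2 ∧ IndCond p L α β h ∧
    f = fun z => Polynomial.eval (iotaL p L z) P * h z}

/-- The locally algebraic representation `π(α)`, as a subspace of functions
`ℚ_p → L`. -/
noncomputable def piRep (k : ℕ) (α β : L) : Submodule L (ℚ_[p] → L) :=
  Submodule.span L (piGen p L k α β)

/-- The standing hypotheses on `(k, α, β)` coming from an absolutely irreducible,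
`φ`-semisimple crystalline representation: `k ≥ 2`, `α ≠ β`,
`0 < val(β) ≤ val(α)` and `val(α) + val(β) = k - 1`. -/
def Hyps (k : ℕ) (α β : L) : Prop :=
  2 ≤ k ∧ α ≠ β ∧ 0 < valL p L α ∧ 0 < valL p L β ∧
    valL p L α + valL p L β = (k : ℝ) - 1 ∧ valL p L β ≤ valL p L α

/-- `Λ` is a `GL₂(ℚ_p)`-stable `𝒪_L`-lattice in `π(α)`: an `𝒪_L`-submodule of
`π(α)` generating it over `L`, containing no `L`-line and stable by the action. -/
def IsLatticeStable (k : ℕ) (α β : L) (Λ : Set (ℚ_[p] → L)) : Prop :=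
  (∀ f ∈ Λ, f ∈ piRep p L k α β) ∧ ((0 : ℚ_[p] → L) ∈ Λ) ∧
  (∀ f ∈ Λ, ∀ g ∈ Λ, f + g ∈ Λ) ∧
  (∀ c : L, ‖c‖ ≤ 1 → ∀ f ∈ Λ, c • f ∈ Λ) ∧
  (∀ f ∈ piRep p L k α β, ∃ c : L, c ≠ 0 ∧ c • f ∈ Λ) ∧
  (∀ f, f ∈ piRep p L k α β → f ≠ 0 → ¬ ∀ c : L, c • f ∈ Λ) ∧
  (∀ m : Matrix (Fin 2) (Fin 2) ℚ_[p], det2 p m ≠ 0 → ∀ f ∈ Λ, gAct p L k α β m f ∈ Λ)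

/-- `π⁰` is an `𝒪_L`-submodule of `π(α)` generating it over `L`, stable under
`GL₂(ℚ_p)` and finitely generated over the group ring `𝒪_L[GL₂(ℚ_p)]`. -/
def PiZeroOk (k : ℕ) (α β : L) (π0 : Set (ℚ_[p] → L)) : Prop :=
  (∀ f ∈ π0, f ∈ piRep p L k α β) ∧ ((0 : ℚ_[p] → L) ∈ π0) ∧
  (∀ f ∈ π0, ∀ g ∈ π0, f + g ∈ π0) ∧
  (∀ c : L, ‖c‖ ≤ 1 → ∀ f ∈ π0, c • f ∈ π0) ∧
  (∀ f ∈ piRep p L k α β, ∃ c : L, c ≠ 0 ∧ c • f ∈ π0) ∧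
  (∀ m : Matrix (Fin 2) (Fin 2) ℚ_[p], det2 p m ≠ 0 → ∀ f ∈ π0, gAct p L k α β m f ∈ π0) ∧
  (∃ s : Finset (ℚ_[p] → L), (↑s : Set (ℚ_[p] → L)) ⊆ π0 ∧ ∀ f ∈ π0,
    ∃ (nn : ℕ) (c : Fin nn → L) (mm : Fin nn → Matrix (Fin 2) (Fin 2) ℚ_[p])
      (gg : Fin nn → (ℚ_[p] → L)),
      (∀ i, ‖c i‖ ≤ 1) ∧ (∀ i, det2 p (mm i) ≠ 0) ∧ (∀ i, gg i ∈ s) ∧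
      f = ∑ i, c i • gAct p L k α β (mm i) (gg i))

/-- The gauge (semi)norm of `π⁰` : `‖f‖ = inf {‖c‖ : f ∈ c • π⁰}`. -/
noncomputable def gaugeN (π0 : Set (ℚ_[p] → L)) (f : ℚ_[p] → L) : ℝ :=
  sInf {x : ℝ | ∃ c : L, x = ‖c‖ ∧ ∃ g ∈ π0, f = c • g}

section MahlerTheory

set_option linter.unusedSectionVars false

variable {p} {L}

/-! ### Mahler coefficients and functions of class `C^r` -/

theorem binomQ_natCast (m n : ℕ) : binomQ p (m : ℤ_[p]) n = (m.choose n : ℚ_[p]) := by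
  have h : (∏ i ∈ Finset.range n, (((m : ℤ_[p]) : ℚ_[p]) - (i : ℚ_[p]))) =
      (m.descFactorial n : ℚ_[p]) := by
    rw [← descPochhammer_eval_eq_descFactorial, descPochhammer_eval_eq_prod_range]
    simp
  rw [binomQ, h, Nat.descFactorial_eq_factorial_mul_choose, Nat.cast_mul,
    mul_div_cancel_left₀ _ (by exact_mod_cast n.factorial_ne_zero)]

theorem continuous_binomQ (n : ℕ) : Continuous fun z : ℤ_[p] => binomQ p z n := by
  unfold binomQ
  refine Continuous.div_const (continuous_finsetProd _ fun i _ => ?_) _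
  exact continuous_subtype_val.sub continuous_const

theorem binomQ_eq_mahler (z : ℤ_[p]) (n : ℕ) : binomQ p z n = ((mahler n z : ℤ_[p]) : ℚ_[p]) := by
  have h := PadicInt.denseRange_natCast.equalizer (continuous_binomQ (p := p) n)
    (continuous_subtype_val.comp (map_continuous (mahler n : C(ℤ_[p], ℤ_[p]))))
    (funext fun m => by
      change binomQ p (m : ℤ_[p]) n = ((mahler n (m : ℤ_[p]) : ℤ_[p]) : ℚ_[p])
      rw [binomQ_natCast, mahler_natCast_eq, PadicInt.coe_natCast])
  exact congrFun h z

theorem norm_iotaL (x : ℚ_[p]) : ‖iotaL p L x‖ = ‖x‖ := norm_algebraMap' L x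

theorem continuous_iotaL : Continuous (iotaL p L) := continuous_algebraMap ℚ_[p] L

theorem norm_natCast_le [IsUltrametricDist L] (n : ℕ) : ‖(n : L)‖ ≤ 1 :=
  IsUltrametricDist.norm_natCast_le_one L n

theorem norm_p_eq : ‖(p : L)‖ = (p : ℝ)⁻¹ := by
  have : (p : L) = algebraMap ℚ_[p] L p := by simp
  rw [this, norm_algebraMap', Padic.norm_p]

theorem mahlerCoeff_eq_fwdDiff (f : ℤ_[p] → L) (n : ℕ) :
    mahlerCoeff p L f n = (fwdDiff (1 : ℤ_[p]))^[n] f 0 := by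
  rw [fwdDiff_iter_eq_sum_shift, mahlerCoeff, ← Finset.sum_range_reflect]
  refine Finset.sum_congr rfl fun i hi => ?_
  have hi' : i ≤ n := Nat.lt_succ_iff.mp (Finset.mem_range.mp hi)
  have h1 : n + 1 - 1 - i = n - i := by omega
  have h2 : n - (n - i) = i := by omega
  rw [h1, h2, Nat.choose_symm hi']
  simp [zsmul_eq_mul]

theorem mahlerCoeff_add (f g : ℤ_[p] → L) (n : ℕ) :
    mahlerCoeff p L (f + g) n = mahlerCoeff p L f n + mahlerCoeff p L g n := by
  simp [mahlerCoeff_eq_fwdDiff]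

theorem mahlerCoeff_smul (c : L) (f : ℤ_[p] → L) (n : ℕ) :
    mahlerCoeff p L (c • f) n = c * mahlerCoeff p L f n := by
  simp [mahlerCoeff_eq_fwdDiff]

theorem mahlerCoeff_sub (f g : ℤ_[p] → L) (n : ℕ) :
    mahlerCoeff p L (f - g) n = mahlerCoeff p L f n - mahlerCoeff p L g n := by
  have h : f - g = f + (-1 : L) • g := by simp [sub_eq_add_neg]
  rw [h, mahlerCoeff_add, mahlerCoeff_smul]
  ring

theorem norm_fwdDiff_iter_le [IsUltrametricDist L] {h : ℤ_[p]} {f : ℤ_[p] → L} {M : ℝ}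
    (hM : 0 ≤ M) (n : ℕ) (z : ℤ_[p]) (hf : ∀ i ≤ n, ‖f (z + i • h)‖ ≤ M) :
    ‖(fwdDiff h)^[n] f z‖ ≤ M := by
  rw [fwdDiff_iter_eq_sum_shift]
  refine IsUltrametricDist.norm_sum_le_of_forall_le_of_nonneg hM fun i hi => ?_
  refine (IsUltrametricDist.norm_zsmul_le _ _).trans (hf i ?_)
  exact Nat.lt_succ_iff.mp (Finset.mem_range.mp hi)

theorem norm_mahlerCoeff_le [IsUltrametricDist L] {f : ℤ_[p] → L} {M : ℝ} (hM : 0 ≤ M) (n : ℕ)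
    (hf : ∀ i : ℕ, i ≤ n → ‖f i‖ ≤ M) : ‖mahlerCoeff p L f n‖ ≤ M := by
  rw [mahlerCoeff_eq_fwdDiff]
  exact norm_fwdDiff_iter_le hM n 0 fun i hi => by simpa using hf i hi

theorem mahlerCoeff_congr {f g : ℤ_[p] → L} (n : ℕ) (h : ∀ i : ℕ, i ≤ n → f i = g i) :
    mahlerCoeff p L f n = mahlerCoeff p L g n := by
  unfold mahlerCoeff
  exact Finset.sum_congr rfl fun i _ => by rw [h _ (Nat.sub_le _ _)]

theorem apply_natCast_eq_sum (f : ℤ_[p] → L) (n : ℕ) :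
    f n = ∑ j ∈ Finset.range (n + 1), (n.choose j : L) * mahlerCoeff p L f j := by
  have h := shift_eq_sum_fwdDiff_iter (1 : ℤ_[p]) f n 0
  simpa [mahlerCoeff_eq_fwdDiff] using h

theorem norm_apply_natCast_le [IsUltrametricDist L] {f : ℤ_[p] → L} {M : ℝ} (hM : 0 ≤ M) (n : ℕ)
    (hf : ∀ j, ‖mahlerCoeff p L f j‖ ≤ M) : ‖f n‖ ≤ M := by
  rw [apply_natCast_eq_sum f n]
  refine IsUltrametricDist.norm_sum_le_of_forall_le_of_nonneg hM fun i _ => ?_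
  rw [norm_mul]
  exact (mul_le_of_le_one_left (norm_nonneg _) (norm_natCast_le _)).trans (hf i)

/-- `L` as a module over `ℤ_p`. -/
abbrev moduleZp : Module ℤ_[p] L := Module.compHom L (PadicInt.Coe.ringHom (p := p))

section Series

variable [IsUltrametricDist L] [CompleteSpace L]

theorem hasSum_mahler_of_continuous {f : ℤ_[p] → L} (hf : Continuous f) (z : ℤ_[p]) :
    HasSum (fun n : ℕ => mahlerCoeff p L f n * iotaL p L (binomQ p z n)) (f z) := by
  let _ : Module ℤ_[p] L := moduleZp
  have hsm (a : ℤ_[p]) (b : L) : a • b = iotaL p L (a : ℚ_[p]) * b :=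
    Algebra.smul_def (a : ℚ_[p]) b
  have : IsBoundedSMul ℤ_[p] L := IsBoundedSMul.of_norm_smul_le fun a b => by
    rw [hsm, norm_mul, norm_iotaL]; rfl
  have h := (ContinuousMap.evalCLM ℕ z : C(ℤ_[p], L) →L[ℕ] L).hasSum
    (PadicInt.hasSum_mahler (⟨f, hf⟩ : C(ℤ_[p], L)))
  change HasSum _ (f z) at h
  convert h using 1
  funext n
  change _ = PadicInt.mahlerTerm ((fwdDiff (1 : ℤ_[p]))^[n] f 0) n z
  rw [PadicInt.mahlerTerm_apply, hsm, mahlerCoeff_eq_fwdDiff, binomQ_eq_mahler, mul_comm]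

theorem continuous_of_hasSum_mahler {f : ℤ_[p] → L} {a : ℕ → L} (ha : Tendsto a atTop (𝓝 0))
    (hf : ∀ z, HasSum (fun n : ℕ => a n * iotaL p L (binomQ p z n)) (f z)) : Continuous f := by
  let _ : Module ℤ_[p] L := moduleZp
  have hsm (a : ℤ_[p]) (b : L) : a • b = iotaL p L (a : ℚ_[p]) * b :=
    Algebra.smul_def (a : ℚ_[p]) b
  have : IsBoundedSMul ℤ_[p] L := IsBoundedSMul.of_norm_smul_le fun a b => by
    rw [hsm, norm_mul, norm_iotaL]; rfl
  have h : f = (PadicInt.mahlerSeries a : C(ℤ_[p], L)) := by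
    funext z
    rw [PadicInt.mahlerSeries_apply ha, ← (hf z).tsum_eq]
    exact tsum_congr fun n => by rw [hsm, binomQ_eq_mahler, mul_comm]
  rw [h]
  exact map_continuous _

/-- The weighted bound `(n+1)^r ‖a_n(f)‖ ≤ M` on all Mahler coefficients of `f`. -/
def MahlerBound (r : ℝ) (f : ℤ_[p] → L) (M : ℝ) : Prop :=
  ∀ n : ℕ, ((n : ℝ) + 1) ^ r * ‖mahlerCoeff p L f n‖ ≤ M

theorem one_le_weight {r : ℝ} (hr : 0 ≤ r) (n : ℕ) : 1 ≤ ((n : ℝ) + 1) ^ r :=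
  Real.one_le_rpow (by linarith [n.cast_nonneg (α := ℝ)]) hr

end Series

end MahlerTheory

section ClassCr

set_option linter.unusedSectionVars false

variable {p} {L} [IsUltrametricDist L] [CompleteSpace L]

theorem MahlerBound.nonneg {r : ℝ} {f : ℤ_[p] → L} {M : ℝ} (h : MahlerBound r f M) : 0 ≤ M :=
  le_trans (by positivity) (h 0)

theorem MahlerBound.mono {r : ℝ} {f : ℤ_[p] → L} {M M' : ℝ} (h : MahlerBound r f M)
    (hM : M ≤ M') : MahlerBound r f M' := fun n => (h n).trans hM

theorem MahlerBound.add {r : ℝ} {f g : ℤ_[p] → L} {M : ℝ} (hf : MahlerBound r f M)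
    (hg : MahlerBound r g M) : MahlerBound r (f + g) M := fun n => by
  rw [mahlerCoeff_add]
  have hw : (0 : ℝ) ≤ ((n : ℝ) + 1) ^ r := by positivity
  refine (mul_le_mul_of_nonneg_left (IsUltrametricDist.norm_add_le_max _ _) hw).trans ?_
  rw [mul_max_of_nonneg _ _ hw]
  exact max_le (hf n) (hg n)

theorem MahlerBound.smul {r : ℝ} {f : ℤ_[p] → L} {M : ℝ} (hf : MahlerBound r f M) (c : L) :
    MahlerBound r (c • f) (‖c‖ * M) := fun n => by
  rw [mahlerCoeff_smul, norm_mul, mul_left_comm]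
  exact mul_le_mul_of_nonneg_left (hf n) (norm_nonneg _)

theorem mahlerBound_zero (r : ℝ) : MahlerBound r (0 : ℤ_[p] → L) 0 := fun n => by
  simp [mahlerCoeff]

theorem MahlerBound.sum {ι : Type*} {r : ℝ} {M : ℝ} (hM : 0 ≤ M) (s : Finset ι)
    {f : ι → ℤ_[p] → L} (h : ∀ i ∈ s, MahlerBound r (f i) M) :
    MahlerBound r (∑ i ∈ s, f i) M :=
  Finset.sum_induction f (fun g => MahlerBound r g M) (fun _ _ => MahlerBound.add)
    ((mahlerBound_zero r).mono hM) h

theorem MahlerBound.norm_coeff_le {r : ℝ} (hr : 0 ≤ r) {f : ℤ_[p] → L} {M : ℝ}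
    (h : MahlerBound r f M) (n : ℕ) : ‖mahlerCoeff p L f n‖ ≤ M :=
  (le_mul_of_one_le_left (norm_nonneg _) (one_le_weight hr n)).trans (h n)

theorem MahlerBound.norm_natCast_le {r : ℝ} (hr : 0 ≤ r) {f : ℤ_[p] → L} {M : ℝ}
    (h : MahlerBound r f M) (n : ℕ) : ‖f n‖ ≤ M :=
  norm_apply_natCast_le h.nonneg n fun j => h.norm_coeff_le hr j

theorem IsCr.continuous {r : ℝ} (hr : 0 ≤ r) {f : ℤ_[p] → L} (hf : IsCr p L r f) :
    Continuous f := by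
  refine continuous_of_hasSum_mahler ?_ hf.2
  rw [tendsto_zero_iff_norm_tendsto_zero]
  refine squeeze_zero' (Eventually.of_forall fun n => norm_nonneg _) ?_ hf.1
  filter_upwards [eventually_ge_atTop 1] with n hn
  exact le_mul_of_one_le_left (norm_nonneg _)
    (Real.one_le_rpow (by exact_mod_cast hn) hr)

theorem isCr_of_continuous {r : ℝ} {f : ℤ_[p] → L} (hf : Continuous f)
    (h : Tendsto (fun n : ℕ => (n : ℝ) ^ r * ‖mahlerCoeff p L f n‖) atTop (𝓝 0)) :
    IsCr p L r f := ⟨h, hasSum_mahler_of_continuous hf⟩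

theorem MahlerBound.isCr {r s : ℝ} (hr : 0 ≤ r) (hrs : r < s) {f : ℤ_[p] → L}
    (hf : Continuous f) {M : ℝ} (h : MahlerBound s f M) : IsCr p L r f := by
  refine isCr_of_continuous hf ?_
  have hlim : Tendsto (fun n : ℕ => ((n : ℝ)) ^ (-(s - r)) * M) atTop (𝓝 0) := by
    have := (tendsto_rpow_neg_atTop (sub_pos.2 hrs)).comp tendsto_natCast_atTop_atTop
    simpa using this.mul_const M
  refine squeeze_zero' (Eventually.of_forall fun n => by positivity) ?_ hlim
  filter_upwards [eventually_ge_atTop 1] with n hn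
  have hn0 : (0 : ℝ) < n := by exact_mod_cast hn
  have h1 : (n : ℝ) ^ r = (n : ℝ) ^ (-(s - r)) * (n : ℝ) ^ s := by
    rw [← Real.rpow_add hn0]; congr 1; ring
  rw [h1, mul_assoc]
  refine mul_le_mul_of_nonneg_left ((mul_le_mul_of_nonneg_right ?_ (norm_nonneg _)).trans (h n))
    (by positivity)
  exact Real.rpow_le_rpow hn0.le (by linarith) (by linarith)

theorem IsCr.tendsto_weight {r : ℝ} (hr : 0 ≤ r) {f : ℤ_[p] → L} (hf : IsCr p L r f) :
    Tendsto (fun n : ℕ => ((n : ℝ) + 1) ^ r * ‖mahlerCoeff p L f n‖) atTop (𝓝 0) := by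
  have h2 := hf.1.const_mul ((2 : ℝ) ^ r)
  rw [mul_zero] at h2
  refine squeeze_zero' (Eventually.of_forall fun n => by positivity) ?_ h2
  filter_upwards [eventually_ge_atTop 1] with n hn
  have hn0 : (1 : ℝ) ≤ n := by exact_mod_cast hn
  rw [← mul_assoc, ← Real.mul_rpow (by norm_num) (by linarith)]
  exact mul_le_mul_of_nonneg_right (Real.rpow_le_rpow (by linarith) (by linarith) hr)
    (norm_nonneg _)

theorem IsCr.mahlerBound {r : ℝ} (hr : 0 ≤ r) {f : ℤ_[p] → L} (hf : IsCr p L r f) :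
    MahlerBound r f (crNorm p L r f) := fun n =>
  le_ciSup (hf.tendsto_weight hr).bddAbove_range n

theorem MahlerBound.crNorm_le {r : ℝ} {f : ℤ_[p] → L} {M : ℝ} (h : MahlerBound r f M) :
    crNorm p L r f ≤ M := ciSup_le h

theorem isCr_zero (r : ℝ) : IsCr p L r 0 := by
  have h : ∀ n, mahlerCoeff p L (0 : ℤ_[p] → L) n = 0 := fun n => by simp [mahlerCoeff]
  refine ⟨by simp [h], fun z => ?_⟩
  simp [h]

theorem IsCr.add {r : ℝ} {f g : ℤ_[p] → L} (hf : IsCr p L r f) (hg : IsCr p L r g) :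
    IsCr p L r (f + g) := by
  refine ⟨?_, fun z => ?_⟩
  · refine squeeze_zero (fun n => by positivity) (fun n => ?_) (by simpa using hf.1.add hg.1)
    rw [mahlerCoeff_add, ← mul_add]
    exact mul_le_mul_of_nonneg_left (norm_add_le _ _) (by positivity)
  · simpa [mahlerCoeff_add, add_mul] using (hf.2 z).add (hg.2 z)

theorem IsCr.smul {r : ℝ} {f : ℤ_[p] → L} (hf : IsCr p L r f) (c : L) :
    IsCr p L r (c • f) := by
  refine ⟨?_, fun z => ?_⟩
  · simpa [mahlerCoeff_smul, mul_left_comm] using hf.1.const_mul ‖c‖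
  · simpa [mahlerCoeff_smul, mul_assoc] using (hf.2 z).mul_left c

theorem IsCr.sub {r : ℝ} {f g : ℤ_[p] → L} (hf : IsCr p L r f) (hg : IsCr p L r g) :
    IsCr p L r (f - g) := by
  have h := hf.add (hg.smul (-1))
  rwa [neg_one_smul, ← sub_eq_add_neg] at h

theorem isCr_of_approx {r : ℝ} {f : ℤ_[p] → L} (hf : Continuous f)
    (h : ∀ ε : ℝ, 0 < ε → ∃ g, IsCr p L r g ∧ MahlerBound r (f - g) ε) (hr : 0 ≤ r) :
    IsCr p L r f := by
  refine isCr_of_continuous hf ?_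
  rw [Metric.tendsto_atTop]
  intro ε hε
  obtain ⟨g, hg, hfg⟩ := h (ε / 2) (by linarith)
  obtain ⟨N, hN⟩ := (Metric.tendsto_atTop.1 hg.1) (ε / 2) (by linarith)
  refine ⟨N, fun n hn => ?_⟩
  have h1 := hN n hn
  rw [Real.dist_eq, sub_zero, abs_of_nonneg (by positivity)] at h1 ⊢
  have h2 := hfg n
  have h3 : mahlerCoeff p L f n = mahlerCoeff p L (f - g) n + mahlerCoeff p L g n := by
    rw [mahlerCoeff_sub]; ring
  have h4 : (n : ℝ) ^ r * ‖mahlerCoeff p L (f - g) n‖ ≤ ε / 2 :=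
    (mul_le_mul_of_nonneg_right (Real.rpow_le_rpow (by positivity) (by linarith) hr)
      (norm_nonneg _)).trans h2
  calc (n : ℝ) ^ r * ‖mahlerCoeff p L f n‖
      ≤ (n : ℝ) ^ r * (‖mahlerCoeff p L (f - g) n‖ + ‖mahlerCoeff p L g n‖) := by
        rw [h3]; exact mul_le_mul_of_nonneg_left (norm_add_le _ _) (by positivity)
    _ < ε := by rw [mul_add]; linarith

end ClassCr

section LocallyPolynomial

set_option linter.unusedSectionVars false

open Polynomial in
theorem exists_sub_one_pow_char_pow (q : ℕ) [Fact q.Prime] (N : ℕ) :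
    ∃ Q : ℤ[X], (X - 1) ^ q ^ N = (X ^ q ^ N - 1) + C (q : ℤ) * Q := by
  have h : C (q : ℤ) ∣ ((X - 1) ^ q ^ N - (X ^ q ^ N - 1) : ℤ[X]) := by
    rw [C_dvd_iff_dvd_coeff]
    intro i
    rw [← ZMod.intCast_zmod_eq_zero_iff_dvd]
    have h0 : (((X - 1) ^ q ^ N - (X ^ q ^ N - 1) : ℤ[X]).map (Int.castRingHom (ZMod q))) = 0 := by
      simp [sub_pow_char_pow]
    have h1 := congrArg (fun P => P.coeff i) h0
    simpa only [coeff_map, coeff_zero, eq_intCast] using h1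
  obtain ⟨Q, hQ⟩ := h
  exact ⟨Q, by rw [← hQ]; ring⟩

theorem exists_add_mul_pow_eq {R : Type*} [CommRing R] (A B t : R) (m e : ℕ) :
    ∃ U V, (A + t * B) ^ m = A ^ e * U + t ^ (m + 1 - e) * V := by
  induction m generalizing e with
  | zero =>
    rcases e with - | e
    · exact ⟨1, 0, by simp⟩
    · exact ⟨0, 1, by simp⟩
  | succ m ih =>
    rcases e with - | e
    · exact ⟨(A + t * B) ^ (m + 1), 0, by simp⟩
    · obtain ⟨U, V, h⟩ := ih e
      obtain ⟨U', V', h'⟩ := ih (e + 1)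
      obtain ⟨s, hs⟩ : ∃ s, t * t ^ (m + 1 - (e + 1)) = t ^ (m + 1 + 1 - (e + 1)) * s := by
        rw [← pow_succ']
        exact pow_dvd_pow t (by omega)
      have h3 : m + 1 + 1 - (e + 1) = m + 1 - e := by omega
      refine ⟨U + t * B * U', A * V + B * s * V', ?_⟩
      calc (A + t * B) ^ (m + 1) = A * (A + t * B) ^ m + t * B * (A + t * B) ^ m := by ring
        _ = A * (A ^ e * U + t ^ (m + 1 - e) * V) +
            t * B * (A ^ (e + 1) * U' + t ^ (m + 1 - (e + 1)) * V') := by rw [← h, ← h']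
        _ = A ^ (e + 1) * (U + t * B * U') + t ^ (m + 1 - e) * (A * V) +
            (t * t ^ (m + 1 - (e + 1))) * (B * V') := by ring
        _ = _ := by rw [hs, h3]; ring

theorem exists_weight_bound (q : ℕ) (hq : 2 ≤ q) (r : ℝ) (d : ℕ) :
    ∃ K : ℝ, 0 ≤ K ∧ ∀ m : ℕ, ((m : ℝ) + 1) ^ r * ((q : ℝ)⁻¹) ^ (m - d) ≤ K := by
  have hq' : (2 : ℝ) ≤ q := by exact_mod_cast hq
  have hx1 : (q : ℝ)⁻¹ < 1 := inv_lt_one_of_one_lt₀ (by linarith)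
  obtain ⟨e, he⟩ := exists_nat_ge r
  have h := (tendsto_pow_const_mul_const_pow_of_abs_lt_one e
    (by rw [abs_of_nonneg (by positivity)]; exact hx1 : |(q : ℝ)⁻¹| < 1)).comp
    (tendsto_add_atTop_nat 1)
  obtain ⟨K, hK⟩ := h.bddAbove_range
  have hK' : ∀ m : ℕ, ((m : ℝ) + 1) ^ e * ((q : ℝ)⁻¹) ^ (m + 1) ≤ K := fun m => by
    have := hK ⟨m, rfl⟩
    simpa using this
  have hK0 : 0 ≤ K := le_trans (by positivity) (hK' 0)
  refine ⟨K * (q : ℝ) ^ (d + 1), by positivity, fun m => ?_⟩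
  have h1 : ((m : ℝ) + 1) ^ r ≤ ((m : ℝ) + 1) ^ e := by
    rw [← Real.rpow_natCast]
    exact Real.rpow_le_rpow_of_exponent_le (by linarith [m.cast_nonneg (α := ℝ)]) he
  have h2 : ((q : ℝ)⁻¹) ^ (m - d) ≤ ((q : ℝ)⁻¹) ^ (m + 1) * (q : ℝ) ^ (d + 1) := by
    have h3 : ((q : ℝ)⁻¹) ^ (m - d) =
        ((q : ℝ)⁻¹) ^ ((m - d) + (d + 1)) * (q : ℝ) ^ (d + 1) := by
      rw [pow_add, mul_assoc, ← mul_pow, inv_mul_cancel₀ (by positivity), one_pow, mul_one]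
    rw [h3]
    refine mul_le_mul_of_nonneg_right ?_ (by positivity)
    exact pow_le_pow_of_le_one (by positivity) hx1.le (by omega)
  calc ((m : ℝ) + 1) ^ r * ((q : ℝ)⁻¹) ^ (m - d)
      ≤ ((m : ℝ) + 1) ^ e * (((q : ℝ)⁻¹) ^ (m + 1) * (q : ℝ) ^ (d + 1)) := by
        gcongr
    _ ≤ K * (q : ℝ) ^ (d + 1) := by
        rw [← mul_assoc]
        exact mul_le_mul_of_nonneg_right (hK' m) (by positivity)

variable {p} {L} [IsUltrametricDist L] [CompleteSpace L]

/-- The action of an integral polynomial in the shift operator `f ↦ f(· + 1)`. -/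
def shiftOp (P : Polynomial ℤ) (f : ℤ_[p] → L) : ℤ_[p] → L :=
  Polynomial.aeval (fwdDiff_aux.shiftₗ ℤ_[p] L 1) P f

theorem shiftOp_mul (P Q : Polynomial ℤ) (f : ℤ_[p] → L) :
    shiftOp (P * Q) f = shiftOp P (shiftOp Q f) := by
  simp [shiftOp, Module.End.mul_apply]

theorem shiftOp_add (P Q : Polynomial ℤ) (f : ℤ_[p] → L) :
    shiftOp (P + Q) f = shiftOp P f + shiftOp Q f := by
  simp [shiftOp]

theorem shiftOp_zero_right (P : Polynomial ℤ) : shiftOp P (0 : ℤ_[p] → L) = 0 := by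
  simp [shiftOp]

theorem shiftOp_C (c : ℤ) (f : ℤ_[p] → L) : shiftOp (Polynomial.C c) f = c • f := by
  simp [shiftOp]

theorem shiftOp_X_pow (n : ℕ) (f : ℤ_[p] → L) (z : ℤ_[p]) :
    shiftOp (Polynomial.X ^ n) f z = f (z + n) := by
  rw [shiftOp, map_pow, Polynomial.aeval_X, fwdDiff_aux.shiftₗ_pow_apply]
  simp

theorem shiftOp_X_pow_sub_one (n : ℕ) (f : ℤ_[p] → L) :
    shiftOp (Polynomial.X ^ n - 1) f = fwdDiff (n : ℤ_[p]) f := by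
  funext z
  rw [sub_eq_add_neg, shiftOp_add, Pi.add_apply, shiftOp_X_pow,
    show (-1 : Polynomial ℤ) = Polynomial.C (-1) by simp, shiftOp_C]
  simp [fwdDiff, sub_eq_add_neg]

theorem shiftOp_iter (n e : ℕ) (f : ℤ_[p] → L) :
    shiftOp ((Polynomial.X ^ n - 1) ^ e) f = (fwdDiff (n : ℤ_[p]))^[e] f := by
  induction e with
  | zero => simp [shiftOp]
  | succ e ih => rw [pow_succ', shiftOp_mul, ih, shiftOp_X_pow_sub_one, Function.iterate_succ_apply']

theorem norm_shiftOp_le (P : Polynomial ℤ) {f : ℤ_[p] → L} {M : ℝ}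
    (hf : ∀ n : ℕ, ‖f n‖ ≤ M) (m : ℕ) : ‖shiftOp P f m‖ ≤ M := by
  induction P using Polynomial.induction_on' with
  | add P Q hP hQ =>
    rw [shiftOp_add]
    exact (IsUltrametricDist.norm_add_le_max _ _).trans (max_le hP hQ)
  | monomial n c =>
    rw [← Polynomial.C_mul_X_pow_eq_monomial, shiftOp_mul, shiftOp_C, Pi.smul_apply, shiftOp_X_pow]
    refine (IsUltrametricDist.norm_zsmul_le _ _).trans ?_
    exact_mod_cast hf (m + n)

/-- `φ` is continuous and locally polynomial of degree at most `d` on the cosets of `p^N ℤ_p`,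
expressed by the vanishing of its `(d+1)`-st difference with step `p^N`. -/
def LP (d N : ℕ) (φ : ℤ_[p] → L) : Prop :=
  Continuous φ ∧ (fwdDiff ((p ^ N : ℕ) : ℤ_[p]))^[d + 1] φ = 0

theorem LP.add {d N : ℕ} {φ ψ : ℤ_[p] → L} (h : LP d N φ) (h' : LP d N ψ) : LP d N (φ + ψ) :=
  ⟨h.1.add h'.1, by rw [fwdDiff_iter_add, h.2, h'.2, add_zero]⟩

theorem LP.smul {d N : ℕ} {φ : ℤ_[p] → L} (h : LP d N φ) (c : L) : LP d N (c • φ) :=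
  ⟨h.1.const_smul c, by rw [fwdDiff_iter_const_smul, h.2, smul_zero]⟩

theorem LP.sub {d N : ℕ} {φ ψ : ℤ_[p] → L} (h : LP d N φ) (h' : LP d N ψ) : LP d N (φ - ψ) := by
  have h := h.add (h'.smul (-1))
  rwa [neg_one_smul, ← sub_eq_add_neg] at h

theorem lp_zero (d N : ℕ) : LP d N (0 : ℤ_[p] → L) := by
  refine ⟨continuous_const, ?_⟩
  rw [← shiftOp_iter, shiftOp_zero_right]

theorem LP.sum {ι : Type*} {d N : ℕ} (s : Finset ι) {f : ι → ℤ_[p] → L}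
    (h : ∀ i ∈ s, LP d N (f i)) : LP d N (∑ i ∈ s, f i) :=
  Finset.sum_induction f (fun g => LP d N g) (fun _ _ => LP.add) (lp_zero d N) h

theorem LP.mono {d N N' : ℕ} (hN : N ≤ N') {φ : ℤ_[p] → L} (h : LP d N φ) : LP d N' φ := by
  refine ⟨h.1, ?_⟩
  obtain ⟨W, hW⟩ : (Polynomial.X ^ p ^ N - 1 : Polynomial ℤ) ∣ Polynomial.X ^ p ^ N' - 1 := by
    have h := sub_dvd_pow_sub_pow (Polynomial.X ^ p ^ N : Polynomial ℤ) 1 (p ^ (N' - N))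
    rwa [one_pow, ← pow_mul, ← pow_add, Nat.add_sub_cancel' hN] at h
  rw [← shiftOp_iter, hW, mul_pow, mul_comm, shiftOp_mul, shiftOp_iter, h.2, shiftOp_zero_right]

theorem fwdDiff_iter_eval_eq_zero {d : ℕ} {P : Polynomial L} (hP : P.natDegree ≤ d) (h z : ℤ_[p]) :
    (fwdDiff h)^[d + 1] (fun z : ℤ_[p] => P.eval (iotaL p L z)) z = 0 := by
  set Q : Polynomial L :=
    P.comp (Polynomial.C (iotaL p L h) * Polynomial.X + Polynomial.C (iotaL p L z)) with hQ
  have hdeg : Q.natDegree < d + 1 := by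
    refine Nat.lt_succ_of_le (Polynomial.natDegree_comp_le.trans ?_)
    refine (Nat.mul_le_mul hP Polynomial.natDegree_linear_le).trans (by simp)
  have h0 := congrFun (Polynomial.fwdDiff_iter_eq_zero_of_degree_lt hdeg) 0
  rw [fwdDiff_iter_eq_sum_shift] at h0 ⊢
  rw [Pi.zero_apply] at h0
  rw [← h0]
  refine Finset.sum_congr rfl fun i _ => ?_
  congr 1
  simp only [hQ, Polynomial.eval_comp]
  congr 1
  simp [iotaL]
  ring

theorem lp_locConst_mul_eval {d N : ℕ} {c : ℤ_[p] → L}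
    (hc : ∀ z z' : ℤ_[p], ‖z - z'‖ ≤ (p : ℝ) ^ (-(N : ℤ)) → c z = c z') {P : Polynomial L}
    (hP : P.natDegree ≤ d) : LP d N fun z => c z * P.eval (iotaL p L z) := by
  have hp : (0 : ℝ) < p := by exact_mod_cast (Fact.out : p.Prime).pos
  refine ⟨?_, ?_⟩
  · refine Continuous.mul ?_ (P.continuous.comp (continuous_iotaL.comp continuous_subtype_val))
    refine (IsLocallyConstant.iff_exists_open c).2 (fun z => ?_) |>.continuous
    refine ⟨Metric.ball z ((p : ℝ) ^ (-(N : ℤ))), Metric.isOpen_ball,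
      Metric.mem_ball_self (by positivity), fun z' hz' => hc _ _ ?_⟩
    rw [← dist_eq_norm]
    exact (Metric.mem_ball.1 hz').le
  · funext z
    have h0 := fwdDiff_iter_eval_eq_zero hP ((p ^ N : ℕ) : ℤ_[p]) z
    rw [fwdDiff_iter_eq_sum_shift] at h0 ⊢
    have : ∀ i : ℕ, c (z + i • ((p ^ N : ℕ) : ℤ_[p])) = c z := fun i => hc _ _ (by
      rw [add_sub_cancel_left, nsmul_eq_mul, norm_mul]
      refine (mul_le_of_le_one_left (norm_nonneg _) (PadicInt.norm_le_one _)).trans ?_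
      rw [Nat.cast_pow, PadicInt.norm_p_pow])
    simp only [this]
    have h1 := congrArg (fun t => c z * t) h0
    simp only [mul_zero, Finset.mul_sum] at h1
    rw [Pi.zero_apply, ← h1]
    exact Finset.sum_congr rfl fun i _ => by simp only [zsmul_eq_mul]; ring

theorem LP.norm_mahlerCoeff_add_le {d N : ℕ} {φ : ℤ_[p] → L} (h : LP d N φ) {M : ℝ}
    (hM : ∀ n : ℕ, ‖φ n‖ ≤ M) (m s : ℕ) :
    ‖mahlerCoeff p L φ (p ^ N * m + s)‖ ≤ ((p : ℝ)⁻¹) ^ (m - d) * M := by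
  obtain ⟨Q, hQ⟩ := exists_sub_one_pow_char_pow p N
  obtain ⟨U, V, hUV⟩ := exists_add_mul_pow_eq (Polynomial.X ^ p ^ N - 1 : Polynomial ℤ) Q
    (Polynomial.C (p : ℤ)) m (d + 1)
  have h1 : (Polynomial.X - 1 : Polynomial ℤ) ^ (p ^ N * m + s) =
      ((Polynomial.X - 1) ^ s * U) * (Polynomial.X ^ p ^ N - 1) ^ (d + 1) +
      Polynomial.C ((p : ℤ) ^ (m - d)) * ((Polynomial.X - 1) ^ s * V) := by
    rw [pow_add, pow_mul, hQ, hUV, Nat.add_sub_add_right, map_pow]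
    ring
  have h2 : mahlerCoeff p L φ (p ^ N * m + s) =
      shiftOp ((Polynomial.X - 1) ^ (p ^ N * m + s)) φ ((0 : ℕ) : ℤ_[p]) := by
    rw [mahlerCoeff_eq_fwdDiff]
    have := shiftOp_iter 1 (p ^ N * m + s) φ
    rw [pow_one, Nat.cast_one] at this
    rw [this, Nat.cast_zero]
  have h3 : ‖((p : ℤ) ^ (m - d) : ℤ) • shiftOp ((Polynomial.X - 1) ^ s * V) φ ((0 : ℕ) : ℤ_[p])‖ ≤
      ((p : ℝ)⁻¹) ^ (m - d) * M := by
    rw [zsmul_eq_mul, norm_mul, Int.cast_pow, Int.cast_natCast, norm_pow, norm_p_eq]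
    exact mul_le_mul_of_nonneg_left (norm_shiftOp_le _ hM 0) (by positivity)
  rw [h2, h1, shiftOp_add, shiftOp_mul _ ((Polynomial.X ^ p ^ N - 1) ^ (d + 1)), shiftOp_iter, h.2,
    shiftOp_zero_right, zero_add, shiftOp_mul, shiftOp_C, Pi.smul_apply]
  exact h3

theorem LP.norm_mahlerCoeff_le {d N : ℕ} {φ : ℤ_[p] → L} (h : LP d N φ) {M : ℝ}
    (hM : ∀ n : ℕ, ‖φ n‖ ≤ M) (n : ℕ) :
    ‖mahlerCoeff p L φ n‖ ≤ ((p : ℝ)⁻¹) ^ (n / p ^ N - d) * M := by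
  have h1 := h.norm_mahlerCoeff_add_le hM (n / p ^ N) (n % p ^ N)
  rwa [Nat.div_add_mod] at h1

theorem exists_lp_mahlerBound (p : ℕ) [Fact p.Prime] (L : Type) [NontriviallyNormedField L]
    [NormedAlgebra ℚ_[p] L] [IsUltrametricDist L] [CompleteSpace L] {r : ℝ} (hr : 0 ≤ r) (d : ℕ) :
    ∃ K : ℝ, 0 ≤ K ∧ ∀ (N : ℕ) (φ : ℤ_[p] → L) (M : ℝ), LP d N φ → (∀ n : ℕ, ‖φ n‖ ≤ M) →
      MahlerBound r φ (K * (p : ℝ) ^ ((N : ℝ) * r) * M) := by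
  have hp : (0 : ℝ) < p := by exact_mod_cast (Fact.out : p.Prime).pos
  obtain ⟨K, hK0, hK⟩ := exists_weight_bound p (Fact.out : p.Prime).two_le r d
  refine ⟨K, hK0, fun N φ M h hM n => ?_⟩
  have hM0 : 0 ≤ M := (norm_nonneg _).trans (hM 0)
  have h1 := h.norm_mahlerCoeff_le hM n
  have h2 : ((n : ℝ) + 1) ^ r ≤ (p : ℝ) ^ ((N : ℝ) * r) * (((n / p ^ N : ℕ) : ℝ) + 1) ^ r := by
    rw [Real.rpow_mul hp.le, ← Real.mul_rpow (by positivity) (by positivity)]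
    refine Real.rpow_le_rpow (by positivity) ?_ hr
    rw [Real.rpow_natCast]
    have h3 : n + 1 ≤ p ^ N * (n / p ^ N + 1) :=
      Nat.lt_mul_div_succ n (Nat.pow_pos (Fact.out : p.Prime).pos)
    exact_mod_cast h3
  calc ((n : ℝ) + 1) ^ r * ‖mahlerCoeff p L φ n‖
      ≤ ((p : ℝ) ^ ((N : ℝ) * r) * (((n / p ^ N : ℕ) : ℝ) + 1) ^ r) *
        (((p : ℝ)⁻¹) ^ (n / p ^ N - d) * M) := by gcongr
    _ = ((((n / p ^ N : ℕ) : ℝ) + 1) ^ r * ((p : ℝ)⁻¹) ^ (n / p ^ N - d)) *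
        ((p : ℝ) ^ ((N : ℝ) * r) * M) := by ring
    _ ≤ K * ((p : ℝ) ^ ((N : ℝ) * r) * M) := by gcongr; exact hK _
    _ = _ := by ring

theorem LP.exists_bound {d N : ℕ} {φ : ℤ_[p] → L} (h : LP d N φ) :
    ∃ M, ∀ z, ‖φ z‖ ≤ M := by
  obtain ⟨M, hM⟩ := (isCompact_univ.image h.1).isBounded.exists_norm_le
  exact ⟨M, fun z => hM _ ⟨z, trivial, rfl⟩⟩

theorem LP.isCr {d N : ℕ} {φ : ℤ_[p] → L} (h : LP d N φ) {r : ℝ} (hr : 0 ≤ r) :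
    IsCr p L r φ := by
  obtain ⟨K, -, hK⟩ := exists_lp_mahlerBound p L (by linarith : 0 ≤ r + 1) d
  obtain ⟨M, hM⟩ := h.exists_bound
  exact (hK N φ M h fun n => hM n).isCr hr (by linarith) h.1

end LocallyPolynomial

section Differences

set_option linter.unusedSectionVars false

variable {p} {L} [IsUltrametricDist L] [CompleteSpace L]

theorem p_pos : (0 : ℝ) < p := by exact_mod_cast (Fact.out : p.Prime).pos

theorem one_lt_p : (1 : ℝ) < p := by exact_mod_cast (Fact.out : p.Prime).one_lt

theorem natCast_eq_iotaL (n : ℕ) : (n : L) = iotaL p L n := by simp [iotaL]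

theorem inv_le_norm_natCast {i : ℕ} (hi : 0 < i) : (i : ℝ)⁻¹ ≤ ‖(i : ℚ_[p])‖ := by
  have hi' : (i : ℚ_[p]) ≠ 0 := by exact_mod_cast hi.ne'
  rw [Padic.norm_eq_zpow_neg_valuation hi', Padic.valuation_natCast, zpow_neg, zpow_natCast]
  have h : p ^ padicValNat p i ≤ i := Nat.le_of_dvd hi pow_padicValNat_dvd
  have h' : ((p : ℝ) ^ padicValNat p i) ≤ i := by exact_mod_cast h
  exact inv_anti₀ (pow_pos p_pos _) h'

theorem norm_choose_le (N i : ℕ) :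
    ‖((p ^ N).choose (i + 1) : L)‖ ≤ ((i : ℝ) + 1) * ((p : ℝ) ^ N)⁻¹ := by
  obtain ⟨q, hq⟩ : ∃ q, p ^ N = q + 1 :=
    ⟨p ^ N - 1, (Nat.sub_add_cancel (Nat.pow_pos (Fact.out : p.Prime).pos)).symm⟩
  have h := Nat.add_one_mul_choose_eq q i
  rw [← hq] at h
  have h1 : ‖(q.choose i : ℚ_[p])‖ ≤ 1 := by exact_mod_cast Padic.norm_int_le_one (q.choose i : ℤ)
  have h2 : ‖((p ^ N : ℕ) : ℚ_[p])‖ = ((p : ℝ) ^ N)⁻¹ := by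
    rw [Nat.cast_pow, norm_pow, Padic.norm_p, inv_pow]
  have h3 : ‖((p ^ N : ℕ) : ℚ_[p])‖ * ‖(q.choose i : ℚ_[p])‖ =
      ‖((p ^ N).choose (i + 1) : ℚ_[p])‖ * ‖((i + 1 : ℕ) : ℚ_[p])‖ := by
    rw [← norm_mul, ← norm_mul]; exact_mod_cast congrArg (fun t : ℕ => ‖(t : ℚ_[p])‖) h
  have h4 := inv_le_norm_natCast (p := p) (Nat.succ_pos i)
  rw [Nat.succ_eq_add_one] at h4
  rw [natCast_eq_iotaL (p := p), norm_iotaL]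
  have h5 : ‖((p ^ N).choose (i + 1) : ℚ_[p])‖ * ((i + 1 : ℕ) : ℝ)⁻¹ ≤ ((p : ℝ) ^ N)⁻¹ := by
    refine (mul_le_mul_of_nonneg_left h4 (norm_nonneg _)).trans ?_
    rw [← h3, h2]
    exact mul_le_of_le_one_right (by positivity) h1
  have hi : (0 : ℝ) < ((i + 1 : ℕ) : ℝ) := by positivity
  rw [mul_inv_le_iff₀ hi] at h5
  push_cast at h5
  linarith

theorem mahlerCoeff_fwdDiff (φ : ℤ_[p] → L) (q m : ℕ) :
    mahlerCoeff p L (fwdDiff (q : ℤ_[p]) φ) m =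
      ∑ i ∈ Finset.range q, (q.choose (i + 1) : L) * mahlerCoeff p L φ (m + (i + 1)) := by
  have h1 : ∀ n (f : ℤ_[p] → L), mahlerCoeff p L f n = shiftOp ((Polynomial.X - 1) ^ n) f 0 := by
    intro n f
    rw [mahlerCoeff_eq_fwdDiff]
    have := shiftOp_iter 1 n f
    rw [pow_one, Nat.cast_one] at this
    rw [this]
  have h2 : (Polynomial.X ^ q - 1 : Polynomial ℤ) = ∑ i ∈ Finset.range q,
      Polynomial.C (q.choose (i + 1) : ℤ) * (Polynomial.X - 1) ^ (i + 1) := by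
    have h := add_pow (Polynomial.X - 1 : Polynomial ℤ) 1 q
    rw [sub_add_cancel, Finset.sum_range_succ'] at h
    rw [h]
    simp [mul_comm]
  have h3 : ∀ (s : Finset ℕ) (P : ℕ → Polynomial ℤ),
      shiftOp (∑ i ∈ s, P i) φ 0 = ∑ i ∈ s, shiftOp (P i) φ 0 := by
    intro s P
    simp [shiftOp, LinearMap.sum_apply]
  rw [h1, ← shiftOp_X_pow_sub_one, ← shiftOp_mul, h2, Finset.mul_sum, h3]
  refine Finset.sum_congr rfl fun i _ => ?_
  rw [mul_left_comm, ← pow_add, shiftOp_mul, shiftOp_C, h1]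
  simp

theorem MahlerBound.fwdDiff_sub_one {s : ℝ} (hs : 1 ≤ s) {φ : ℤ_[p] → L} {M : ℝ}
    (h : MahlerBound s φ M) (N : ℕ) :
    MahlerBound (s - 1) (fwdDiff ((p ^ N : ℕ) : ℤ_[p]) φ) (((p : ℝ) ^ N)⁻¹ * M) := fun m => by
  have hp := p_pos (p := p)
  have hw : 0 < ((m : ℝ) + 1) ^ (s - 1) := by positivity
  rw [← le_div_iff₀' hw, mahlerCoeff_fwdDiff]
  refine IsUltrametricDist.norm_sum_le_of_forall_le_of_nonneg
    (div_nonneg (mul_nonneg (by positivity) h.nonneg) hw.le) fun i _ => ?_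
  rw [le_div_iff₀' hw, norm_mul]
  have h1 := h (m + (i + 1))
  have h2 := norm_choose_le (p := p) (L := L) N i
  set x : ℝ := ((m + (i + 1) : ℕ) : ℝ) + 1 with hx
  have hx' : x = (m : ℝ) + i + 2 := by rw [hx]; push_cast; ring
  have hx0 : 0 < x := by rw [hx]; positivity
  have h3 : ((m : ℝ) + 1) ^ (s - 1) * ((i : ℝ) + 1) ≤ x ^ s := by
    have : x ^ s = x ^ (s - 1) * x := by
      rw [← Real.rpow_add_one hx0.ne']; congr 1; ring
    rw [this]
    refine mul_le_mul (Real.rpow_le_rpow (by positivity) ?_ (by linarith)) ?_ (by positivity)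
      (by positivity) <;> rw [hx'] <;> linarith [m.cast_nonneg (α := ℝ), i.cast_nonneg (α := ℝ)]
  calc _ ≤ ((m : ℝ) + 1) ^ (s - 1) * ((((i : ℝ) + 1) * ((p : ℝ) ^ N)⁻¹) *
        ‖mahlerCoeff p L φ (m + (i + 1))‖) := by gcongr
    _ = ((p : ℝ) ^ N)⁻¹ * ((((m : ℝ) + 1) ^ (s - 1) * ((i : ℝ) + 1)) *
        ‖mahlerCoeff p L φ (m + (i + 1))‖) := by ring
    _ ≤ ((p : ℝ) ^ N)⁻¹ * (x ^ s * ‖mahlerCoeff p L φ (m + (i + 1))‖) := by gcongr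
    _ ≤ _ := by gcongr

theorem MahlerBound.fwdDiff_zero {s : ℝ} (hs0 : 0 ≤ s) (hs : s ≤ 1) {φ : ℤ_[p] → L} {M : ℝ}
    (h : MahlerBound s φ M) (N : ℕ) :
    MahlerBound 0 (fwdDiff ((p ^ N : ℕ) : ℤ_[p]) φ) ((p : ℝ) ^ (-((N : ℝ) * s)) * M) := fun m => by
  have hp := p_pos (p := p)
  rw [Real.rpow_zero, one_mul, mahlerCoeff_fwdDiff]
  refine IsUltrametricDist.norm_sum_le_of_forall_le_of_nonneg
    (mul_nonneg (by positivity) h.nonneg) fun i hi => ?_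
  rw [norm_mul]
  have h1 := h (m + (i + 1))
  have h2 := norm_choose_le (p := p) (L := L) N i
  set x : ℝ := ((m + (i + 1) : ℕ) : ℝ) + 1 with hx
  have hx' : x = (m : ℝ) + i + 2 := by rw [hx]; push_cast; ring
  have hx0 : 0 < x := by rw [hx]; positivity
  have hi1 : (i : ℝ) + 1 ≤ (p : ℝ) ^ N := by exact_mod_cast Finset.mem_range.1 hi
  have h3 : ((i : ℝ) + 1) * ((p : ℝ) ^ N)⁻¹ ≤ x ^ s * (p : ℝ) ^ (-((N : ℝ) * s)) := by
    have h5 : ((i : ℝ) + 1) * ((p : ℝ) ^ N)⁻¹ ≤ (((i : ℝ) + 1) * ((p : ℝ) ^ N)⁻¹) ^ s := by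
      have := Real.rpow_le_rpow_of_exponent_ge
        (by positivity : 0 < ((i : ℝ) + 1) * ((p : ℝ) ^ N)⁻¹)
        (by rw [mul_inv_le_iff₀ (by positivity)]; linarith) hs
      rwa [Real.rpow_one] at this
    refine h5.trans ?_
    rw [Real.mul_rpow (by positivity) (by positivity), Real.rpow_neg hp.le, Real.rpow_mul hp.le,
      Real.rpow_natCast, Real.inv_rpow (by positivity)]
    gcongr
    rw [hx']
    linarith [m.cast_nonneg (α := ℝ)]
  calc _ ≤ (x ^ s * (p : ℝ) ^ (-((N : ℝ) * s))) * ‖mahlerCoeff p L φ (m + (i + 1))‖ := by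
        gcongr; exact h2.trans h3
    _ = (p : ℝ) ^ (-((N : ℝ) * s)) * (x ^ s * ‖mahlerCoeff p L φ (m + (i + 1))‖) := by ring
    _ ≤ _ := by gcongr

theorem MahlerBound.fwdDiff_iter (N e : ℕ) {r : ℝ} (hr : 0 ≤ r) (hre : r ≤ e) {φ : ℤ_[p] → L}
    {M : ℝ} (h : MahlerBound r φ M) :
    MahlerBound 0 ((fwdDiff ((p ^ N : ℕ) : ℤ_[p]))^[e] φ) ((p : ℝ) ^ (-((N : ℝ) * r)) * M) := by
  have hp := p_pos (p := p)
  induction e generalizing r φ M with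
  | zero =>
    have hr0 : r = 0 := le_antisymm (by simpa using hre) hr
    subst hr0
    simpa using h
  | succ e ih =>
    rw [Function.iterate_succ_apply]
    push_cast at hre
    rcases le_total 1 r with h1 | h1
    · have h2 := ih (r := r - 1) (by linarith) (by linarith) (h.fwdDiff_sub_one h1 N)
      refine h2.mono (le_of_eq ?_)
      rw [← mul_assoc]
      congr 1
      rw [← Real.rpow_natCast, ← Real.rpow_neg hp.le, ← Real.rpow_add hp]
      congr 1
      ring
    · have h2 := ih le_rfl (by positivity) (h.fwdDiff_zero hr h1 N)
      simpa using h2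

theorem MahlerBound.norm_fwdDiff_iter_natCast_le (N e : ℕ) {r : ℝ} (hr : 0 ≤ r) (hre : r ≤ e)
    {φ : ℤ_[p] → L} {M : ℝ} (h : MahlerBound r φ M) (n : ℕ) :
    ‖(fwdDiff ((p ^ N : ℕ) : ℤ_[p]))^[e] φ n‖ ≤ (p : ℝ) ^ (-((N : ℝ) * r)) * M :=
  (h.fwdDiff_iter N e hr hre).norm_natCast_le le_rfl n

end Differences

section Projections

set_option linter.unusedSectionVars false

variable {p} {L} [IsUltrametricDist L] [CompleteSpace L]

theorem charZero_of_padic (p : ℕ) [Fact p.Prime] (L : Type) [NontriviallyNormedField L]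
    [NormedAlgebra ℚ_[p] L] : CharZero L :=
  charZero_of_injective_algebraMap (algebraMap ℚ_[p] L).injective

variable (L) in
/-- The binomial polynomial `X(X-1)⋯(X-j+1)/j!`. -/
def binPoly (j : ℕ) : Polynomial L :=
  Polynomial.C ((j.factorial : L)⁻¹) * descPochhammer L j

theorem binPoly_natDegree_le (j : ℕ) : (binPoly L j).natDegree ≤ j :=
  (Polynomial.natDegree_C_mul_le _ _).trans (descPochhammer_natDegree L j).le

theorem binPoly_eval_natCast (p : ℕ) [Fact p.Prime] [NormedAlgebra ℚ_[p] L] (j t : ℕ) :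
    (binPoly L j).eval (t : L) = (t.choose j : L) := by
  have := charZero_of_padic p L
  rw [binPoly, Polynomial.eval_mul, Polynomial.eval_C, descPochhammer_eval_eq_descFactorial,
    Nat.descFactorial_eq_factorial_mul_choose, Nat.cast_mul,
    inv_mul_cancel_left₀ (by exact_mod_cast j.factorial_ne_zero)]

variable (p L) in
/-- The function supported on `b + p^N ℤ_p` and equal to `binom((z-b)/p^N, j)` there. -/
def binBall (N b j : ℕ) : ℤ_[p] → L := fun z =>
  if ‖z - b‖ ≤ (p : ℝ) ^ (-(N : ℤ)) then
    (binPoly L j).eval ((iotaL p L z - b) / (p : L) ^ N) else 0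

theorem padicInt_norm_sub_le_trans {x y z : ℤ_[p]} {t : ℝ} (h : ‖x - y‖ ≤ t) (h' : ‖y - z‖ ≤ t) :
    ‖x - z‖ ≤ t := by
  have := PadicInt.nonarchimedean (x - y) (y - z)
  rw [sub_add_sub_cancel] at this
  exact this.trans (max_le h h')

theorem lp_binBall {d j : ℕ} (hj : j ≤ d) (N b : ℕ) : LP d N (binBall p L N b j) := by
  have hdeg : ((binPoly L j).comp (Polynomial.C ((p : L) ^ N)⁻¹ *
      (Polynomial.X - Polynomial.C (b : L)))).natDegree ≤ d := by
    refine Polynomial.natDegree_comp_le.trans ?_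
    refine (Nat.mul_le_mul (binPoly_natDegree_le j)
      ((Polynomial.natDegree_C_mul_le _ _).trans (Polynomial.natDegree_X_sub_C_le _))).trans ?_
    simpa using hj
  have h := lp_locConst_mul_eval (p := p) (L := L) (N := N)
    (c := fun z => if ‖z - b‖ ≤ (p : ℝ) ^ (-(N : ℤ)) then 1 else 0) (fun z z' hz => by
      refine if_congr ⟨fun h => ?_, fun h => ?_⟩ rfl rfl
      · exact padicInt_norm_sub_le_trans (by rwa [norm_sub_rev]) h
      · exact padicInt_norm_sub_le_trans hz h) hdeg
  convert h using 1
  funext z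
  simp only [binBall]
  split_ifs
  · simp [div_eq_inv_mul]
  · simp

theorem binBall_natCast {N b : ℕ} (hb : b < p ^ N) (j n : ℕ) :
    binBall p L N b j n = if b = n % p ^ N then ((n / p ^ N).choose j : L) else 0 := by
  have hcond : ‖(n : ℤ_[p]) - b‖ ≤ (p : ℝ) ^ (-(N : ℤ)) ↔ b = n % p ^ N := by
    have : (n : ℤ_[p]) - b = ((n - b : ℤ) : ℤ_[p]) := by push_cast; rfl
    rw [this, PadicInt.norm_int_le_pow_iff_dvd]
    have h2 := Nat.modEq_iff_dvd (n := p ^ N) (a := b) (b := n)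
    push_cast at h2
    rw [← h2, Nat.ModEq, Nat.mod_eq_of_lt hb]
  have hp0 : (p : L) ≠ 0 := by
    have := charZero_of_padic p L
    exact_mod_cast (Fact.out : p.Prime).ne_zero
  rw [binBall]
  refine ite_congr (propext hcond) (fun h => ?_) fun _ => rfl
  have h1 : (n : L) = (p : L) ^ N * ((n / p ^ N : ℕ) : L) + b := by
    have := Nat.div_add_mod n (p ^ N)
    rw [← h] at this
    exact_mod_cast congrArg (fun t : ℕ => (t : L)) this.symm
  have h2 : (iotaL p L ((n : ℤ_[p]) : ℚ_[p]) - b) / (p : L) ^ N = ((n / p ^ N : ℕ) : L) := by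
    rw [PadicInt.coe_natCast, ← natCast_eq_iotaL, h1, add_sub_cancel_right,
      mul_div_cancel_left₀ _ (pow_ne_zero _ hp0)]
  rw [h2, binPoly_eval_natCast p]

/-- The locally polynomial interpolation of `φ` of degree `d` on the cosets of `p^N ℤ_p`. -/
def lpProj (d N : ℕ) (φ : ℤ_[p] → L) : ℤ_[p] → L :=
  ∑ b ∈ Finset.range (p ^ N), ∑ j ∈ Finset.range (d + 1),
    ((fwdDiff ((p ^ N : ℕ) : ℤ_[p]))^[j] φ b) • binBall p L N b j

theorem lp_lpProj (d N : ℕ) (φ : ℤ_[p] → L) : LP d N (lpProj d N φ) :=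
  LP.sum _ fun b _ => LP.sum _ fun _ hj =>
    (lp_binBall (Nat.lt_succ_iff.1 (Finset.mem_range.1 hj)) N b).smul _

theorem lpProj_natCast (d N : ℕ) (φ : ℤ_[p] → L) (n : ℕ) :
    lpProj d N φ n = ∑ j ∈ Finset.range (d + 1),
      ((n / p ^ N).choose j : L) * (fwdDiff ((p ^ N : ℕ) : ℤ_[p]))^[j] φ ((n % p ^ N : ℕ) : ℤ_[p]) := by
  have hq : 0 < p ^ N := Nat.pow_pos (Fact.out : p.Prime).pos
  simp only [lpProj, Finset.sum_apply]
  rw [Finset.sum_eq_single (n % p ^ N)]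
  · refine Finset.sum_congr rfl fun j _ => ?_
    rw [Pi.smul_apply, binBall_natCast (Nat.mod_lt _ hq), if_pos rfl, smul_eq_mul, mul_comm]
  · intro b hb hne
    refine Finset.sum_eq_zero fun j _ => ?_
    rw [Pi.smul_apply, binBall_natCast (Finset.mem_range.1 hb), if_neg hne, smul_zero]
  · intro h
    exact absurd (Finset.mem_range.2 (Nat.mod_lt _ hq)) h

theorem apply_natCast_eq_lpProj_add (d N : ℕ) (φ : ℤ_[p] → L) (n : ℕ) :
    φ n = lpProj d N φ n + ∑ i ∈ Finset.range (n / p ^ N + 1),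
      ((n / p ^ N).choose (d + 1 + i) : L) * (fwdDiff ((p ^ N : ℕ) : ℤ_[p]))^[i]
        ((fwdDiff ((p ^ N : ℕ) : ℤ_[p]))^[d + 1] φ) ((n % p ^ N : ℕ) : ℤ_[p]) := by
  have h := shift_eq_sum_fwdDiff_iter ((p ^ N : ℕ) : ℤ_[p]) φ (n / p ^ N) ((n % p ^ N : ℕ) : ℤ_[p])
  have h1 : ((n % p ^ N : ℕ) : ℤ_[p]) + (n / p ^ N) • ((p ^ N : ℕ) : ℤ_[p]) = n := by
    rw [nsmul_eq_mul]
    have := Nat.mod_add_div n (p ^ N)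
    rw [mul_comm] at this
    exact_mod_cast congrArg (fun t : ℕ => (t : ℤ_[p])) this
  rw [h1] at h
  rw [h, lpProj_natCast]
  have h2 := Finset.sum_range_add (fun j => ((n / p ^ N).choose j : L) *
    (fwdDiff ((p ^ N : ℕ) : ℤ_[p]))^[j] φ ((n % p ^ N : ℕ) : ℤ_[p])) (d + 1) (n / p ^ N + 1)
  have h3 : ∀ i, (fwdDiff ((p ^ N : ℕ) : ℤ_[p]))^[d + 1 + i] φ =
      (fwdDiff ((p ^ N : ℕ) : ℤ_[p]))^[i] ((fwdDiff ((p ^ N : ℕ) : ℤ_[p]))^[d + 1] φ) := fun i => by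
    rw [add_comm, Function.iterate_add_apply]
  simp only [h3] at h2
  rw [← h2]
  rw [add_comm (d + 1), Finset.sum_range_add _ (n / p ^ N + 1) (d + 1)]
  simp only [nsmul_eq_mul]
  rw [eq_comm, add_eq_left]
  refine Finset.sum_eq_zero fun i _ => ?_
  rw [Nat.choose_eq_zero_of_lt (by omega), Nat.cast_zero, zero_mul]

theorem LP.lpProj_eq {d N : ℕ} {φ : ℤ_[p] → L} (h : LP d N φ) : lpProj d N φ = φ := by
  refine PadicInt.denseRange_natCast.equalizer (lp_lpProj d N φ).1 h.1 (funext fun n => ?_)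
  simp only [Function.comp_apply]
  rw [apply_natCast_eq_lpProj_add d N φ n, h.2]
  refine (add_eq_left.2 (Finset.sum_eq_zero fun i _ => ?_)).symm
  rw [← shiftOp_iter, shiftOp_zero_right, Pi.zero_apply, mul_zero]

theorem norm_fwdDiff_iter_natCast_le {φ : ℤ_[p] → L} {M : ℝ} (hM : ∀ n : ℕ, ‖φ n‖ ≤ M)
    (q i n : ℕ) : ‖(fwdDiff (q : ℤ_[p]))^[i] φ n‖ ≤ M := by
  refine norm_fwdDiff_iter_le ((norm_nonneg _).trans (hM 0)) i _ fun l _ => ?_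
  rw [nsmul_eq_mul]
  exact_mod_cast hM (n + l * q)

theorem MahlerBound.norm_sub_lpProj_le {d : ℕ} {r : ℝ} (hr : 0 ≤ r) (hrd : r ≤ d + 1)
    {φ : ℤ_[p] → L} {M : ℝ} (h : MahlerBound r φ M) (N n : ℕ) :
    ‖(φ - lpProj d N φ) n‖ ≤ (p : ℝ) ^ (-((N : ℝ) * r)) * M := by
  have hM := h.nonneg
  have hp := p_pos (p := p)
  rw [Pi.sub_apply, apply_natCast_eq_lpProj_add d N φ n, add_sub_cancel_left]
  refine IsUltrametricDist.norm_sum_le_of_forall_le_of_nonneg (by positivity) fun i _ => ?_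
  rw [norm_mul]
  refine (mul_le_of_le_one_left (norm_nonneg _) (Paper.norm_natCast_le _)).trans ?_
  exact Paper.norm_fwdDiff_iter_natCast_le (fun n => h.norm_fwdDiff_iter_natCast_le N (d + 1) hr
    (by push_cast; exact hrd) n) _ i _

theorem lpProj_sub (d N : ℕ) (φ ψ : ℤ_[p] → L) :
    lpProj d N (φ - ψ) = lpProj d N φ - lpProj d N ψ := by
  have h : ∀ j, (fwdDiff ((p ^ N : ℕ) : ℤ_[p]))^[j] (φ - ψ) =
      (fwdDiff ((p ^ N : ℕ) : ℤ_[p]))^[j] φ - (fwdDiff ((p ^ N : ℕ) : ℤ_[p]))^[j] ψ := fun j => by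
    have : φ - ψ = φ + (-1 : L) • ψ := by simp [sub_eq_add_neg]
    rw [this, fwdDiff_iter_add, fwdDiff_iter_const_smul]
    simp [sub_eq_add_neg]
  simp only [lpProj, h, Pi.sub_apply, sub_smul, Finset.sum_sub_distrib]

theorem lpProj_succ_sub (d N : ℕ) (φ : ℤ_[p] → L) :
    lpProj d (N + 1) φ - lpProj d N φ = lpProj d (N + 1) (φ - lpProj d N φ) := by
  rw [lpProj_sub, ((lp_lpProj d N φ).mono (Nat.le_succ N)).lpProj_eq]

/-- A gauge-type bound on all normalised `binBall` functions propagates to locally polynomial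
functions, with a constant depending only on the `C^r`-bound. -/
theorem LP.gauge_bound {E : Type*} [AddCommGroup E] [Module L E] (T : (ℤ_[p] → L) →ₗ[L] E)
    (G : ℝ → E → Prop) (hadd : ∀ M f g, G M f → G M g → G M (f + g))
    (hsmul : ∀ M (c : L) f, G M f → G (‖c‖ * M) (c • f))
    (hmono : ∀ M M' f, M ≤ M' → G M f → G M' f) (hzero : G 0 0)
    {d : ℕ} {r C : ℝ} (hr : 0 ≤ r) (hrd : r ≤ d + 1) (hC : 0 ≤ C)
    (hβ : ∀ N b j : ℕ, j ≤ d → G (C * (p : ℝ) ^ ((N : ℝ) * r)) (T (binBall p L N b j)))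
    {N : ℕ} {φ : ℤ_[p] → L} (hφ : LP d N φ) {M : ℝ} (hM : MahlerBound r φ M) :
    G (C * (p : ℝ) ^ r * M) (T φ) := by
  have hM0 := hM.nonneg
  have hp := p_pos (p := p)
  have hzero' : ∀ M, 0 ≤ M → G M 0 := fun M hM => hmono 0 M 0 hM hzero
  have hproj : ∀ (n : ℕ) (ψ : ℤ_[p] → L) (A : ℝ), (∀ i : ℕ, ‖ψ i‖ ≤ A) →
      G (A * (C * (p : ℝ) ^ ((n : ℝ) * r))) (T (lpProj d n ψ)) := by
    intro n ψ A hA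
    have hA0 : 0 ≤ A := (norm_nonneg _).trans (hA 0)
    simp only [lpProj, map_sum, map_smul]
    refine Finset.sum_induction _ (fun f => G _ f) (hadd _) (hzero' _ (by positivity))
      fun b _ => ?_
    refine Finset.sum_induction _ (fun f => G _ f) (hadd _) (hzero' _ (by positivity))
      fun j hj => ?_
    refine hmono _ _ _ ?_ (hsmul _ _ _ (hβ n b j (Nat.lt_succ_iff.1 (Finset.mem_range.1 hj))))
    exact mul_le_mul_of_nonneg_right (norm_fwdDiff_iter_natCast_le hA _ j b) (by positivity)
  have hp1 : (1 : ℝ) ≤ (p : ℝ) ^ r := Real.one_le_rpow one_lt_p.le hr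
  have key : ∀ n, G (C * (p : ℝ) ^ r * M) (T (lpProj d n φ)) := by
    intro n
    induction n with
    | zero =>
      refine hmono _ _ _ ?_ (hproj 0 φ M fun i => hM.norm_natCast_le hr i)
      simp only [Nat.cast_zero, zero_mul, Real.rpow_zero, mul_one]
      nlinarith [mul_nonneg hC hM0]
    | succ n ih =>
      have h1 := hproj (n + 1) _ _ fun i => hM.norm_sub_lpProj_le hr hrd n i
      rw [← lpProj_succ_sub] at h1
      have h2 := hadd _ _ _ ih (hmono _ (C * (p : ℝ) ^ r * M) _ (le_of_eq ?_) h1)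
      · rwa [← map_add, add_sub_cancel] at h2
      · have h3 : (p : ℝ) ^ (-((n : ℝ) * r)) * (p : ℝ) ^ (((n + 1 : ℕ) : ℝ) * r) = (p : ℝ) ^ r := by
          rw [← Real.rpow_add hp]
          congr 1
          push_cast
          ring
        rw [← h3]
        ring
  have := key N
  rwa [hφ.lpProj_eq] at this

theorem mahlerCoeff_binom (m n : ℕ) :
    mahlerCoeff p L (fun z => iotaL p L (binomQ p z m)) n = if n = m then 1 else 0 := by
  have h := fwdDiff_iter_choose_zero m n
  rw [fwdDiff_iter_eq_sum_shift] at h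
  rw [mahlerCoeff_eq_fwdDiff, fwdDiff_iter_eq_sum_shift]
  have hcast := congrArg (fun t : ℤ => (t : L)) h
  simp only [zero_add, smul_eq_mul, mul_one, nsmul_eq_mul, Int.cast_ite, Int.cast_one,
    Int.cast_zero, Int.cast_sum, Int.cast_mul, Int.cast_natCast, zsmul_eq_mul,
    binomQ_natCast, ← natCast_eq_iotaL] at hcast ⊢
  exact hcast

/-- A function of class `C^r` is approximated by locally polynomial functions of degree `d`,
as soon as `r < d + 1`. -/
theorem IsCr.exists_lp_approx {d : ℕ} {r : ℝ} (hr : 0 ≤ r) (hrd : r < d + 1) {φ : ℤ_[p] → L}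
    (hφ : IsCr p L r φ) {ε : ℝ} (hε : 0 < ε) :
    ∃ N φ', LP d N φ' ∧ MahlerBound r (φ - φ') ε := by
  have hp := p_pos (p := p)
  obtain ⟨n0, hn0⟩ := (Metric.tendsto_atTop.1 (hφ.tendsto_weight hr)) ε hε
  set ψ : ℤ_[p] → L := ∑ n ∈ Finset.range n0,
    mahlerCoeff p L φ n • fun z => iotaL p L (binomQ p z n) with hψ
  have hcoef : ∀ m, mahlerCoeff p L ψ m = if m < n0 then mahlerCoeff p L φ m else 0 := by
    intro m
    have hs : ∀ s : Finset ℕ, mahlerCoeff p L (∑ n ∈ s,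
        mahlerCoeff p L φ n • fun z => iotaL p L (binomQ p z n)) m =
        ∑ n ∈ s, if m = n then mahlerCoeff p L φ n else 0 := by
      intro s
      induction s using Finset.induction_on with
      | empty => simp [mahlerCoeff]
      | insert a s ha ih =>
        rw [Finset.sum_insert ha, Finset.sum_insert ha, mahlerCoeff_add, ih, mahlerCoeff_smul,
          mahlerCoeff_binom]
        simp
    rw [hψ, hs]
    simp
  have happ : MahlerBound r (φ - ψ) ε := fun n => by
    rw [mahlerCoeff_sub, hcoef]
    split_ifs with h
    · simpa using hε.le
    · have := hn0 n (not_lt.1 h)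
      rw [Real.dist_eq, sub_zero, abs_of_nonneg (by positivity)] at this
      rw [sub_zero]
      exact this.le
  obtain ⟨M, hM⟩ : ∃ M, MahlerBound ((d : ℝ) + 1) ψ M := by
    obtain ⟨M, hM⟩ := ((Finset.range n0).image fun n : ℕ =>
      ((n : ℝ) + 1) ^ ((d : ℝ) + 1) * ‖mahlerCoeff p L φ n‖).bddAbove
    refine ⟨max M 0, fun n => ?_⟩
    rw [hcoef]
    split_ifs with h
    · exact le_max_of_le_left (hM (Finset.mem_coe.2
        (Finset.mem_image_of_mem _ (Finset.mem_range.2 h))))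
    · simp
  have hM0 := hM.nonneg
  have hd0 : (0 : ℝ) ≤ (d : ℝ) + 1 := by positivity
  have hsub : ∀ N n : ℕ, ‖(ψ - lpProj d N ψ) n‖ ≤ (p : ℝ) ^ (-((N : ℝ) * ((d : ℝ) + 1))) * M :=
    fun N n => hM.norm_sub_lpProj_le hd0 le_rfl N n
  obtain ⟨K, hK0, hK⟩ := exists_lp_mahlerBound p L hr d
  set η : ℝ := (d : ℝ) + 1 - r with hη
  have hη0 : 0 < η := by rw [hη]; linarith
  have hstep : ∀ N : ℕ, MahlerBound r (lpProj d (N + 1) ψ - lpProj d N ψ)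
      (K * (p : ℝ) ^ r * M * (p : ℝ) ^ (-((N : ℝ) * η))) := by
    intro N
    have hle : ∀ n : ℕ, ‖(lpProj d (N + 1) ψ - lpProj d N ψ) n‖ ≤
        (p : ℝ) ^ (-((N : ℝ) * ((d : ℝ) + 1))) * M := by
      intro n
      have h1 : (lpProj d (N + 1) ψ - lpProj d N ψ) n =
          (ψ - lpProj d N ψ) n - (ψ - lpProj d (N + 1) ψ) n := by
        simp only [Pi.sub_apply]; ring
      rw [h1, sub_eq_add_neg]
      refine (IsUltrametricDist.norm_add_le_max _ _).trans (max_le (hsub N n) ?_)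
      rw [norm_neg]
      refine (hsub (N + 1) n).trans (mul_le_mul_of_nonneg_right ?_ hM0)
      refine Real.rpow_le_rpow_of_exponent_le one_lt_p.le ?_
      push_cast
      nlinarith
    have h2 := hK (N + 1) _ _ (((lp_lpProj d (N + 1) ψ)).sub
      ((lp_lpProj d N ψ).mono (Nat.le_succ N))) hle
    refine h2.mono (le_of_eq ?_)
    have h3 : (p : ℝ) ^ (((N + 1 : ℕ) : ℝ) * r) * (p : ℝ) ^ (-((N : ℝ) * ((d : ℝ) + 1))) =
        (p : ℝ) ^ r * (p : ℝ) ^ (-((N : ℝ) * η)) := by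
      rw [← Real.rpow_add hp, ← Real.rpow_add hp]
      congr 1
      rw [hη]
      push_cast
      ring
    calc _ = K * ((p : ℝ) ^ (((N + 1 : ℕ) : ℝ) * r) *
          (p : ℝ) ^ (-((N : ℝ) * ((d : ℝ) + 1)))) * M := by ring
      _ = _ := by rw [h3]; ring
  have hpow : ∀ s : ℝ, 0 < s → Tendsto (fun N : ℕ => (p : ℝ) ^ (-((N : ℝ) * s))) atTop (𝓝 0) := by
    intro s hs
    have hb : (p : ℝ) ^ (-s) < 1 := Real.rpow_lt_one_of_one_lt_of_neg one_lt_p (by linarith)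
    refine (tendsto_pow_atTop_nhds_zero_of_lt_one (by positivity) hb).congr fun N => ?_
    rw [← Real.rpow_natCast, ← Real.rpow_mul hp.le]
    congr 1
    ring
  obtain ⟨N, hN⟩ : ∃ N : ℕ, K * (p : ℝ) ^ r * M * (p : ℝ) ^ (-((N : ℝ) * η)) ≤ ε := by
    have h := (hpow η hη0).const_mul (K * (p : ℝ) ^ r * M)
    rw [mul_zero] at h
    exact ((h.eventually (ge_mem_nhds hε)).exists)
  refine ⟨N, lpProj d N ψ, lp_lpProj d N ψ, ?_⟩
  have hdiff : ∀ N', N ≤ N' → MahlerBound r (lpProj d N' ψ - lpProj d N ψ) ε := by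
    intro N' hN'
    induction N', hN' using Nat.le_induction with
    | base => rw [sub_self]; exact (mahlerBound_zero r).mono hε.le
    | succ n hn ih =>
      have h1 : lpProj d (n + 1) ψ - lpProj d N ψ =
          (lpProj d (n + 1) ψ - lpProj d n ψ) + (lpProj d n ψ - lpProj d N ψ) := by abel
      rw [h1]
      refine MahlerBound.add ((hstep n).mono (le_trans ?_ hN)) ih
      refine mul_le_mul_of_nonneg_left ?_ (by positivity)
      refine Real.rpow_le_rpow_of_exponent_le one_lt_p.le ?_
      have : (N : ℝ) ≤ n := by exact_mod_cast hn
      nlinarith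
  have hlim : MahlerBound r (ψ - lpProj d N ψ) ε := fun n => by
    have ht : Tendsto (fun N' : ℕ => max (((n : ℝ) + 1) ^ r *
        ((p : ℝ) ^ (-((N' : ℝ) * ((d : ℝ) + 1))) * M)) ε) atTop (𝓝 (max 0 ε)) := by
      refine Tendsto.max ?_ tendsto_const_nhds
      have h := ((hpow ((d : ℝ) + 1) (by positivity)).mul_const M).const_mul (((n : ℝ) + 1) ^ r)
      simpa using h
    rw [max_eq_right hε.le] at ht
    refine ge_of_tendsto ht ?_
    filter_upwards [eventually_ge_atTop N] with N' hN'
    have h1 : ψ - lpProj d N ψ = (ψ - lpProj d N' ψ) + (lpProj d N' ψ - lpProj d N ψ) := by abel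
    have hw : (0 : ℝ) ≤ ((n : ℝ) + 1) ^ r := by positivity
    rw [h1, mahlerCoeff_add]
    refine (mul_le_mul_of_nonneg_left (IsUltrametricDist.norm_add_le_max _ _) hw).trans ?_
    rw [mul_max_of_nonneg _ _ hw]
    refine max_le_max (mul_le_mul_of_nonneg_left ?_ hw) (hdiff N' hN' n)
    exact norm_mahlerCoeff_le (by positivity) n fun i _ => hsub N' i
  have h1 : φ - lpProj d N ψ = (φ - ψ) + (ψ - lpProj d N ψ) := by abel
  rw [h1]
  exact happ.add hlim

end Projections

section Pieces

set_option linter.unusedSectionVars false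

variable {p} {L} [IsUltrametricDist L] [CompleteSpace L]

theorem mahlerBound_of_pieces {r B : ℝ} (hB : 0 ≤ B) {φ : ℤ_[p] → L} {ψ : ℕ → ℤ_[p] → L}
    (hψ : ∀ m, MahlerBound r (ψ m) B)
    (hsum : ∀ z, ∀ᶠ n : ℕ in atTop, φ z = ∑ m ∈ Finset.range n, ψ m z) : MahlerBound r φ B := by
  intro n
  have h : ∀ᶠ k : ℕ in atTop, ∀ i ∈ Finset.range (n + 1),
      φ (i : ℤ_[p]) = ∑ m ∈ Finset.range k, ψ m (i : ℤ_[p]) :=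
    (Finset.range (n + 1)).eventually_all.2 fun i _ => hsum i
  obtain ⟨k, hk⟩ := h.exists
  have h1 : mahlerCoeff p L φ n = mahlerCoeff p L (∑ m ∈ Finset.range k, ψ m) n :=
    mahlerCoeff_congr n fun i hi => by
      rw [hk i (Finset.mem_range.2 (Nat.lt_succ_iff.2 hi)), Finset.sum_apply]
  rw [h1]
  exact MahlerBound.sum hB _ (fun m _ => hψ m) n

theorem rpow_neg_mul_tendsto {s : ℝ} (hs : 0 < s) :
    Tendsto (fun N : ℕ => (p : ℝ) ^ (-((N : ℝ) * s))) atTop (𝓝 0) := by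
  have hp := p_pos (p := p)
  have hb : (p : ℝ) ^ (-s) < 1 := Real.rpow_lt_one_of_one_lt_of_neg one_lt_p (by linarith)
  refine (tendsto_pow_atTop_nhds_zero_of_lt_one (by positivity) hb).congr fun N => ?_
  rw [← Real.rpow_natCast, ← Real.rpow_mul hp.le]
  congr 1
  ring

theorem rpow_neg_mul_anti {s : ℝ} (hs : 0 ≤ s) {m n : ℕ} (h : m ≤ n) :
    (p : ℝ) ^ (-((n : ℝ) * s)) ≤ (p : ℝ) ^ (-((m : ℝ) * s)) := by
  refine Real.rpow_le_rpow_of_exponent_le one_lt_p.le ?_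
  have : (m : ℝ) ≤ n := by exact_mod_cast h
  nlinarith

theorem continuous_of_pieces {s A : ℝ} (hs : 0 < s) (hA : 0 ≤ A) {φ : ℤ_[p] → L}
    {ψ : ℕ → ℤ_[p] → L} (hψ : ∀ m, Continuous (ψ m))
    (hsup : ∀ m z, ‖ψ m z‖ ≤ A * (p : ℝ) ^ (-((m : ℝ) * s)))
    (hsum : ∀ z, ∀ᶠ n : ℕ in atTop, φ z = ∑ m ∈ Finset.range n, ψ m z) : Continuous φ := by
  have hp := p_pos (p := p)
  refine continuous_of_uniform_approx_of_continuous fun u hu => ?_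
  obtain ⟨ε, hε, hεu⟩ := Metric.mem_uniformity_dist.1 hu
  have hlim := (rpow_neg_mul_tendsto (p := p) hs).const_mul A
  rw [mul_zero] at hlim
  obtain ⟨M, hM⟩ := (hlim.eventually (gt_mem_nhds hε)).exists
  refine ⟨fun z => ∑ m ∈ Finset.range M, ψ m z, continuous_finsetSum _ fun m _ => hψ m,
    fun z => hεu ?_⟩
  obtain ⟨n, hn, hMn⟩ := ((hsum z).and (eventually_ge_atTop M)).exists
  rw [dist_eq_norm, hn, ← Finset.sum_range_add_sum_Ico _ hMn, add_sub_cancel_left]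
  refine lt_of_le_of_lt ?_ hM
  refine IsUltrametricDist.norm_sum_le_of_forall_le_of_nonneg (by positivity) fun m hm => ?_
  exact (hsup m z).trans (mul_le_mul_of_nonneg_left
    (rpow_neg_mul_anti hs.le (Finset.mem_Ico.1 hm).1) hA)

theorem exists_pieces_bound (p : ℕ) [Fact p.Prime] (L : Type) [NontriviallyNormedField L]
    [NormedAlgebra ℚ_[p] L] [IsUltrametricDist L] [CompleteSpace L] {r : ℝ} (hr : 0 ≤ r) (d : ℕ) :
    ∃ K : ℝ, 0 ≤ K ∧ ∀ (N₀ m₀ : ℕ) (φ : ℤ_[p] → L) (ψ : ℕ → ℤ_[p] → L) (A s : ℝ), r < s → 0 ≤ A →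
      (∀ m, LP d (N₀ + m + 1) (ψ m)) →
      (∀ m z, ‖ψ m z‖ ≤ A * (p : ℝ) ^ (-((m : ℝ) * s))) →
      (∀ z, ∀ᶠ n : ℕ in atTop, φ z = ∑ m ∈ Finset.range n, ψ m z) →
      (∀ m, m < m₀ → ψ m = 0) →
      IsCr p L r φ ∧ MahlerBound r φ
        (K * A * (p : ℝ) ^ (((N₀ : ℝ) + 1) * r) * (p : ℝ) ^ (-((m₀ : ℝ) * (s - r)))) := by
  have hp := p_pos (p := p)
  obtain ⟨K, hK0, hK⟩ := exists_lp_mahlerBound p L hr d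
  refine ⟨K, hK0, fun N₀ m₀ φ ψ A s hrs hA hLP hsup hsum hm₀ => ?_⟩
  have hpiece : ∀ m, MahlerBound r (ψ m)
      (K * A * (p : ℝ) ^ (((N₀ : ℝ) + 1) * r) * (p : ℝ) ^ (-((m : ℝ) * (s - r)))) := by
    intro m
    refine (hK _ _ _ (hLP m) fun n => hsup m n).mono (le_of_eq ?_)
    have h3 : (p : ℝ) ^ (((N₀ + m + 1 : ℕ) : ℝ) * r) * (p : ℝ) ^ (-((m : ℝ) * s)) =
        (p : ℝ) ^ (((N₀ : ℝ) + 1) * r) * (p : ℝ) ^ (-((m : ℝ) * (s - r))) := by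
      rw [← Real.rpow_add hp, ← Real.rpow_add hp]
      congr 1
      push_cast
      ring
    calc _ = K * A * ((p : ℝ) ^ (((N₀ + m + 1 : ℕ) : ℝ) * r) * (p : ℝ) ^ (-((m : ℝ) * s))) := by
          ring
      _ = _ := by rw [h3]; ring
  have htail : ∀ M : ℕ, (∀ m, m < M → ψ m = 0) → MahlerBound r φ
      (K * A * (p : ℝ) ^ (((N₀ : ℝ) + 1) * r) * (p : ℝ) ^ (-((M : ℝ) * (s - r)))) := by
    intro M hM
    refine mahlerBound_of_pieces (by positivity) (fun m => ?_) hsum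
    rcases lt_or_ge m M with h | h
    · rw [hM m h]
      exact (mahlerBound_zero r).mono (by positivity)
    · exact (hpiece m).mono (mul_le_mul_of_nonneg_left
        (rpow_neg_mul_anti (sub_pos.2 hrs).le h) (by positivity))
  refine ⟨isCr_of_approx (continuous_of_pieces (lt_of_le_of_lt hr hrs) hA (fun m => (hLP m).1) hsup
    hsum) (fun ε hε => ?_) hr, htail m₀ hm₀⟩
  have hlim := (rpow_neg_mul_tendsto (p := p) (sub_pos.2 hrs)).const_mul
    (K * A * (p : ℝ) ^ (((N₀ : ℝ) + 1) * r))
  rw [mul_zero] at hlim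
  obtain ⟨M, hM⟩ := (hlim.eventually (ge_mem_nhds hε)).exists
  refine ⟨∑ m ∈ Finset.range M, ψ m, ?_, ?_⟩
  · exact Finset.sum_induction _ (fun f => IsCr p L r f) (fun _ _ => IsCr.add) (isCr_zero r)
      fun m _ => (hLP m).isCr hr
  · refine MahlerBound.mono (mahlerBound_of_pieces (ψ := fun m => if m < M then 0 else ψ m)
      (by positivity) (fun m => ?_) fun z => ?_) hM
    · split_ifs with h
      · exact (mahlerBound_zero r).mono (by positivity)
      · exact (hpiece m).mono (mul_le_mul_of_nonneg_left
          (rpow_neg_mul_anti (sub_pos.2 hrs).le (not_lt.1 h)) (by positivity))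
    · filter_upwards [hsum z, eventually_ge_atTop M] with n hn hMn
      rw [Pi.sub_apply, hn, Finset.sum_apply, ← Finset.sum_range_add_sum_Ico _ hMn,
        add_sub_cancel_left, ← Finset.sum_range_add_sum_Ico _ hMn]
      have h0 : ∑ k ∈ Finset.range M, (if k < M then (0 : ℤ_[p] → L) else ψ k) z = 0 :=
        Finset.sum_eq_zero fun m hm => by rw [if_pos (Finset.mem_range.1 hm)]; rfl
      rw [h0, zero_add]
      exact Finset.sum_congr rfl fun m hm => by
        rw [if_neg (not_lt.2 (Finset.mem_Ico.1 hm).1)]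

end Pieces

section Weights

set_option linter.unusedSectionVars false

variable {p} {L} [IsUltrametricDist L] [CompleteSpace L]

/-- The numerical hypotheses on `(k, α, β)`; they are symmetric in `α` and `β`. -/
structure Adm (p : ℕ) [Fact p.Prime] (L : Type) [NontriviallyNormedField L]
    [NormedAlgebra ℚ_[p] L] (k : ℕ) (α β : L) : Prop where
  two_le : 2 ≤ k
  pos_left : 0 < valL p L α
  pos_right : 0 < valL p L β
  sum_eq : valL p L α + valL p L β = (k : ℝ) - 1

theorem norm_eq_rpow_valL {x : L} (hx : x ≠ 0) : ‖x‖ = (p : ℝ) ^ (-valL p L x) := by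
  rw [valL, neg_neg, Real.rpow_logb p_pos (ne_of_gt one_lt_p) (norm_pos_iff.2 hx)]

theorem ne_zero_of_valL_pos {x : L} (hx : 0 < valL p L x) : x ≠ 0 := by
  rintro rfl
  simp [valL] at hx

theorem norm_zpow_valuation {x : L} (hx : x ≠ 0) {t : ℚ_[p]} (ht : t ≠ 0) :
    ‖x ^ t.valuation‖ = ‖t‖ ^ valL p L x := by
  have hp := p_pos (p := p)
  rw [norm_zpow, norm_eq_rpow_valL (p := p) hx, Padic.norm_eq_zpow_neg_valuation ht,
    ← Real.rpow_intCast, ← Real.rpow_intCast, ← Real.rpow_mul hp.le, ← Real.rpow_mul hp.le]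
  congr 1
  push_cast
  ring

variable {k : ℕ} {α β : L}

theorem Adm.left_ne (h : Adm p L k α β) : α ≠ 0 := ne_zero_of_valL_pos h.pos_left

theorem Adm.right_ne (h : Adm p L k α β) : β ≠ 0 := ne_zero_of_valL_pos h.pos_right

theorem Adm.valL_lt (h : Adm p L k α β) : valL p L α < ((k - 2 : ℕ) : ℝ) + 1 := by
  have h1 := h.sum_eq
  have h2 := h.pos_right
  rw [Nat.cast_sub h.two_le]
  push_cast
  linarith

theorem Adm.lam_ne (h : Adm p L k α β) : α * (p : L) / β ≠ 0 := by
  have : (p : L) ≠ 0 := by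
    rw [← norm_pos_iff, norm_p_eq]
    exact inv_pos.2 p_pos
  exact div_ne_zero (mul_ne_zero h.left_ne this) h.right_ne

variable (p k α β) in
/-- The weight `(αp/β)^{val t} t^{k-2}`. -/
def wt (t : ℚ_[p]) : L := (α * (p : L) / β) ^ t.valuation * iotaL p L t ^ (k - 2)

theorem iotaL_mul (x y : ℚ_[p]) : iotaL p L (x * y) = iotaL p L x * iotaL p L y :=
  map_mul (algebraMap ℚ_[p] L) x y

theorem iotaL_add (x y : ℚ_[p]) : iotaL p L (x + y) = iotaL p L x + iotaL p L y :=
  map_add (algebraMap ℚ_[p] L) x y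

theorem iotaL_div (x y : ℚ_[p]) : iotaL p L (x / y) = iotaL p L x / iotaL p L y :=
  map_div₀ (algebraMap ℚ_[p] L) x y

theorem iotaL_ne {x : ℚ_[p]} (hx : x ≠ 0) : iotaL p L x ≠ 0 :=
  (map_ne_zero (algebraMap ℚ_[p] L)).2 hx

theorem wt_mul (h : Adm p L k α β) {s t : ℚ_[p]} (hs : s ≠ 0) (ht : t ≠ 0) :
    wt p k α β (s * t) = wt p k α β s * wt p k α β t := by
  rw [wt, wt, wt, Padic.valuation_mul hs ht, zpow_add₀ h.lam_ne, iotaL_mul, mul_pow]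
  ring

theorem wt_ne (h : Adm p L k α β) {t : ℚ_[p]} (ht : t ≠ 0) : wt p k α β t ≠ 0 :=
  mul_ne_zero (zpow_ne_zero _ h.lam_ne) (pow_ne_zero _ (iotaL_ne ht))

theorem wt_one : wt p k α β 1 = 1 := by
  simp [wt, iotaL]

theorem valL_lam (h : Adm p L k α β) :
    valL p L (α * (p : L) / β) = 2 * valL p L α - ((k - 2 : ℕ) : ℝ) := by
  have hp := p_pos (p := p)
  have h1 : ‖α * (p : L) / β‖ = (p : ℝ) ^ (-(2 * valL p L α - ((k - 2 : ℕ) : ℝ))) := by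
    rw [norm_div, norm_mul, norm_p_eq, norm_eq_rpow_valL (p := p) h.left_ne,
      norm_eq_rpow_valL (p := p) h.right_ne, ← Real.rpow_neg_one, ← Real.rpow_add hp,
      ← Real.rpow_sub hp]
    congr 1
    have := h.sum_eq
    rw [Nat.cast_sub h.two_le]
    push_cast
    linarith
  rw [valL, h1, Real.logb_rpow hp (ne_of_gt one_lt_p), neg_neg]

theorem norm_wt (h : Adm p L k α β) {t : ℚ_[p]} (ht : t ≠ 0) :
    ‖wt p k α β t‖ = ‖t‖ ^ (2 * valL p L α) := by
  have ht' : 0 < ‖t‖ := norm_pos_iff.2 ht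
  rw [wt, norm_mul, norm_zpow_valuation h.lam_ne ht, norm_pow, norm_iotaL, valL_lam h,
    ← Real.rpow_natCast, ← Real.rpow_add ht']
  congr 1
  ring

theorem valuation_eq_of_norm {t : ℚ_[p]} {m : ℤ} (ht : ‖t‖ = (p : ℝ) ^ (-m)) :
    t.valuation = m := by
  have hp := p_pos (p := p)
  have h0 : t ≠ 0 := by
    rintro rfl
    rw [norm_zero] at ht
    exact absurd ht.symm (zpow_pos hp _).ne'
  rw [Padic.norm_eq_zpow_neg_valuation h0] at ht
  have := zpow_right_injective₀ hp (ne_of_gt one_lt_p) ht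
  omega

theorem valuation_congr {s t : ℚ_[p]} (h : ‖s‖ = ‖t‖) : s.valuation = t.valuation := by
  rcases eq_or_ne t 0 with rfl | ht
  · rw [norm_zero, norm_eq_zero] at h
    rw [h]
  · rw [Padic.norm_eq_zpow_neg_valuation ht] at h
    exact valuation_eq_of_norm h

theorem exists_norm_eq {t : ℚ_[p]} (ht : t ≠ 0) (h1 : ‖t‖ ≤ 1) :
    ∃ m : ℕ, ‖t‖ = (p : ℝ) ^ (-(m : ℤ)) := by
  have h2 := Padic.norm_eq_zpow_neg_valuation ht
  have h3 : 0 ≤ t.valuation := by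
    by_contra hneg
    rw [h2] at h1
    have : (1 : ℝ) < (p : ℝ) ^ (-t.valuation) := one_lt_zpow₀ one_lt_p (by omega)
    linarith
  exact ⟨t.valuation.toNat, by rw [h2, Int.toNat_of_nonneg h3]⟩

theorem norm_eq_of_sub_lt {x y : ℚ_[p]} (h : ‖x - y‖ < ‖y‖) : ‖x‖ = ‖y‖ := by
  have := IsUltrametricDist.norm_add_eq_max_of_norm_ne_norm (ne_of_lt h)
  rw [sub_add_cancel, max_eq_right h.le] at this
  exact this

theorem norm_add_le_max (x y : ℚ_[p]) : ‖x + y‖ ≤ max ‖x‖ ‖y‖ := Padic.nonarchimedean x y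

theorem norm_le_iff_of_sub_lt {x y : ℚ_[p]} {c : ℝ} (h : ‖x - y‖ < c) : ‖x‖ ≤ c ↔ ‖y‖ ≤ c := by
  constructor
  · intro hx
    have := norm_add_le_max (y - x) x
    rw [sub_add_cancel, norm_sub_rev] at this
    exact this.trans (max_le h.le hx)
  · intro hy
    have := norm_add_le_max (x - y) y
    rw [sub_add_cancel] at this
    exact this.trans (max_le h.le hy)

end Weights

section Cut

set_option linter.unusedSectionVars false

variable {p} {L} [IsUltrametricDist L] [CompleteSpace L]

variable {k : ℕ} {α β : L}

/-- The relations `R` on pairs of norms that are used to cut out domains: they are invariant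
under scaling, and only the comparison of the two norms matters. -/
structure CutRel (p : ℕ) [Fact p.Prime] (R : ℝ → ℝ → Prop) : Prop where
  scale : ∀ c s t : ℝ, 0 < c → (R (c * s) (c * t) ↔ R s t)
  stable : ∀ x x' y : ℚ_[p], ‖x - x'‖ < ‖y‖ → (R ‖x‖ ‖y‖ ↔ R ‖x'‖ ‖y‖)

theorem cutRel_le : CutRel p (· ≤ ·) :=
  ⟨fun _ _ _ hc => mul_le_mul_iff_right₀ hc, fun _ _ _ h => norm_le_iff_of_sub_lt h⟩

theorem cutRel_gt : CutRel p (fun s t => t < s) :=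
  ⟨fun _ _ _ hc => mul_lt_mul_iff_right₀ hc, fun _ _ _ h => by
    simpa using (norm_le_iff_of_sub_lt h).not⟩

theorem cutRel_true : CutRel p (fun _ _ => True) := ⟨by simp, by simp⟩

variable (p k α β) in
/-- The homogeneous function `(αp/β)^{val y} y^{k-2-j} x^j`, restricted to the domain
`y ≠ 0`, `R ‖x‖ ‖y‖`. -/
def cut (R : ℝ → ℝ → Prop) (j : ℕ) (x y : ℚ_[p]) : L :=
  if y ≠ 0 ∧ R ‖x‖ ‖y‖ then wt p k α β y * iotaL p L (x / y) ^ j else 0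

theorem cut_mul (h : Adm p L k α β) {R : ℝ → ℝ → Prop} (hR : CutRel p R) (j : ℕ) {t : ℚ_[p]}
    (ht : t ≠ 0) (x y : ℚ_[p]) :
    cut p k α β R j (t * x) (t * y) = wt p k α β t * cut p k α β R j x y := by
  have ht' : 0 < ‖t‖ := norm_pos_iff.2 ht
  rw [cut, cut, norm_mul, norm_mul, hR.scale _ _ _ ht', mul_div_mul_left _ _ ht]
  by_cases hy : y = 0
  · simp [hy]
  · simp only [ne_eq, mul_eq_zero, ht, hy, or_self, not_false_eq_true, true_and]
    split_ifs
    · rw [wt_mul h ht hy, mul_assoc]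
    · rw [mul_zero]

theorem cut_zero_right (R : ℝ → ℝ → Prop) (j : ℕ) (x : ℚ_[p]) :
    cut p k α β R j x 0 = (0 : L) := by simp [cut]

theorem cut_true_eq (j : ℕ) (x y : ℚ_[p]) :
    cut p k α β (fun _ _ => True) j x y =
      cut p k α β (· ≤ ·) j x y + (cut p k α β (fun s t => t < s) j x y : L) := by
  simp only [cut]
  by_cases hy : y = 0
  · simp [hy]
  · rcases le_or_gt ‖x‖ ‖y‖ with h | h
    · simp [hy, h, not_lt.2 h]
    · simp [hy, h, not_le.2 h]

theorem norm_cut_le (h : Adm p L k α β) (R : ℝ → ℝ → Prop) (j : ℕ) (x y : ℚ_[p]) (hy : y ≠ 0) :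
    ‖cut p k α β R j x y‖ ≤ ‖y‖ ^ (2 * valL p L α) * (‖x‖ / ‖y‖) ^ j := by
  rw [cut]
  split_ifs
  · rw [norm_mul, norm_wt h hy, norm_pow, norm_iotaL, norm_div]
  · rw [norm_zero]
    positivity

/-- The affine function `z ↦ a z + b` on `ℤ_p`. -/
def aff (a b : ℚ_[p]) (z : ℤ_[p]) : ℚ_[p] := a * z + b

theorem aff_sub_norm_le {a b : ℚ_[p]} (ha : ‖a‖ ≤ 1) (z z' : ℤ_[p]) :
    ‖aff a b z - aff a b z'‖ ≤ ‖z - z'‖ := by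
  have : aff a b z - aff a b z' = a * ((z - z' : ℤ_[p]) : ℚ_[p]) := by
    simp only [aff, PadicInt.coe_sub]; ring
  rw [this, norm_mul, ← PadicInt.norm_def]
  exact mul_le_of_le_one_left (norm_nonneg _) ha

theorem norm_aff_le {a b : ℚ_[p]} (ha : ‖a‖ ≤ 1) (hb : ‖b‖ ≤ 1) (z : ℤ_[p]) :
    ‖aff a b z‖ ≤ 1 := by
  refine (norm_add_le_max _ _).trans (max_le ?_ hb)
  rw [norm_mul]
  exact mul_le_one₀ ha (norm_nonneg _) (by rw [← PadicInt.norm_def]; exact PadicInt.norm_le_one z)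

variable (k α β) in
/-- The part of a cut function over the shell where the second form has valuation `m`. -/
def shell (R : ℝ → ℝ → Prop) (j : ℕ) (a b c d : ℚ_[p]) (m : ℕ) (z : ℤ_[p]) : L :=
  if ‖aff c d z‖ = (p : ℝ) ^ (-(m : ℤ)) then cut p k α β R j (aff a b z) (aff c d z) else 0

theorem lp_shell {R : ℝ → ℝ → Prop} (hR : CutRel p R) {j : ℕ}
    (hj : j ≤ k - 2) {a b c d : ℚ_[p]} (ha : ‖a‖ ≤ 1) (hc : ‖c‖ ≤ 1) (m : ℕ) :
    LP (k - 2) (m + 1) (shell k α β R j a b c d m) := by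
  have hp := p_pos (p := p)
  set C : ℤ_[p] → L := fun z => if ‖aff c d z‖ = (p : ℝ) ^ (-(m : ℤ)) ∧
    R ‖aff a b z‖ ((p : ℝ) ^ (-(m : ℤ))) then (α * (p : L) / β) ^ m else 0 with hC
  set P : Polynomial L := (Polynomial.C (iotaL p L c) * Polynomial.X +
    Polynomial.C (iotaL p L d)) ^ (k - 2 - j) * (Polynomial.C (iotaL p L a) * Polynomial.X +
    Polynomial.C (iotaL p L b)) ^ j with hP
  have heq : shell k α β R j a b c d m = fun z => C z * P.eval (iotaL p L z) := by
    funext z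
    have he : P.eval (iotaL p L z) = iotaL p L (aff c d z) ^ (k - 2 - j) *
        iotaL p L (aff a b z) ^ j := by
      simp only [hP, aff, iotaL_add, iotaL_mul, Polynomial.eval_mul, Polynomial.eval_pow,
        Polynomial.eval_add, Polynomial.eval_C, Polynomial.eval_X]
    rw [he]
    simp only [shell, hC]
    by_cases h1 : ‖aff c d z‖ = (p : ℝ) ^ (-(m : ℤ))
    · have h2 : aff c d z ≠ 0 := by
        rw [← norm_ne_zero_iff, h1]
        exact (zpow_pos hp _).ne'
      rw [if_pos h1, cut]
      simp only [h1, h2, ne_eq, not_false_eq_true, true_and]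
      split_ifs
      · rw [wt, valuation_eq_of_norm h1, zpow_natCast, mul_assoc, iotaL_div]
        congr 1
        have h3 := pow_ne_zero j (iotaL_ne (L := L) h2)
        have h4 : iotaL p L (aff c d z) ^ (k - 2) =
            iotaL p L (aff c d z) ^ (k - 2 - j) * iotaL p L (aff c d z) ^ j := by
          rw [← pow_add, Nat.sub_add_cancel hj]
        rw [h4, mul_assoc, div_pow, mul_div_cancel₀ _ h3]
      · rw [zero_mul]
    · rw [if_neg h1, if_neg (fun h => h1 h.1), zero_mul]
  rw [heq]
  refine lp_locConst_mul_eval (fun z z' hz => ?_) ?_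
  · have hlt : (p : ℝ) ^ (-((m + 1 : ℕ) : ℤ)) < (p : ℝ) ^ (-(m : ℤ)) :=
      zpow_lt_zpow_right₀ one_lt_p (by push_cast; omega)
    have hz' := lt_of_le_of_lt hz hlt
    have h1 := lt_of_le_of_lt (aff_sub_norm_le (b := b) ha z z') hz'
    have h2 := lt_of_le_of_lt (aff_sub_norm_le (b := d) hc z z') hz'
    have key : ∀ x y : ℚ_[p], ‖x - y‖ < (p : ℝ) ^ (-(m : ℤ)) → ‖y‖ = (p : ℝ) ^ (-(m : ℤ)) →
        ‖x‖ = (p : ℝ) ^ (-(m : ℤ)) := fun x y h h' => by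
      rw [← h'] at h
      rw [norm_eq_of_sub_lt h, h']
    have h3 : ‖aff c d z‖ = (p : ℝ) ^ (-(m : ℤ)) ↔ ‖aff c d z'‖ = (p : ℝ) ^ (-(m : ℤ)) :=
      ⟨key _ _ (by rwa [norm_sub_rev]), key _ _ h2⟩
    simp only [hC]
    by_cases h4 : ‖aff c d z‖ = (p : ℝ) ^ (-(m : ℤ))
    · have h5 := hR.stable (aff a b z) (aff a b z') (aff c d z) (by rwa [h4])
      rw [h4] at h5
      simp only [h4, h3.1 h4, true_and, h5]
    · rw [if_neg (fun h => h4 h.1), if_neg (fun h => h4 (h3.2 h.1))]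
  · refine (Polynomial.natDegree_mul_le).trans ?_
    have h1 := Polynomial.natDegree_pow_le_of_le (k - 2 - j)
      (Polynomial.natDegree_linear_le (a := iotaL p L c) (b := iotaL p L d))
    have h2 := Polynomial.natDegree_pow_le_of_le j
      (Polynomial.natDegree_linear_le (a := iotaL p L a) (b := iotaL p L b))
    omega

theorem eventually_cut_eq_sum_shell (R : ℝ → ℝ → Prop) (j : ℕ) (a b : ℚ_[p]) {c d : ℚ_[p]}
    (hc : ‖c‖ ≤ 1) (hd : ‖d‖ ≤ 1) (z : ℤ_[p]) :
    ∀ᶠ n : ℕ in atTop, cut p k α β R j (aff a b z) (aff c d z) =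
      ∑ m ∈ Finset.range n, shell k α β R j a b c d m z := by
  have hp := p_pos (p := p)
  by_cases h0 : aff c d z = 0
  · refine Eventually.of_forall fun n => ?_
    rw [h0, cut_zero_right, Finset.sum_eq_zero]
    intro m _
    rw [shell, if_neg]
    rw [h0, norm_zero]
    exact (zpow_pos hp _).ne
  · obtain ⟨m, hm⟩ := exists_norm_eq h0 (norm_aff_le hc hd z)
    filter_upwards [eventually_gt_atTop m] with n hn
    rw [Finset.sum_eq_single_of_mem m (Finset.mem_range.2 hn), shell, if_pos hm]
    intro m' _ hne
    rw [shell, if_neg]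
    intro h
    have := (valuation_eq_of_norm hm).symm.trans (valuation_eq_of_norm h)
    exact hne (by exact_mod_cast this.symm)

end Cut

section ChartBounds

set_option linter.unusedSectionVars false

variable {p} {L} [IsUltrametricDist L] [CompleteSpace L]

variable {k : ℕ} {α β : L}

theorem mul_aff (t a b : ℚ_[p]) (z : ℤ_[p]) : t * aff a b z = aff (t * a) (t * b) z := by
  simp only [aff]; ring

theorem zpow_neg_natCast_rpow (m : ℕ) (s : ℝ) :
    ((p : ℝ) ^ (-(m : ℤ))) ^ s = (p : ℝ) ^ (-((m : ℝ) * s)) := by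
  rw [← Real.rpow_intCast, ← Real.rpow_mul p_pos.le]
  congr 1
  push_cast
  ring

theorem norm_shell_le (h : Adm p L k α β) (R : ℝ → ℝ → Prop) (j : ℕ) {a b c d : ℚ_[p]} {D : ℝ}
    (hD : ∀ z : ℤ_[p], ‖aff a b z‖ ≤ D) (m : ℕ) (z : ℤ_[p]) :
    ‖shell k α β R j a b c d m z‖ ≤
      D ^ j * (p : ℝ) ^ (-((m : ℝ) * (2 * valL p L α - j))) := by
  have hp := p_pos (p := p)
  have hD0 : 0 ≤ D := (norm_nonneg _).trans (hD 0)
  rw [shell]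
  split_ifs with hm
  · have h2 : aff c d z ≠ 0 := by
      rw [← norm_ne_zero_iff, hm]
      exact (zpow_pos hp _).ne'
    refine (norm_cut_le h R j _ _ h2).trans ?_
    rw [hm]
    have h1 : (‖aff a b z‖ / (p : ℝ) ^ (-(m : ℤ))) ^ j ≤ (D / (p : ℝ) ^ (-(m : ℤ))) ^ j := by
      gcongr
      exact hD z
    refine (mul_le_mul_of_nonneg_left h1 (by positivity)).trans (le_of_eq ?_)
    have h3 : ((p : ℝ) ^ (-(m : ℤ))) ^ j = (p : ℝ) ^ (-((m : ℝ) * j)) := by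
      rw [← zpow_neg_natCast_rpow, Real.rpow_natCast]
    rw [div_pow, h3, zpow_neg_natCast_rpow, mul_div_assoc', mul_comm, mul_div_assoc,
      ← Real.rpow_sub hp]
    congr 2
    ring
  · rw [norm_zero]
    positivity

theorem norm_shell_le_of_le (h : Adm p L k α β) (j : ℕ) (a b c d : ℚ_[p]) (m : ℕ) (z : ℤ_[p]) :
    ‖shell k α β (· ≤ ·) j a b c d m z‖ ≤
      (p : ℝ) ^ (-((m : ℝ) * (2 * valL p L α))) := by
  have hp := p_pos (p := p)
  rw [shell]
  split_ifs with hm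
  · have h2 : aff c d z ≠ 0 := by
      rw [← norm_ne_zero_iff, hm]
      exact (zpow_pos hp _).ne'
    by_cases h3 : ‖aff a b z‖ ≤ ‖aff c d z‖
    · refine (norm_cut_le h _ j _ _ h2).trans ?_
      rw [hm, zpow_neg_natCast_rpow]
      refine mul_le_of_le_one_right (by positivity) (pow_le_one₀ (by positivity) ?_)
      rw [← hm]
      exact div_le_one_of_le₀ h3 (norm_nonneg _)
    · rw [cut, if_neg (fun h => h3 h.2), norm_zero]
      positivity
  · rw [norm_zero]
    positivity

theorem norm_det_le_max {a b c d : ℚ_[p]} (ha : ‖a‖ ≤ 1) (hc : ‖c‖ ≤ 1) (z : ℤ_[p]) :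
    ‖a * d - b * c‖ ≤ max ‖aff a b z‖ ‖aff c d z‖ := by
  have : a * d - b * c = a * aff c d z + -(c * aff a b z) := by simp only [aff]; ring
  rw [this]
  refine (norm_add_le_max _ _).trans ?_
  rw [norm_neg, norm_mul, norm_mul, max_comm]
  exact max_le_max (mul_le_of_le_one_left (norm_nonneg _) hc)
    (mul_le_of_le_one_left (norm_nonneg _) ha)

theorem exists_lp_cut_le {j : ℕ} (hj : j ≤ k - 2) {a b c d : ℚ_[p]} (ha : ‖a‖ ≤ 1)
    (hc : ‖c‖ ≤ 1) (hd : ‖d‖ ≤ 1) (hdet : a * d - b * c ≠ 0) :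
    ∃ N, LP (k - 2) N fun z : ℤ_[p] => cut p k α β (· ≤ ·) j (aff a b z) (aff c d z) := by
  have hp := p_pos (p := p)
  obtain ⟨M, hM⟩ := exists_pow_lt_of_lt_one (norm_pos_iff.2 hdet)
    (inv_lt_one_of_one_lt₀ (one_lt_p (p := p)))
  have hMm : ∀ m, M ≤ m → (p : ℝ) ^ (-(m : ℤ)) < ‖a * d - b * c‖ := fun m hm => by
    refine lt_of_le_of_lt ?_ hM
    rw [inv_pow, zpow_neg, zpow_natCast]
    exact inv_anti₀ (by positivity) (pow_le_pow_right₀ one_lt_p.le hm)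
  have hz : ∀ m, M ≤ m → ∀ z, shell k α β (· ≤ ·) j a b c d m z = 0 := fun m hm z => by
    rw [shell]
    split_ifs with h1
    · rw [cut, if_neg]
      rintro ⟨-, h2⟩
      have h3 := norm_det_le_max (b := b) (d := d) ha hc z
      rw [max_eq_right h2, h1] at h3
      exact absurd (hMm m hm) (not_lt.2 h3)
    · rfl
  refine ⟨M, ?_⟩
  have heq : (fun z : ℤ_[p] => cut p k α β (· ≤ ·) j (aff a b z) (aff c d z)) =
      ∑ m ∈ Finset.range M, shell k α β (· ≤ ·) j a b c d m := by
    funext z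
    obtain ⟨n, hn, hMn⟩ := ((eventually_cut_eq_sum_shell (k := k) (α := α) (β := β)
      (· ≤ ·) j a b hc hd z).and (eventually_ge_atTop M)).exists
    rw [hn, Finset.sum_apply, ← Finset.sum_range_add_sum_Ico _ hMn,
      Finset.sum_eq_zero (s := Finset.Ico M n) fun m hm => hz m (Finset.mem_Ico.1 hm).1 z, add_zero]
  rw [heq]
  exact LP.sum _ fun m hm => (lp_shell cutRel_le hj ha hc m).mono (Finset.mem_range.1 hm)

theorem isCr_cut_true (h : Adm p L k α β) {j : ℕ} (hj : (j : ℝ) < valL p L α) {a b c d : ℚ_[p]}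
    (ha : ‖a‖ ≤ 1) (hb : ‖b‖ ≤ 1) (hc : ‖c‖ ≤ 1) (hd : ‖d‖ ≤ 1) :
    IsCr p L (valL p L α) fun z : ℤ_[p] =>
      cut p k α β (fun _ _ => True) j (aff a b z) (aff c d z) := by
  have hj' : j ≤ k - 2 := by
    have := hj.trans h.valL_lt
    exact Nat.lt_succ_iff.1 (by exact_mod_cast this)
  obtain ⟨K, -, hK⟩ := exists_pieces_bound (p := p) (L := L) h.pos_left.le (k - 2)
  refine (hK 0 0 _ (shell k α β (fun _ _ => True) j a b c d) (1 ^ j) (2 * valL p L α - j)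
    (by linarith) (by simp) (fun m => ?_)
    (norm_shell_le h _ j (norm_aff_le ha hb)) (eventually_cut_eq_sum_shell _ j a b hc hd)
    (by simp)).1
  rw [Nat.zero_add]
  exact lp_shell cutRel_true hj' ha hc m

/-- Complement of the small domain: the bound for `j < val α`. -/
theorem exists_bound_cut_gt (h : Adm p L k α β) :
    ∃ K : ℝ, 0 ≤ K ∧ ∀ j : ℕ, (j : ℝ) < valL p L α → ∀ a b c d δ : ℚ_[p], ‖a‖ ≤ 1 → ‖b‖ ≤ 1 →
      ‖c‖ ≤ 1 → ‖d‖ ≤ 1 → δ ≠ 0 → ‖δ‖ ≤ 1 →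
      MahlerBound (valL p L α) (fun z : ℤ_[p] =>
        cut p k α β (fun s t => t < s) j (δ * aff a b z) (aff c d z))
        (K * ‖δ‖ ^ valL p L α) := by
  have hp := p_pos (p := p)
  obtain ⟨K, hK0, hK⟩ := exists_pieces_bound (p := p) (L := L) h.pos_left.le (k - 2)
  refine ⟨K * (p : ℝ) ^ valL p L α, by positivity, fun j hj a b c d δ ha hb hc hd hδ0 hδ => ?_⟩
  have hj' : j ≤ k - 2 := by
    have := hj.trans h.valL_lt
    exact Nat.lt_succ_iff.1 (by exact_mod_cast this)
  obtain ⟨n, hn⟩ := exists_norm_eq hδ0 hδ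
  have hx : ∀ z : ℤ_[p], ‖aff (δ * a) (δ * b) z‖ ≤ ‖δ‖ := fun z => by
    rw [← mul_aff, norm_mul]
    exact mul_le_of_le_one_right (norm_nonneg _) (norm_aff_le ha hb z)
  have hδa : ‖δ * a‖ ≤ 1 := by
    rw [norm_mul]; exact mul_le_one₀ hδ (norm_nonneg _) ha
  simp only [mul_aff]
  refine ((hK 0 n _ (shell k α β (fun s t => t < s) j (δ * a) (δ * b) c d) (‖δ‖ ^ j)
    (2 * valL p L α - j) (by linarith) (by positivity) (fun m => ?_) (norm_shell_le h _ j hx)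
    (eventually_cut_eq_sum_shell _ j _ _ hc hd) fun m hm => ?_).2).mono (le_of_eq ?_)
  · rw [Nat.zero_add]
    exact lp_shell cutRel_gt hj' hδa hc m
  · funext z
    rw [shell]
    split_ifs with h1
    · rw [cut, if_neg]
      · rfl
      rintro ⟨-, h2⟩
      have h3 := lt_of_lt_of_le h2 (hx z)
      rw [h1, hn] at h3
      have := (zpow_lt_zpow_iff_right₀ (one_lt_p (p := p))).1 h3
      omega
    · rfl
  · have h1 : ‖δ‖ ^ j = (p : ℝ) ^ (-((n : ℝ) * j)) := by
      rw [hn, ← zpow_neg_natCast_rpow, Real.rpow_natCast]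
    have h2 : (p : ℝ) ^ (-((n : ℝ) * j)) *
        (p : ℝ) ^ (-((n : ℝ) * (2 * valL p L α - j - valL p L α))) =
        (p : ℝ) ^ (-((n : ℝ) * valL p L α)) := by
      rw [← Real.rpow_add hp]; congr 1; ring
    rw [h1, hn, zpow_neg_natCast_rpow, ← h2]
    push_cast
    rw [zero_add, one_mul]
    ring

/-- The bound for `j ≥ val α` on the large domain. -/
theorem exists_bound_cut_le_left (h : Adm p L k α β) :
    ∃ K : ℝ, 0 ≤ K ∧ ∀ j : ℕ, valL p L α ≤ j → j ≤ k - 2 → ∀ a b c d δ : ℚ_[p], ‖a‖ ≤ 1 →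
      ‖b‖ ≤ 1 → ‖c‖ ≤ 1 → ‖d‖ ≤ 1 → (p : ℝ)⁻¹ ≤ ‖a * d - b * c‖ → δ ≠ 0 → ‖δ‖ ≤ 1 →
      MahlerBound (valL p L α) (fun z : ℤ_[p] =>
        cut p k α β (· ≤ ·) j (δ * aff a b z) (aff c d z)) (K * ‖δ‖ ^ valL p L α) := by
  have hp := p_pos (p := p)
  obtain ⟨K, hK0, hK⟩ := exists_lp_mahlerBound p L h.pos_left.le (k - 2)
  refine ⟨K * (p : ℝ) ^ ((k - 2 : ℕ) : ℝ), by positivity,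
    fun j hj hjk a b c d δ ha hb hc hd hdet hδ0 hδ => ?_⟩
  have hx : ∀ z : ℤ_[p], ‖aff (δ * a) (δ * b) z‖ ≤ ‖δ‖ := fun z => by
    rw [← mul_aff, norm_mul]
    exact mul_le_of_le_one_right (norm_nonneg _) (norm_aff_le ha hb z)
  have hδa : ‖δ * a‖ ≤ 1 := by
    rw [norm_mul]; exact mul_le_one₀ hδ (norm_nonneg _) ha
  have hδp : 0 < ‖δ‖ := norm_pos_iff.2 hδ0
  simp only [mul_aff]
  refine mahlerBound_of_pieces (by positivity) (fun m => ?_)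
    (eventually_cut_eq_sum_shell _ j _ _ hc hd)
  rcases lt_or_ge ((p : ℝ) ^ (-(m : ℤ))) (‖δ‖ * (p : ℝ)⁻¹) with hm | hm
  · have h0 : shell k α β (· ≤ ·) j (δ * a) (δ * b) c d m = (0 : ℤ_[p] → L) := by
      funext z
      rw [shell]
      split_ifs with h1
      · rw [cut, if_neg]
        · rfl
        rintro ⟨-, h2⟩
        rw [← mul_aff, norm_mul] at h2
        have h3 := hdet.trans (norm_det_le_max (b := b) (d := d) ha hc z)
        have h4 := mul_le_mul_of_nonneg_left h3 hδp.le
        rw [mul_max_of_nonneg _ _ hδp.le] at h4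
        have h5 := h4.trans (max_le h2 (mul_le_of_le_one_left (norm_nonneg _) hδ))
        rw [h1] at h5
        exact absurd hm (not_lt.2 h5)
      · rfl
    rw [h0]
    exact (mahlerBound_zero _).mono (by positivity)
  · refine (hK _ _ _ (lp_shell cutRel_le hjk hδa hc m)
      fun n => norm_shell_le h _ j hx m n).mono ?_
    set r := valL p L α
    have h1 : ((p : ℝ) ^ (-(m : ℤ))) ^ (-((j : ℝ) - r)) ≤
        (‖δ‖ * (p : ℝ)⁻¹) ^ (-((j : ℝ) - r)) :=
      Real.rpow_le_rpow_of_nonpos (by positivity) hm (by linarith)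
    rw [zpow_neg_natCast_rpow, Real.mul_rpow hδp.le (by positivity), Real.inv_rpow hp.le,
      Real.rpow_neg hp.le (_ - _), inv_inv] at h1
    have h2 : (p : ℝ) ^ (((m + 1 : ℕ) : ℝ) * r) * (p : ℝ) ^ (-((m : ℝ) * (2 * r - j))) =
        (p : ℝ) ^ r * (p : ℝ) ^ (-((m : ℝ) * -((j : ℝ) - r))) := by
      rw [← Real.rpow_add hp, ← Real.rpow_add hp]
      congr 1
      push_cast
      ring
    have h3 : ‖δ‖ ^ j * ‖δ‖ ^ (-((j : ℝ) - r)) = ‖δ‖ ^ r := by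
      rw [← Real.rpow_natCast, ← Real.rpow_add hδp]
      congr 1
      ring
    have h4 : (p : ℝ) ^ r * (p : ℝ) ^ ((j : ℝ) - r) ≤ (p : ℝ) ^ ((k - 2 : ℕ) : ℝ) := by
      rw [← Real.rpow_add hp]
      refine Real.rpow_le_rpow_of_exponent_le one_lt_p.le ?_
      have : (j : ℝ) ≤ ((k - 2 : ℕ) : ℝ) := by exact_mod_cast hjk
      linarith
    calc K * (p : ℝ) ^ (((m + 1 : ℕ) : ℝ) * r) *
          (‖δ‖ ^ j * (p : ℝ) ^ (-((m : ℝ) * (2 * r - j))))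
        = K * ‖δ‖ ^ j * ((p : ℝ) ^ (((m + 1 : ℕ) : ℝ) * r) *
          (p : ℝ) ^ (-((m : ℝ) * (2 * r - j)))) := by ring
      _ = K * ‖δ‖ ^ j * ((p : ℝ) ^ r * (p : ℝ) ^ (-((m : ℝ) * -((j : ℝ) - r)))) := by rw [h2]
      _ ≤ K * ‖δ‖ ^ j * ((p : ℝ) ^ r *
          (‖δ‖ ^ (-((j : ℝ) - r)) * (p : ℝ) ^ ((j : ℝ) - r))) := by gcongr
      _ = K * ((p : ℝ) ^ r * (p : ℝ) ^ ((j : ℝ) - r)) *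
          (‖δ‖ ^ j * ‖δ‖ ^ (-((j : ℝ) - r))) := by ring
      _ ≤ _ := by
        rw [h3]
        gcongr

/-- The bound on the small domain. -/
theorem exists_bound_cut_le_right (h : Adm p L k α β) :
    ∃ K : ℝ, 0 ≤ K ∧ ∀ j : ℕ, j ≤ k - 2 → ∀ a b c d δ : ℚ_[p], ‖a‖ ≤ 1 →
      ‖c‖ ≤ 1 → ‖d‖ ≤ 1 → δ ≠ 0 → ‖δ‖ ≤ 1 →
      MahlerBound (valL p L α) (fun z : ℤ_[p] =>
        cut p k α β (· ≤ ·) j (aff a b z) (δ * aff c d z)) (K * ‖δ‖ ^ valL p L α) := by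
  have hp := p_pos (p := p)
  obtain ⟨K, hK0, hK⟩ := exists_pieces_bound (p := p) (L := L) h.pos_left.le (k - 2)
  refine ⟨K * (p : ℝ) ^ valL p L α, by positivity, fun j hj a b c d δ ha hc hd hδ0 hδ => ?_⟩
  obtain ⟨n, hn⟩ := exists_norm_eq hδ0 hδ
  have hx : ∀ z : ℤ_[p], ‖aff (δ * c) (δ * d) z‖ ≤ ‖δ‖ := fun z => by
    rw [← mul_aff, norm_mul]
    exact mul_le_of_le_one_right (norm_nonneg _) (norm_aff_le hc hd z)
  have hδc : ‖δ * c‖ ≤ 1 := by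
    rw [norm_mul]; exact mul_le_one₀ hδ (norm_nonneg _) hc
  have hδd : ‖δ * d‖ ≤ 1 := by
    rw [norm_mul]; exact mul_le_one₀ hδ (norm_nonneg _) hd
  simp only [mul_aff]
  have hr := h.pos_left
  refine ((hK 0 n _ (shell k α β (· ≤ ·) j a b (δ * c) (δ * d)) 1
    (2 * valL p L α) (by linarith) zero_le_one (fun m => ?_)
    (fun m z => by rw [one_mul]; exact norm_shell_le_of_le h j _ _ _ _ m z)
    (eventually_cut_eq_sum_shell _ j _ _ hδc hδd) fun m hm => ?_).2).mono (le_of_eq ?_)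
  · rw [Nat.zero_add]
    exact lp_shell cutRel_le hj ha hδc m
  · funext z
    rw [shell, if_neg]
    · rfl
    intro h1
    have h3 := hx z
    rw [h1, hn] at h3
    have := (zpow_le_zpow_iff_right₀ (one_lt_p (p := p))).1 h3
    omega
  · rw [hn, zpow_neg_natCast_rpow, mul_one]
    push_cast
    rw [zero_add, one_mul]
    congr 3
    ring

end ChartBounds

section BSpace

set_option linter.unusedSectionVars false

variable {p} {L} [IsUltrametricDist L] [CompleteSpace L]

variable {k : ℕ} {α β : L}

/-- The first chart `z ↦ f (p z)`. -/
def chart (f : ℚ_[p] → L) : ℤ_[p] → L := fun z => f ((p : ℚ_[p]) * (z : ℚ_[p]))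

theorem Ext2.eq (h : Adm p L k α β) {f : ℚ_[p] → L} {g g' : ℤ_[p] → L}
    (hg : Ext2 p L k α β f g) (hg' : Ext2 p L k α β f g') : g = g' := by
  have hd : Dense ({0}ᶜ : Set ℤ_[p]) := by
    rw [dense_compl_singleton_iff_not_open]
    intro ho
    obtain ⟨ε, hε, hb⟩ := Metric.isOpen_singleton_iff.1 ho
    obtain ⟨n, hn⟩ := exists_pow_lt_of_lt_one hε (inv_lt_one_of_one_lt₀ (one_lt_p (p := p)))
    have h1 := hb ((p : ℤ_[p]) ^ n) (by simpa using hn)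
    exact pow_ne_zero n (Nat.cast_ne_zero.2 (Fact.out : p.Prime).ne_zero) h1
  exact Continuous.ext_on hd (hg.1.continuous h.pos_left.le) (hg'.1.continuous h.pos_left.le)
    fun z hz => by rw [hg.2 z hz, hg'.2 z hz]

theorem Ext2.ext2_eq (h : Adm p L k α β) {f : ℚ_[p] → L} {g : ℤ_[p] → L}
    (hg : Ext2 p L k α β f g) : ext2 p L k α β f = g := by
  have hex : ∃ g : ℤ_[p] → L, Ext2 p L k α β f g := ⟨g, hg⟩
  rw [ext2, dif_pos hex]
  exact Ext2.eq h hex.choose_spec hg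

theorem Ext2.add {f f' : ℚ_[p] → L} {g g' : ℤ_[p] → L} (hg : Ext2 p L k α β f g)
    (hg' : Ext2 p L k α β f' g') : Ext2 p L k α β (f + f') (g + g') :=
  ⟨hg.1.add hg'.1, fun z hz => by
    rw [Pi.add_apply, Pi.add_apply, hg.2 z hz, hg'.2 z hz, mul_add]⟩

theorem Ext2.smul {f : ℚ_[p] → L} {g : ℤ_[p] → L} (hg : Ext2 p L k α β f g) (c : L) :
    Ext2 p L k α β (c • f) (c • g) :=
  ⟨hg.1.smul c, fun z hz => by
    rw [Pi.smul_apply, Pi.smul_apply, hg.2 z hz, smul_eq_mul, smul_eq_mul, mul_left_comm]⟩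

variable (k α β) in
/-- `f` lies in `B(α)` and has norm at most `M`. -/
def BBd (M : ℝ) (f : ℚ_[p] → L) : Prop :=
  IsCr p L (valL p L α) (chart f) ∧ MahlerBound (valL p L α) (chart f) M ∧
    ∃ g : ℤ_[p] → L, Ext2 p L k α β f g ∧ MahlerBound (valL p L α) g M

theorem BBd.memB {M : ℝ} {f : ℚ_[p] → L} (hf : BBd k α β M f) : MemB p L k α β f :=
  ⟨hf.1, hf.2.2.imp fun _ h => h.1⟩

theorem BBd.bNorm_le (h : Adm p L k α β) {M : ℝ} {f : ℚ_[p] → L} (hf : BBd k α β M f) :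
    bNorm p L k α β f ≤ M := by
  obtain ⟨-, h1, g, hg, h2⟩ := hf
  refine max_le h1.crNorm_le ?_
  rw [hg.ext2_eq h]
  exact h2.crNorm_le

theorem MemB.bbd (h : Adm p L k α β) {f : ℚ_[p] → L} (hf : MemB p L k α β f) :
    BBd k α β (bNorm p L k α β f) f := by
  obtain ⟨h1, g, hg⟩ := hf
  refine ⟨h1, (IsCr.mahlerBound h.pos_left.le h1).mono (le_max_left _ _), g, hg,
    (IsCr.mahlerBound h.pos_left.le hg.1).mono ?_⟩
  rw [bNorm, hg.ext2_eq h]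
  exact le_max_right _ _

theorem BBd.nonneg {M : ℝ} {f : ℚ_[p] → L} (hf : BBd k α β M f) : 0 ≤ M := hf.2.1.nonneg

theorem BBd.mono {M M' : ℝ} (hM : M ≤ M') {f : ℚ_[p] → L} (hf : BBd k α β M f) :
    BBd k α β M' f :=
  ⟨hf.1, hf.2.1.mono hM, hf.2.2.imp fun _ h => ⟨h.1, h.2.mono hM⟩⟩

theorem BBd.add {M : ℝ} {f g : ℚ_[p] → L} (hf : BBd k α β M f) (hg : BBd k α β M g) :
    BBd k α β M (f + g) := by
  obtain ⟨h1, h2, f', h3, h4⟩ := hf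
  obtain ⟨h1', h2', g', h3', h4'⟩ := hg
  exact ⟨h1.add h1', h2.add h2', f' + g', h3.add h3', h4.add h4'⟩

theorem BBd.smul {M : ℝ} {f : ℚ_[p] → L} (hf : BBd k α β M f) (c : L) :
    BBd k α β (‖c‖ * M) (c • f) := by
  obtain ⟨h1, h2, f', h3, h4⟩ := hf
  exact ⟨h1.smul c, h2.smul c, c • f', h3.smul c, h4.smul c⟩

theorem BBd.sub {M : ℝ} {f g : ℚ_[p] → L} (hf : BBd k α β M f) (hg : BBd k α β M g) :
    BBd k α β M (f - g) := by
  have h := hf.add ((hg.smul (-1)).mono (by simp : ‖(-1 : L)‖ * M ≤ M))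
  rwa [neg_one_smul, ← sub_eq_add_neg] at h

theorem bbd_zero : BBd k α β 0 (0 : ℚ_[p] → L) :=
  ⟨isCr_zero _, mahlerBound_zero _, 0, ⟨isCr_zero _, by simp⟩, mahlerBound_zero _⟩

theorem MemB.add (h : Adm p L k α β) {f g : ℚ_[p] → L} (hf : MemB p L k α β f)
    (hg : MemB p L k α β g) : MemB p L k α β (f + g) :=
  (((hf.bbd h).mono (le_max_left _ _)).add ((hg.bbd h).mono (le_max_right _ _))).memB

theorem MemB.smul (h : Adm p L k α β) {f : ℚ_[p] → L} (hf : MemB p L k α β f) (c : L) :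
    MemB p L k α β (c • f) := ((hf.bbd h).smul c).memB

/-- Homogeneity of a function of two variables, of weight `(αp/β)^{val t} t^{k-2}`. -/
def Homog (k : ℕ) (α β : L) (F : ℚ_[p] → ℚ_[p] → L) : Prop :=
  ∀ t : ℚ_[p], t ≠ 0 → ∀ x y, F (t * x) (t * y) = wt p k α β t * F x y

/-- Restriction of a function of two variables to the affine line `y = 1`. -/
def ev : (ℚ_[p] → ℚ_[p] → L) →ₗ[L] (ℚ_[p] → L) where
  toFun F z := F z 1
  map_add' _ _ := rfl
  map_smul' _ _ := rfl

theorem ev_apply (F : ℚ_[p] → ℚ_[p] → L) (z : ℚ_[p]) : ev F z = F z 1 := rfl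

theorem Homog.ext2 {F : ℚ_[p] → ℚ_[p] → L} (hF : Homog k α β F)
    (h2 : IsCr p L (valL p L α) fun z : ℤ_[p] => F 1 z) :
    Ext2 p L k α β (ev F) fun z : ℤ_[p] => F 1 z := by
  refine ⟨h2, fun z hz => ?_⟩
  have hz' : (z : ℚ_[p]) ≠ 0 := fun h0 => hz (Subtype.ext h0)
  have := hF z hz' (z : ℚ_[p])⁻¹ 1
  rw [mul_inv_cancel₀ hz', mul_one] at this
  beta_reduce
  rw [this, wt, ev_apply]

theorem Homog.bbd {F : ℚ_[p] → ℚ_[p] → L} (hF : Homog k α β F) {M : ℝ}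
    (h1 : IsCr p L (valL p L α) fun z : ℤ_[p] => F (p * z) 1)
    (h2 : IsCr p L (valL p L α) fun z : ℤ_[p] => F 1 z)
    (h1' : MahlerBound (valL p L α) (fun z : ℤ_[p] => F (p * z) 1) M)
    (h2' : MahlerBound (valL p L α) (fun z : ℤ_[p] => F 1 z) M) :
    BBd k α β M (ev F) :=
  ⟨h1, h1', _, hF.ext2 h2, h2'⟩

theorem Homog.memB {F : ℚ_[p] → ℚ_[p] → L} (hF : Homog k α β F)
    (h1 : IsCr p L (valL p L α) fun z : ℤ_[p] => F (p * z) 1)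
    (h2 : IsCr p L (valL p L α) fun z : ℤ_[p] => F 1 z) : MemB p L k α β (ev F) :=
  ⟨h1, _, hF.ext2 h2⟩

variable (α) in
/-- The action of a matrix on functions of two variables. -/
def act (m : Matrix (Fin 2) (Fin 2) ℚ_[p]) :
    (ℚ_[p] → ℚ_[p] → L) →ₗ[L] (ℚ_[p] → ℚ_[p] → L) where
  toFun F x y := α ^ (-(det2 p m).valuation) *
    F (m 1 1 * x - m 0 1 * y) (-(m 1 0) * x + m 0 0 * y)
  map_add' _ _ := by
    funext x y
    simp only [Pi.add_apply, mul_add]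
  map_smul' c _ := by
    funext x y
    simp only [Pi.smul_apply, smul_eq_mul, RingHom.id_apply]
    ring

theorem act_apply (m : Matrix (Fin 2) (Fin 2) ℚ_[p]) (F : ℚ_[p] → ℚ_[p] → L) (x y : ℚ_[p]) :
    act α m F x y = α ^ (-(det2 p m).valuation) *
      F (m 1 1 * x - m 0 1 * y) (-(m 1 0) * x + m 0 0 * y) := rfl

theorem Homog.gAct_ev (h : Adm p L k α β) {F : ℚ_[p] → ℚ_[p] → L} (hF : Homog k α β F)
    (h2 : IsCr p L (valL p L α) fun z : ℤ_[p] => F 1 z)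
    {m : Matrix (Fin 2) (Fin 2) ℚ_[p]} (hm : det2 p m ≠ 0) :
    gAct p L k α β m (ev F) = ev (act α m F) := by
  funext z
  rw [ev_apply, act_apply, gAct, mul_one, mul_one]
  split_ifs with h0
  · rw [(hF.ext2 h2).ext2_eq h, h0]
    have hc : m 1 0 ≠ 0 := by
      intro hc
      rw [hc, neg_zero, zero_mul, zero_add] at h0
      exact hm (by rw [det2, h0, hc]; ring)
    have hx : m 1 1 * z - m 0 1 = det2 p m / m 1 0 * 1 := by
      rw [det2, mul_one, eq_div_iff hc]
      linear_combination (-(m 1 1)) * h0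
    have := hF (det2 p m / m 1 0) (div_ne_zero hm hc) 1 0
    rw [mul_zero] at this
    beta_reduce
    rw [hx, this, wt, PadicInt.coe_zero]
    ring
  · have := hF _ h0 ((m 1 1 * z - m 0 1) / (-(m 1 0) * z + m 0 0)) 1
    rw [mul_one, mul_div_cancel₀ _ h0] at this
    rw [this, wt, ev_apply]
    ring

theorem MemB.gAct_add (h : Adm p L k α β) {f g : ℚ_[p] → L} (hf : MemB p L k α β f)
    (hg : MemB p L k α β g) (m : Matrix (Fin 2) (Fin 2) ℚ_[p]) :
    gAct p L k α β m (f + g) = gAct p L k α β m f + gAct p L k α β m g := by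
  obtain ⟨-, f', hf'⟩ := hf
  obtain ⟨-, g', hg'⟩ := hg
  funext z
  rw [Pi.add_apply, gAct, gAct, gAct, (hf'.add hg').ext2_eq h, hf'.ext2_eq h, hg'.ext2_eq h]
  split_ifs
  · rw [Pi.add_apply, mul_add]
  · rw [Pi.add_apply, mul_add]

theorem MemB.gAct_smul (h : Adm p L k α β) {f : ℚ_[p] → L} (hf : MemB p L k α β f) (c : L)
    (m : Matrix (Fin 2) (Fin 2) ℚ_[p]) :
    gAct p L k α β m (c • f) = c • gAct p L k α β m f := by
  obtain ⟨-, f', hf'⟩ := hf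
  funext z
  rw [Pi.smul_apply, gAct, gAct, (hf'.smul c).ext2_eq h, hf'.ext2_eq h]
  split_ifs
  · rw [Pi.smul_apply, smul_eq_mul, smul_eq_mul, mul_left_comm]
  · rw [Pi.smul_apply, smul_eq_mul, smul_eq_mul, mul_left_comm]

end BSpace

section Forms

set_option linter.unusedSectionVars false

variable {p} {L} [IsUltrametricDist L] [CompleteSpace L]

variable {k : ℕ} {α β : L}

variable (k α β) in
/-- A cut function composed with the two linear forms `a x + b y` and `c x + d y`. -/
def cutF (R : ℝ → ℝ → Prop) (j : ℕ) (a b c d : ℚ_[p]) (x y : ℚ_[p]) : L :=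
  cut p k α β R j (a * x + b * y) (c * x + d * y)

theorem homog_cutF (h : Adm p L k α β) {R : ℝ → ℝ → Prop} (hR : CutRel p R) (j : ℕ)
    (a b c d : ℚ_[p]) : Homog k α β (cutF k α β R j a b c d) := fun t ht x y => by
  rw [cutF, cutF, ← cut_mul h hR j ht]
  congr 1 <;> ring

theorem cutF_mul (h : Adm p L k α β) {R : ℝ → ℝ → Prop} (hR : CutRel p R) (j : ℕ) {t : ℚ_[p]}
    (ht : t ≠ 0) (a b c d : ℚ_[p]) :
    cutF k α β R j (t * a) (t * b) (t * c) (t * d) =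
      wt p k α β t • cutF k α β R j a b c d := by
  funext x y
  rw [Pi.smul_apply, Pi.smul_apply, smul_eq_mul, cutF, cutF, ← cut_mul h hR j ht]
  congr 1 <;> ring

theorem cutF_chart_zero (R : ℝ → ℝ → Prop) (j : ℕ) (a b c d : ℚ_[p]) (z : ℤ_[p]) :
    cutF k α β R j a b c d (p * z) 1 =
      cut p k α β R j (aff (a * p) b z) (aff (c * p) d z) := by
  rw [cutF, aff, aff]
  congr 1 <;> ring

theorem cutF_chart_infty (R : ℝ → ℝ → Prop) (j : ℕ) (a b c d : ℚ_[p]) (z : ℤ_[p]) :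
    cutF k α β R j a b c d 1 z = cut p k α β R j (aff b a z) (aff d c z) := by
  rw [cutF, aff, aff]
  congr 1 <;> ring

theorem norm_mul_p_le {a : ℚ_[p]} (ha : ‖a‖ ≤ 1) : ‖a * p‖ ≤ 1 := by
  rw [norm_mul]
  exact mul_le_one₀ ha (norm_nonneg _) (Padic.norm_p_lt_one).le

theorem p_ne_zero : (p : ℚ_[p]) ≠ 0 := Nat.cast_ne_zero.2 (Fact.out : p.Prime).ne_zero

theorem exists_mul_norm_le_one (a b c d : ℚ_[p]) :
    ∃ t : ℚ_[p], t ≠ 0 ∧ ‖t * a‖ ≤ 1 ∧ ‖t * b‖ ≤ 1 ∧ ‖t * c‖ ≤ 1 ∧ ‖t * d‖ ≤ 1 := by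
  have hM : 0 < (‖a‖ + ‖b‖ + ‖c‖ + ‖d‖ + 1)⁻¹ := by positivity
  obtain ⟨t, ht0, ht⟩ := NormedField.exists_norm_lt ℚ_[p] hM
  have key : ∀ x : ℚ_[p], ‖x‖ ≤ ‖a‖ + ‖b‖ + ‖c‖ + ‖d‖ + 1 → ‖t * x‖ ≤ 1 := fun x hx => by
    rw [norm_mul]
    refine (mul_le_mul ht.le hx (norm_nonneg _) hM.le).trans (le_of_eq ?_)
    exact inv_mul_cancel₀ (inv_pos.1 hM).ne'
  have h1 := norm_nonneg a
  have h2 := norm_nonneg b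
  have h3 := norm_nonneg c
  have h4 := norm_nonneg d
  exact ⟨t, norm_pos_iff.1 ht0, key a (by linarith), key b (by linarith), key c (by linarith),
    key d (by linarith)⟩

variable (k α β) in
/-- The homogeneous functions whose restrictions to `y = 1` make up `π(α)`. -/
def W2 : Submodule L (ℚ_[p] → ℚ_[p] → L) :=
  Submodule.span L {F | ∃ (i : ℕ) (a b c d : ℚ_[p]), i ≤ k - 2 ∧ a * d - b * c ≠ 0 ∧
    F = cutF k α β (· ≤ ·) i a b c d}

theorem cutF_mem_W2 {i : ℕ} (hi : i ≤ k - 2) {a b c d : ℚ_[p]} (hdet : a * d - b * c ≠ 0) :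
    cutF k α β (· ≤ ·) i a b c d ∈ W2 (p := p) k α β :=
  Submodule.subset_span ⟨i, a, b, c, d, hi, hdet, rfl⟩

theorem homog_of_mem_W2 (h : Adm p L k α β) {F : ℚ_[p] → ℚ_[p] → L} (hF : F ∈ W2 k α β) :
    Homog k α β F := by
  induction hF using Submodule.span_induction with
  | mem F hF =>
    obtain ⟨i, a, b, c, d, -, -, rfl⟩ := hF
    exact homog_cutF h cutRel_le i a b c d
  | zero => intro t _ x y; simp
  | add F G _ _ hF hG =>
    intro t ht x y
    simp only [Pi.add_apply, hF t ht, hG t ht, mul_add]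
  | smul c F _ hF =>
    intro t ht x y
    simp only [Pi.smul_apply, smul_eq_mul, hF t ht]
    ring

theorem exists_lp_cutF_of_integral {i : ℕ} (hi : i ≤ k - 2) {a b c d : ℚ_[p]} (ha : ‖a‖ ≤ 1)
    (hb : ‖b‖ ≤ 1) (hc : ‖c‖ ≤ 1) (hd : ‖d‖ ≤ 1) (hdet : a * d - b * c ≠ 0) :
    ∃ N, LP (k - 2) N (fun z : ℤ_[p] => cutF k α β (· ≤ ·) i a b c d (p * z) 1) ∧
      LP (k - 2) N (fun z : ℤ_[p] => cutF k α β (· ≤ ·) i a b c d 1 z) := by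
  simp only [cutF_chart_zero, cutF_chart_infty]
  have h1 : a * p * d - b * (c * p) ≠ 0 := by
    have : a * p * d - b * (c * p) = (a * d - b * c) * p := by ring
    rw [this]
    exact mul_ne_zero hdet p_ne_zero
  have h2 : b * c - a * d ≠ 0 := by rwa [← neg_sub, neg_ne_zero]
  obtain ⟨N, hN⟩ := exists_lp_cut_le (L := L) (α := α) (β := β) hi (norm_mul_p_le ha)
    (norm_mul_p_le hc) hd h1
  obtain ⟨N', hN'⟩ := exists_lp_cut_le (L := L) (α := α) (β := β) hi hb hd hc h2
  exact ⟨max N N', hN.mono (le_max_left _ _), hN'.mono (le_max_right _ _)⟩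

theorem exists_lp_of_mem_W2 (h : Adm p L k α β) {F : ℚ_[p] → ℚ_[p] → L} (hF : F ∈ W2 k α β) :
    ∃ N, LP (k - 2) N (fun z : ℤ_[p] => F (p * z) 1) ∧
      LP (k - 2) N (fun z : ℤ_[p] => F 1 z) := by
  induction hF using Submodule.span_induction with
  | mem F hF =>
    obtain ⟨i, a, b, c, d, hi, hdet, rfl⟩ := hF
    obtain ⟨t, ht, h1, h2, h3, h4⟩ := exists_mul_norm_le_one a b c d
    have hdet' : t * a * (t * d) - t * b * (t * c) ≠ 0 := by
      have : t * a * (t * d) - t * b * (t * c) = t * t * (a * d - b * c) := by ring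
      rw [this]
      exact mul_ne_zero (mul_ne_zero ht ht) hdet
    obtain ⟨N, hN, hN'⟩ := exists_lp_cutF_of_integral (L := L) (α := α) (β := β) hi h1 h2 h3 h4
      hdet'
    have hw := wt_ne h ht
    have heq : cutF k α β (· ≤ ·) i a b c d = (wt p k α β t)⁻¹ •
        cutF k α β (· ≤ ·) i (t * a) (t * b) (t * c) (t * d) := by
      rw [cutF_mul h cutRel_le i ht, smul_smul, inv_mul_cancel₀ hw, one_smul]
    rw [heq]
    exact ⟨N, hN.smul _, hN'.smul _⟩
  | zero => exact ⟨0, lp_zero _ _, lp_zero _ _⟩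
  | add F G _ _ hF hG =>
    obtain ⟨N, h1, h2⟩ := hF
    obtain ⟨N', h1', h2'⟩ := hG
    exact ⟨max N N', (h1.mono (le_max_left _ _)).add (h1'.mono (le_max_right _ _)),
      (h2.mono (le_max_left _ _)).add (h2'.mono (le_max_right _ _))⟩
  | smul c F _ hF =>
    obtain ⟨N, h1, h2⟩ := hF
    exact ⟨N, h1.smul c, h2.smul c⟩

theorem memB_ev_of_mem_W2 (h : Adm p L k α β) {F : ℚ_[p] → ℚ_[p] → L} (hF : F ∈ W2 k α β) :
    MemB p L k α β (ev F) := by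
  obtain ⟨N, h1, h2⟩ := exists_lp_of_mem_W2 h hF
  exact (homog_of_mem_W2 h hF).memB (h1.isCr h.pos_left.le) (h2.isCr h.pos_left.le)

theorem gAct_ev_of_mem_W2 (h : Adm p L k α β) {F : ℚ_[p] → ℚ_[p] → L} (hF : F ∈ W2 k α β)
    {m : Matrix (Fin 2) (Fin 2) ℚ_[p]} (hm : det2 p m ≠ 0) :
    gAct p L k α β m (ev F) = ev (act α m F) := by
  obtain ⟨N, -, h2⟩ := exists_lp_of_mem_W2 h hF
  exact (homog_of_mem_W2 h hF).gAct_ev h (h2.isCr h.pos_left.le) hm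

theorem act_cutF (R : ℝ → ℝ → Prop) (i : ℕ) (a b c d : ℚ_[p])
    (m : Matrix (Fin 2) (Fin 2) ℚ_[p]) :
    act α m (cutF k α β R i a b c d) = α ^ (-(det2 p m).valuation) •
      cutF k α β R i (a * m 1 1 - b * m 1 0) (b * m 0 0 - a * m 0 1)
        (c * m 1 1 - d * m 1 0) (d * m 0 0 - c * m 0 1) := by
  funext x y
  rw [act_apply, Pi.smul_apply, Pi.smul_apply, smul_eq_mul, cutF, cutF]
  congr 2 <;> ring

theorem det_comp (a b c d : ℚ_[p]) (m : Matrix (Fin 2) (Fin 2) ℚ_[p]) :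
    (a * m 1 1 - b * m 1 0) * (d * m 0 0 - c * m 0 1) -
      (b * m 0 0 - a * m 0 1) * (c * m 1 1 - d * m 1 0) = (a * d - b * c) * det2 p m := by
  rw [det2]; ring

theorem act_mem_W2 {F : ℚ_[p] → ℚ_[p] → L} (hF : F ∈ W2 k α β)
    {m : Matrix (Fin 2) (Fin 2) ℚ_[p]} (hm : det2 p m ≠ 0) : act α m F ∈ W2 k α β := by
  induction hF using Submodule.span_induction with
  | mem F hF =>
    obtain ⟨i, a, b, c, d, hi, hdet, rfl⟩ := hF
    rw [act_cutF]
    exact Submodule.smul_mem _ _ (cutF_mem_W2 hi (by rw [det_comp]; exact mul_ne_zero hdet hm))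
  | zero => rw [map_zero]; exact Submodule.zero_mem _
  | add F G _ _ hF hG => rw [map_add]; exact Submodule.add_mem _ hF hG
  | smul c F _ hF => rw [map_smul]; exact Submodule.smul_mem _ _ hF

end Forms

section LGen

set_option linter.unusedSectionVars false

variable {p} {L} [IsUltrametricDist L] [CompleteSpace L]

variable {k : ℕ} {α β : L}

theorem Adm.le_of_lt (h : Adm p L k α β) {j : ℕ} (hj : (j : ℝ) < valL p L α) : j ≤ k - 2 := by
  have := hj.trans h.valL_lt
  exact Nat.lt_succ_iff.1 (by exact_mod_cast this)

theorem monomialFun_eq (j : ℕ) :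
    monomialFun p L j = ev (cutF k α β (fun _ _ => True) j 1 0 0 1) := by
  funext z
  simp [ev_apply, cutF, cut, monomialFun, wt_one]

theorem specFun_eq {j : ℕ} (hj : j ≤ k - 2) (a : ℚ_[p]) :
    specFun p L k α β a j = ev (cutF k α β (fun _ _ => True) j 0 1 1 (-a)) := by
  funext z
  have h1 : (1 : ℚ_[p]) * z + -a * 1 = z - a := by ring
  have h2 : (0 : ℚ_[p]) * z + 1 * 1 = 1 := by ring
  rw [ev_apply, cutF, cut, specFun, h1, h2]
  by_cases hz : z = a
  · simp [hz]
  · have hz' : z - a ≠ 0 := sub_ne_zero.2 hz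
    rw [if_neg hz, if_pos ⟨hz', trivial⟩, wt, iotaL_div, div_pow, mul_assoc]
    congr 1
    have h4 : iotaL p L (z - a) ^ (k - 2) =
        iotaL p L (z - a) ^ (k - 2 - j) * iotaL p L (z - a) ^ j := by
      rw [← pow_add, Nat.sub_add_cancel hj]
    have h5 : iotaL p L 1 = 1 := map_one (algebraMap ℚ_[p] L)
    rw [h4, h5, one_pow, mul_one_div, mul_div_cancel_right₀ _ (pow_ne_zero j (iotaL_ne hz'))]

theorem exists_eq_ev_of_mem_lGen (h : Adm p L k α β) {f : ℚ_[p] → L}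
    (hf : f ∈ lGen p L k α β) : ∃ (j : ℕ) (a b c d : ℚ_[p]), (j : ℝ) < valL p L α ∧
      a * d - b * c ≠ 0 ∧ ‖a‖ ≤ 1 ∧ ‖b‖ ≤ 1 ∧ ‖c‖ ≤ 1 ∧ ‖d‖ ≤ 1 ∧
      ∃ u : L, f = u • ev (cutF k α β (fun _ _ => True) j a b c d) := by
  obtain ⟨j, hj, rfl | ⟨a, rfl⟩⟩ := hf
  · exact ⟨j, 1, 0, 0, 1, hj, by simp, by simp, by simp, by simp, by simp, 1,
      by rw [one_smul]; exact monomialFun_eq j⟩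
  · obtain ⟨t, ht, h1, h2, h3, h4⟩ := exists_mul_norm_le_one (p := p) 0 1 1 (-a)
    refine ⟨j, t * 0, t * 1, t * 1, t * -a, hj, by simpa using ht, h1, h2, h3, h4,
      (wt p k α β t)⁻¹, ?_⟩
    rw [cutF_mul h cutRel_true j ht, map_smul, smul_smul, inv_mul_cancel₀ (wt_ne h ht), one_smul]
    exact specFun_eq (h.le_of_lt hj) a

theorem memB_ev_cutF_true (h : Adm p L k α β) {j : ℕ} (hj : (j : ℝ) < valL p L α)
    {a b c d : ℚ_[p]} (ha : ‖a‖ ≤ 1) (hb : ‖b‖ ≤ 1) (hc : ‖c‖ ≤ 1) (hd : ‖d‖ ≤ 1) :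
    MemB p L k α β (ev (cutF k α β (fun _ _ => True) j a b c d)) := by
  refine (homog_cutF h cutRel_true j a b c d).memB ?_ ?_
  · simp only [cutF_chart_zero]
    exact isCr_cut_true h hj (norm_mul_p_le ha) hb (norm_mul_p_le hc) hd
  · simp only [cutF_chart_infty]
    exact isCr_cut_true h hj hb ha hd hc

theorem memB_of_mem_span_lGen (h : Adm p L k α β) {f : ℚ_[p] → L}
    (hf : f ∈ Submodule.span L (lGen p L k α β)) : MemB p L k α β f := by
  induction hf using Submodule.span_induction with
  | mem f hf =>
    obtain ⟨j, a, b, c, d, hj, -, ha, hb, hc, hd, u, rfl⟩ := exists_eq_ev_of_mem_lGen h hf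
    exact (memB_ev_cutF_true h hj ha hb hc hd).smul h u
  | zero => exact bbd_zero.memB
  | add f g _ _ hf hg => exact hf.add h hg
  | smul c f _ hf => exact hf.smul h c

theorem memLalpha_of_mem_span_lGen (h : Adm p L k α β) {f : ℚ_[p] → L}
    (hf : f ∈ Submodule.span L (lGen p L k α β)) : MemLalpha p L k α β f := by
  refine ⟨memB_of_mem_span_lGen h hf, fun ε hε => ⟨f, hf, ?_⟩⟩
  rw [sub_self]
  exact lt_of_le_of_lt (bbd_zero.bNorm_le h) hε

theorem ev_cutF_true_mem_span (h : Adm p L k α β) {j : ℕ} (hj : (j : ℝ) < valL p L α)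
    (a b c d : ℚ_[p]) :
    ev (cutF k α β (fun _ _ => True) j a b c d) ∈ Submodule.span L (lGen p L k α β) := by
  have hlt : ∀ l ∈ Finset.range (j + 1), (l : ℝ) < valL p L α := fun l hl => by
    refine lt_of_le_of_lt ?_ hj
    exact_mod_cast Nat.lt_succ_iff.1 (Finset.mem_range.1 hl)
  rcases eq_or_ne c 0 with rfl | hc
  · rcases eq_or_ne d 0 with rfl | hd
    · convert Submodule.zero_mem _ using 1
      funext z
      simp [ev_apply, cutF, cut]
    · have heq : ev (cutF k α β (fun _ _ => True) j a b 0 d) =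
          ∑ l ∈ Finset.range (j + 1), (wt p k α β d * (iotaL p L (a / d) ^ l *
            iotaL p L (b / d) ^ (j - l) * (j.choose l : L))) • monomialFun p L l := by
        funext z
        have h1 : (0 : ℚ_[p]) * z + d * 1 = d := by ring
        have h2 : (a * z + b * 1) / d = a / d * z + b / d := by field_simp
        simp only [ev_apply, cutF, cut, h1, h2]
        rw [if_pos ⟨hd, trivial⟩, iotaL_add, iotaL_mul, add_pow, Finset.sum_apply, Finset.mul_sum]
        refine Finset.sum_congr rfl fun l _ => ?_
        rw [Pi.smul_apply, smul_eq_mul, monomialFun, mul_pow]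
        ring
      rw [heq]
      exact Submodule.sum_mem _ fun l hl => Submodule.smul_mem _ _
        (Submodule.subset_span ⟨l, hlt l hl, Or.inl rfl⟩)
  · have heq : ev (cutF k α β (fun _ _ => True) j a b c d) =
        ∑ l ∈ Finset.range (j + 1), (wt p k α β c * (iotaL p L ((b - a * d / c) / c) ^ l *
          iotaL p L (a / c) ^ (j - l) * (j.choose l : L))) • specFun p L k α β (-d / c) l := by
      funext z
      rw [Finset.sum_apply]
      have h1 : c * z + d * 1 = c * (z - -d / c) := by field_simp; ring
      rw [ev_apply, cutF, cut, h1]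
      by_cases hz : z = -d / c
      · rw [if_neg (by simp [hz]), Finset.sum_eq_zero]
        intro l _
        simp [hz, specFun]
      · have hz' : z - -d / c ≠ 0 := sub_ne_zero.2 hz
        have h2 : (a * z + b * 1) / (c * (z - -d / c)) =
            (b - a * d / c) / c * (1 / (z - -d / c)) + a / c := by
          obtain ⟨w, rfl⟩ : ∃ w, z = w + -d / c := ⟨z - -d / c, by ring⟩
          rw [add_sub_cancel_right] at hz' ⊢
          field_simp
          ring
        rw [if_pos ⟨mul_ne_zero hc hz', trivial⟩, h2, iotaL_add, iotaL_mul, add_pow,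
          Finset.mul_sum, wt_mul h hc hz']
        refine Finset.sum_congr rfl fun l hl => ?_
        have hs := congrFun (specFun_eq (L := L) (α := α) (β := β)
          (h.le_of_lt (hlt l hl)) (-d / c)) z
        have h3 : (1 : ℚ_[p]) * z + -(-d / c) * 1 = z - -d / c := by ring
        have h4 : (0 : ℚ_[p]) * z + 1 * 1 = 1 := by ring
        rw [ev_apply, cutF, cut, h3, h4, if_pos ⟨hz', trivial⟩] at hs
        rw [Pi.smul_apply, smul_eq_mul, hs, mul_pow]
        ring
    rw [heq]
    exact Submodule.sum_mem _ fun l hl => Submodule.smul_mem _ _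
      (Submodule.subset_span ⟨l, hlt l hl, Or.inr ⟨_, rfl⟩⟩)

end LGen

section Upper

set_option linter.unusedSectionVars false

variable {p} {L} [IsUltrametricDist L] [CompleteSpace L]

variable {k : ℕ} {α β : L}

theorem cut_le_add_left (i : ℕ) {s : ℚ_[p]} (hs : ‖s‖ ≤ 1) (x y : ℚ_[p]) :
    cut p k α β (· ≤ ·) i (s * y + x) y = ∑ j ∈ Finset.range (i + 1),
      ((i.choose j : L) * iotaL p L s ^ (i - j)) * cut p k α β (· ≤ ·) j x y := by
  have hsy : ‖s * y‖ ≤ ‖y‖ := by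
    rw [norm_mul]; exact mul_le_of_le_one_left (norm_nonneg _) hs
  have hiff : ‖s * y + x‖ ≤ ‖y‖ ↔ ‖x‖ ≤ ‖y‖ := by
    constructor
    · intro h1
      have h2 := norm_add_le_max (s * y + x) (-(s * y))
      rw [norm_neg, show s * y + x + -(s * y) = x by ring] at h2
      exact h2.trans (max_le h1 hsy)
    · intro h1
      exact (norm_add_le_max _ _).trans (max_le hsy h1)
  simp only [cut, hiff]
  by_cases hc : y ≠ 0 ∧ ‖x‖ ≤ ‖y‖
  · simp only [if_pos hc]
    have h2 : (s * y + x) / y = x / y + s := by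
      have := hc.1
      field_simp
      ring
    rw [h2, iotaL_add, add_pow, Finset.mul_sum]
    refine Finset.sum_congr rfl fun j _ => ?_
    ring
  · simp only [if_neg hc, mul_zero, Finset.sum_const_zero]

theorem norm_mul_add_eq {s x y : ℚ_[p]} (hs : ‖s‖ < 1) (hy : y ≠ 0) (hxy : ‖x‖ ≤ ‖y‖) :
    ‖s * x + y‖ = ‖y‖ := by
  refine norm_eq_of_sub_lt ?_
  rw [add_sub_cancel_right, norm_mul]
  have := norm_pos_iff.2 hy
  nlinarith [norm_nonneg s, norm_nonneg x]

theorem cut_le_add_right {i : ℕ} (hi : i ≤ k - 2) {s : ℚ_[p]} (hs : ‖s‖ < 1) (x y : ℚ_[p]) :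
    cut p k α β (· ≤ ·) i x (s * x + y) = ∑ l ∈ Finset.range (k - 2 - i + 1),
      (((k - 2 - i).choose l : L) * iotaL p L s ^ l) * cut p k α β (· ≤ ·) (i + l) x y := by
  have himp : ∀ {s y : ℚ_[p]}, ‖s‖ < 1 → y ≠ 0 ∧ ‖x‖ ≤ ‖y‖ →
      s * x + y ≠ 0 ∧ ‖x‖ ≤ ‖s * x + y‖ := fun {s y} hs hc => by
    have h1 := norm_mul_add_eq hs hc.1 hc.2
    exact ⟨norm_pos_iff.1 (h1 ▸ norm_pos_iff.2 hc.1), h1 ▸ hc.2⟩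
  have hiff : (s * x + y ≠ 0 ∧ ‖x‖ ≤ ‖s * x + y‖) ↔ (y ≠ 0 ∧ ‖x‖ ≤ ‖y‖) := by
    refine ⟨fun hc => ?_, himp hs⟩
    have := himp (s := -s) (by rwa [norm_neg]) hc
    rwa [show -s * x + (s * x + y) = y by ring] at this
  simp only [cut, hiff]
  by_cases hc : y ≠ 0 ∧ ‖x‖ ≤ ‖y‖
  · simp only [if_pos hc]
    have hy' : s * x + y ≠ 0 := (himp hs hc).1
    have hyi : iotaL p L y ≠ 0 := iotaL_ne hc.1
    have hyi' : iotaL p L (s * x + y) ≠ 0 := iotaL_ne hy'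
    have key : ∀ (w : L) (n : ℕ), w ≠ 0 → n ≤ k - 2 → ∀ v : L,
        w ^ (k - 2) * (v / w) ^ n = w ^ (k - 2 - n) * v ^ n := fun w n hw hn v => by
      rw [div_pow, mul_div_assoc', div_eq_iff (pow_ne_zero _ hw), mul_right_comm, ← pow_add,
        Nat.sub_add_cancel hn]
    rw [wt, valuation_congr (norm_mul_add_eq hs hc.1 hc.2), iotaL_div, mul_assoc,
      key _ _ hyi' hi, iotaL_add, iotaL_mul, add_pow, Finset.sum_mul, Finset.mul_sum]
    refine Finset.sum_congr rfl fun l hl => ?_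
    have hl' : i + l ≤ k - 2 := by
      have := Finset.mem_range.1 hl
      omega
    rw [wt, iotaL_div, mul_assoc _ _ ((iotaL p L x / iotaL p L y) ^ (i + l)), key _ _ hyi hl',
      Nat.sub_add_eq, pow_add]
    ring
  · simp only [if_neg hc, mul_zero, Finset.sum_const_zero]

variable (k α β) in
/-- `f` has distance at most `M` from the span of the generators of `L(α)`. -/
def QB (M : ℝ) (f : ℚ_[p] → L) : Prop :=
  ∃ g ∈ Submodule.span L (lGen p L k α β), BBd k α β M (f - g)

theorem QB.mono {M M' : ℝ} (hM : M ≤ M') {f : ℚ_[p] → L} (hf : QB k α β M f) :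
    QB k α β M' f := by
  obtain ⟨g, hg, h1⟩ := hf
  exact ⟨g, hg, h1.mono hM⟩

theorem QB.nonneg {M : ℝ} {f : ℚ_[p] → L} (hf : QB k α β M f) : 0 ≤ M := by
  obtain ⟨g, -, h1⟩ := hf
  exact h1.nonneg

theorem QB.add {M : ℝ} {f f' : ℚ_[p] → L} (hf : QB k α β M f) (hf' : QB k α β M f') :
    QB k α β M (f + f') := by
  obtain ⟨g, hg, h1⟩ := hf
  obtain ⟨g', hg', h1'⟩ := hf'
  refine ⟨g + g', Submodule.add_mem _ hg hg', ?_⟩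
  rw [add_sub_add_comm]
  exact h1.add h1'

theorem QB.smul {M : ℝ} {f : ℚ_[p] → L} (hf : QB k α β M f) (c : L) :
    QB k α β (‖c‖ * M) (c • f) := by
  obtain ⟨g, hg, h1⟩ := hf
  refine ⟨c • g, Submodule.smul_mem _ _ hg, ?_⟩
  rw [← smul_sub]
  exact h1.smul c

theorem qb_zero : QB k α β 0 (0 : ℚ_[p] → L) :=
  ⟨0, Submodule.zero_mem _, by rw [sub_zero]; exact bbd_zero⟩

theorem QB.sum {ι : Type*} {M : ℝ} (hM : 0 ≤ M) (s : Finset ι) {f : ι → ℚ_[p] → L}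
    (h : ∀ i ∈ s, QB k α β M (f i)) : QB k α β M (∑ i ∈ s, f i) := by
  induction s using Finset.induction_on with
  | empty => rw [Finset.sum_empty]; exact qb_zero.mono hM
  | insert a s ha ih =>
    rw [Finset.sum_insert ha]
    exact (h a (Finset.mem_insert_self a s)).add
      (ih fun i hi => h i (Finset.mem_insert_of_mem hi))

theorem BBd.qb {M : ℝ} {f : ℚ_[p] → L} (hf : BBd k α β M f) : QB k α β M f :=
  ⟨0, Submodule.zero_mem _, by rwa [sub_zero]⟩

theorem aff_mul (δ a b : ℚ_[p]) (z : ℤ_[p]) : aff (δ * a) (δ * b) z = δ * aff a b z :=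
  (mul_aff δ a b z).symm

theorem norm_mul_le_one {x y : ℚ_[p]} (hx : ‖x‖ ≤ 1) (hy : ‖y‖ ≤ 1) : ‖x * y‖ ≤ 1 := by
  rw [norm_mul]
  exact mul_le_one₀ hx (norm_nonneg _) hy

theorem exists_bbd_true_sub_le (h : Adm p L k α β) :
    ∃ K : ℝ, 0 ≤ K ∧ ∀ j : ℕ, (j : ℝ) < valL p L α → ∀ a b c d δ : ℚ_[p], ‖a‖ ≤ 1 → ‖b‖ ≤ 1 →
      ‖c‖ ≤ 1 → ‖d‖ ≤ 1 → a * d - b * c ≠ 0 → δ ≠ 0 → ‖δ‖ ≤ 1 →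
      BBd k α β (K * ‖δ‖ ^ valL p L α)
        (ev (cutF k α β (fun _ _ => True) j (δ * a) (δ * b) c d) -
          ev (cutF k α β (· ≤ ·) j (δ * a) (δ * b) c d)) := by
  obtain ⟨K, hK0, hK⟩ := exists_bound_cut_gt h
  refine ⟨K, hK0, fun j hj a b c d δ ha hb hc hd hdet hδ0 hδ => ?_⟩
  have hcut : cutF k α β (fun s t => t < s) j (δ * a) (δ * b) c d =
      cutF k α β (fun _ _ => True) j (δ * a) (δ * b) c d -
        cutF k α β (· ≤ ·) j (δ * a) (δ * b) c d := by
    funext x y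
    simp only [Pi.sub_apply, cutF]
    rw [cut_true_eq, add_sub_cancel_left]
  have hdet' : δ * a * d - δ * b * c ≠ 0 := by
    rw [mul_assoc, mul_assoc, ← mul_sub]
    exact mul_ne_zero hδ0 hdet
  have hda := norm_mul_le_one hδ ha
  have hdb := norm_mul_le_one hδ hb
  obtain ⟨N, hN, hN'⟩ := exists_lp_cutF_of_integral (L := L) (α := α) (β := β) (h.le_of_lt hj)
    hda hdb hc hd hdet'
  rw [← map_sub, ← hcut]
  refine (homog_cutF h cutRel_gt j _ _ c d).bbd ?_ ?_ ?_ ?_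
  · rw [hcut]
    refine IsCr.sub ?_ (hN.isCr h.pos_left.le)
    simp only [cutF_chart_zero]
    exact isCr_cut_true h hj (norm_mul_p_le hda) hdb (norm_mul_p_le hc) hd
  · rw [hcut]
    refine IsCr.sub ?_ (hN'.isCr h.pos_left.le)
    simp only [cutF_chart_infty]
    exact isCr_cut_true h hj hdb hda hd hc
  · simp only [cutF_chart_zero, mul_assoc, aff_mul]
    exact hK j hj _ _ _ _ δ (norm_mul_p_le ha) hb (norm_mul_p_le hc) hd hδ0 hδ
  · simp only [cutF_chart_infty, aff_mul]
    exact hK j hj _ _ _ _ δ hb ha hd hc hδ0 hδ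

theorem exists_qb_cutF_left (h : Adm p L k α β) :
    ∃ K : ℝ, 0 ≤ K ∧ ∀ j : ℕ, j ≤ k - 2 → ∀ a b c d δ : ℚ_[p], ‖a‖ ≤ 1 → ‖b‖ ≤ 1 →
      ‖c‖ ≤ 1 → ‖d‖ ≤ 1 → ‖a * d - b * c‖ = 1 → δ ≠ 0 → ‖δ‖ ≤ 1 →
      QB k α β (K * ‖δ‖ ^ valL p L α) (ev (cutF k α β (· ≤ ·) j (δ * a) (δ * b) c d)) := by
  obtain ⟨K1, hK10, hK1⟩ := exists_bbd_true_sub_le h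
  obtain ⟨K2, hK20, hK2⟩ := exists_bound_cut_le_left h
  have hp := p_pos (p := p)
  refine ⟨max K1 K2, hK10.trans (le_max_left _ _),
    fun j hj a b c d δ ha hb hc hd hdet hδ0 hδ => ?_⟩
  have hdet0 : a * d - b * c ≠ 0 := norm_pos_iff.1 (by rw [hdet]; exact one_pos)
  rcases lt_or_ge (j : ℝ) (valL p L α) with hjr | hjr
  · refine ⟨ev (cutF k α β (fun _ _ => True) j (δ * a) (δ * b) c d),
      ev_cutF_true_mem_span h hjr _ _ _ _, ?_⟩
    have h1 := (hK1 j hjr a b c d δ ha hb hc hd hdet0 hδ0 hδ).smul (-1)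
    rw [norm_neg, norm_one, one_mul, neg_one_smul, neg_sub] at h1
    exact h1.mono (by gcongr; exact le_max_left _ _)
  · refine BBd.qb (BBd.mono (M := K2 * ‖δ‖ ^ valL p L α) (by gcongr; exact le_max_right _ _) ?_)
    have hdet' : δ * a * d - δ * b * c ≠ 0 := by
      rw [mul_assoc, mul_assoc, ← mul_sub]
      exact mul_ne_zero hδ0 hdet0
    obtain ⟨N, hN, hN'⟩ := exists_lp_cutF_of_integral (L := L) (α := α) (β := β) hj
      (norm_mul_le_one hδ ha) (norm_mul_le_one hδ hb) hc hd hdet'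
    refine (homog_cutF h cutRel_le j _ _ c d).bbd (hN.isCr h.pos_left.le)
      (hN'.isCr h.pos_left.le) ?_ ?_
    · simp only [cutF_chart_zero, mul_assoc, aff_mul]
      refine hK2 j hjr hj _ _ _ _ δ (norm_mul_p_le ha) hb (norm_mul_p_le hc) hd ?_ hδ0 hδ
      rw [show a * p * d - b * (c * p) = (a * d - b * c) * p by ring, norm_mul, hdet, one_mul,
        Padic.norm_p]
    · simp only [cutF_chart_infty, aff_mul]
      refine hK2 j hjr hj _ _ _ _ δ hb ha hd hc ?_ hδ0 hδ
      rw [norm_sub_rev, hdet]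
      exact inv_le_one_of_one_le₀ (one_lt_p (p := p)).le

theorem exists_qb_cutF_right (h : Adm p L k α β) :
    ∃ K : ℝ, 0 ≤ K ∧ ∀ j : ℕ, j ≤ k - 2 → ∀ a b c d δ : ℚ_[p], ‖a‖ ≤ 1 → ‖b‖ ≤ 1 →
      ‖c‖ ≤ 1 → ‖d‖ ≤ 1 → ‖a * d - b * c‖ = 1 → δ ≠ 0 → ‖δ‖ ≤ 1 →
      QB k α β (K * ‖δ‖ ^ valL p L α) (ev (cutF k α β (· ≤ ·) j a b (δ * c) (δ * d))) := by
  obtain ⟨K, hK0, hK⟩ := exists_bound_cut_le_right h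
  refine ⟨K, hK0, fun j hj a b c d δ ha hb hc hd hdet hδ0 hδ => BBd.qb ?_⟩
  have hdet0 : a * d - b * c ≠ 0 := norm_pos_iff.1 (by rw [hdet]; exact one_pos)
  have hdet' : a * (δ * d) - b * (δ * c) ≠ 0 := by
    rw [mul_left_comm, mul_left_comm b, ← mul_sub]
    exact mul_ne_zero hδ0 hdet0
  obtain ⟨N, hN, hN'⟩ := exists_lp_cutF_of_integral (L := L) (α := α) (β := β) hj
    ha hb (norm_mul_le_one hδ hc) (norm_mul_le_one hδ hd) hdet'
  refine (homog_cutF h cutRel_le j a b _ _).bbd (hN.isCr h.pos_left.le)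
    (hN'.isCr h.pos_left.le) ?_ ?_
  · simp only [cutF_chart_zero]
    simp only [mul_assoc δ, aff_mul]
    exact hK j hj _ _ _ _ δ (norm_mul_p_le ha) (norm_mul_p_le hc) hd hδ0 hδ
  · simp only [cutF_chart_infty, aff_mul]
    exact hK j hj _ _ _ _ δ hb hd hc hδ0 hδ

theorem norm_choose_mul_pow_le (n j : ℕ) {s : ℚ_[p]} (hs : ‖s‖ ≤ 1) (m : ℕ) :
    ‖(n.choose j : L) * iotaL p L s ^ m‖ ≤ 1 := by
  rw [norm_mul, norm_pow, norm_iotaL]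
  exact mul_le_one₀ (norm_natCast_le _) (by positivity) (pow_le_one₀ (norm_nonneg _) hs)

theorem QB.sum_smul {ι : Type*} {M : ℝ} (hM : 0 ≤ M) (s : Finset ι) {u : ι → L}
    {f : ι → ℚ_[p] → L} (hu : ∀ i ∈ s, ‖u i‖ ≤ 1) (h : ∀ i ∈ s, QB k α β M (f i)) :
    QB k α β M (∑ i ∈ s, u i • f i) :=
  QB.sum hM s fun i hi => ((h i hi).smul (u i)).mono (mul_le_of_le_one_left hM (hu i hi))

theorem exists_qb_cutF_add_left (h : Adm p L k α β) :
    ∃ K : ℝ, 0 ≤ K ∧ ∀ j : ℕ, j ≤ k - 2 → ∀ a b c d δ s : ℚ_[p], ‖a‖ ≤ 1 → ‖b‖ ≤ 1 →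
      ‖c‖ ≤ 1 → ‖d‖ ≤ 1 → ‖a * d - b * c‖ = 1 → δ ≠ 0 → ‖δ‖ ≤ 1 → ‖s‖ ≤ 1 →
      QB k α β (K * ‖δ‖ ^ valL p L α)
        (ev (cutF k α β (· ≤ ·) j (s * c + δ * a) (s * d + δ * b) c d)) := by
  obtain ⟨K, hK0, hK⟩ := exists_qb_cutF_left h
  refine ⟨K, hK0, fun i hi a b c d δ s ha hb hc hd hdet hδ0 hδ hs => ?_⟩
  have heq : ev (cutF k α β (· ≤ ·) i (s * c + δ * a) (s * d + δ * b) c d) =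
      ∑ j ∈ Finset.range (i + 1), ((i.choose j : L) * iotaL p L s ^ (i - j)) •
        ev (cutF k α β (· ≤ ·) j (δ * a) (δ * b) c d) := by
    funext z
    rw [Finset.sum_apply, ev_apply, cutF,
      show (s * c + δ * a) * z + (s * d + δ * b) * 1 =
        s * (c * z + d * 1) + (δ * a * z + δ * b * 1) by ring, cut_le_add_left i hs]
    rfl
  rw [heq]
  refine QB.sum_smul (by positivity) _ (fun j _ => norm_choose_mul_pow_le _ _ hs _)
    fun j hj => hK j ?_ a b c d δ ha hb hc hd hdet hδ0 hδ
  have := Finset.mem_range.1 hj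
  omega

theorem exists_qb_cutF_add_right (h : Adm p L k α β) :
    ∃ K : ℝ, 0 ≤ K ∧ ∀ j : ℕ, j ≤ k - 2 → ∀ a b c d δ s : ℚ_[p], ‖a‖ ≤ 1 → ‖b‖ ≤ 1 →
      ‖c‖ ≤ 1 → ‖d‖ ≤ 1 → ‖a * d - b * c‖ = 1 → δ ≠ 0 → ‖δ‖ ≤ 1 → ‖s‖ < 1 →
      QB k α β (K * ‖δ‖ ^ valL p L α)
        (ev (cutF k α β (· ≤ ·) j a b (s * a + δ * c) (s * b + δ * d))) := by
  obtain ⟨K, hK0, hK⟩ := exists_qb_cutF_right h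
  refine ⟨K, hK0, fun i hi a b c d δ s ha hb hc hd hdet hδ0 hδ hs => ?_⟩
  have heq : ev (cutF k α β (· ≤ ·) i a b (s * a + δ * c) (s * b + δ * d)) =
      ∑ l ∈ Finset.range (k - 2 - i + 1), (((k - 2 - i).choose l : L) * iotaL p L s ^ l) •
        ev (cutF k α β (· ≤ ·) (i + l) a b (δ * c) (δ * d)) := by
    funext z
    rw [Finset.sum_apply, ev_apply, cutF,
      show (s * a + δ * c) * z + (s * b + δ * d) * 1 =
        s * (a * z + b * 1) + (δ * c * z + δ * d * 1) by ring, cut_le_add_right hi hs]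
    rfl
  rw [heq]
  refine QB.sum_smul (by positivity) _ (fun j _ => norm_choose_mul_pow_le _ _ hs.le _)
    fun j hj => hK _ ?_ a b c d δ ha hb hc hd hdet hδ0 hδ
  have := Finset.mem_range.1 hj
  omega

theorem norm_det_le_sq {a b c d t : ℚ_[p]} (ha : ‖a‖ ≤ ‖t‖) (hb : ‖b‖ ≤ ‖t‖) (hc : ‖c‖ ≤ ‖t‖)
    (hd : ‖d‖ ≤ ‖t‖) : ‖a * d - b * c‖ ≤ ‖t‖ ^ 2 := by
  rw [sub_eq_add_neg]
  refine (norm_add_le_max _ _).trans (max_le ?_ ?_)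
  · rw [norm_mul, sq]; gcongr
  · rw [norm_neg, norm_mul, sq]; gcongr

theorem QB.of_scale (h : Adm p L k α β) {K : ℝ} {i : ℕ} {a b c d t D δ : ℚ_[p]}
    (ht : t ≠ 0) (hδ : ‖δ‖ = ‖D‖ / ‖t‖ ^ 2)
    (hq : QB k α β (K * ‖δ‖ ^ valL p L α) (ev (cutF k α β (· ≤ ·) i a b c d))) :
    QB k α β (K * ‖D‖ ^ valL p L α)
      (ev (cutF k α β (· ≤ ·) i (t * a) (t * b) (t * c) (t * d))) := by
  have h1 := hq.smul (wt p k α β t)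
  rw [← map_smul, ← cutF_mul h cutRel_le i ht] at h1
  have hpos := norm_pos_iff.2 ht
  convert h1 using 1
  rw [norm_wt h ht, hδ, Real.div_rpow (norm_nonneg _) (by positivity), ← Real.rpow_natCast ‖t‖ 2,
    ← Real.rpow_mul hpos.le]
  have : 0 < ‖t‖ ^ (2 * valL p L α) := by positivity
  push_cast
  field_simp

/-- The uniform bound modulo `L(α)` on the generators of `π(α)`. -/
theorem exists_qb_cutF (h : Adm p L k α β) :
    ∃ K : ℝ, 0 ≤ K ∧ ∀ i : ℕ, i ≤ k - 2 → ∀ a b c d : ℚ_[p], a * d - b * c ≠ 0 →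
      QB k α β (K * ‖a * d - b * c‖ ^ valL p L α) (ev (cutF k α β (· ≤ ·) i a b c d)) := by
  obtain ⟨K1, hK10, hK1⟩ := exists_qb_cutF_add_left h
  obtain ⟨K2, hK20, hK2⟩ := exists_qb_cutF_add_right h
  refine ⟨max K1 K2, hK10.trans (le_max_left _ _), fun i hi a b c d hdet => ?_⟩
  have hq1 : ∀ {f : ℚ_[p] → L}, QB k α β (K1 * ‖a * d - b * c‖ ^ valL p L α) f →
      QB k α β (max K1 K2 * ‖a * d - b * c‖ ^ valL p L α) f := fun hf =>
    hf.mono (by gcongr; exact le_max_left _ _)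
  have hq2 : ∀ {f : ℚ_[p] → L}, QB k α β (K2 * ‖a * d - b * c‖ ^ valL p L α) f →
      QB k α β (max K1 K2 * ‖a * d - b * c‖ ^ valL p L α) f := fun hf =>
    hf.mono (by gcongr; exact le_max_right _ _)
  have hdivle : ∀ {x t : ℚ_[p]}, t ≠ 0 → ‖x‖ ≤ ‖t‖ → ‖x / t‖ ≤ 1 := fun ht hx => by
    rw [norm_div]; exact div_le_one_of_le₀ hx (norm_nonneg _)
  have hδle : ∀ {t : ℚ_[p]}, t ≠ 0 → ‖a‖ ≤ ‖t‖ → ‖b‖ ≤ ‖t‖ → ‖c‖ ≤ ‖t‖ → ‖d‖ ≤ ‖t‖ →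
      ‖(a * d - b * c) / t ^ 2‖ ≤ 1 := fun ht h1 h2 h3 h4 => by
    refine hdivle (pow_ne_zero 2 ht) ?_
    rw [norm_pow]
    exact norm_det_le_sq h1 h2 h3 h4
  have hδeq : ∀ t : ℚ_[p], ‖(a * d - b * c) / t ^ 2‖ = ‖a * d - b * c‖ / ‖t‖ ^ 2 := fun t => by
    rw [norm_div, norm_pow]
  have hδ0 : ∀ {t : ℚ_[p]}, t ≠ 0 → (a * d - b * c) / t ^ 2 ≠ 0 := fun ht =>
    div_ne_zero hdet (pow_ne_zero 2 ht)
  have hz : ∀ {t : ℚ_[p]}, ‖a‖ ≤ ‖t‖ → ‖c‖ ≤ ‖t‖ → t ≠ 0 := by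
    rintro t h1 h2 rfl
    rw [norm_zero, norm_le_zero_iff] at h1 h2
    simp [h1, h2] at hdet
  have h01 : ‖(0 : ℚ_[p])‖ ≤ 1 := by simp
  have h11 : ‖(1 : ℚ_[p])‖ ≤ 1 := by simp
  rcases le_or_gt (max ‖a‖ ‖b‖) (max ‖c‖ ‖d‖) with hA | hB
  · rcases le_total ‖d‖ ‖c‖ with hcd | hcd
    · rw [max_eq_left hcd] at hA
      have ha := (le_max_left _ _).trans hA
      have hb := (le_max_right _ _).trans hA
      have ht : c ≠ 0 := hz ha le_rfl
      have := QB.of_scale h ht ((norm_neg _).trans (hδeq c))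
        (hK1 i hi 0 1 1 (d / c) (-((a * d - b * c) / c ^ 2)) (a / c) h01 h11 h11
        (hdivle ht hcd) (by simp) (neg_ne_zero.2 (hδ0 ht))
        (by rw [norm_neg]; exact hδle ht ha hb le_rfl hcd) (hdivle ht ha))
      convert hq1 this using 3 <;> (try field_simp) <;> ring
    · rw [max_eq_right hcd] at hA
      have ha := (le_max_left _ _).trans hA
      have hb := (le_max_right _ _).trans hA
      have ht : d ≠ 0 := hz ha hcd
      have := QB.of_scale h ht (hδeq d)
        (hK1 i hi 1 0 (c / d) 1 ((a * d - b * c) / d ^ 2) (b / d) h11 h01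
        (hdivle ht hcd) h11 (by simp) (hδ0 ht) (hδle ht ha hb hcd le_rfl) (hdivle ht hb))
      convert hq1 this using 3 <;> (try field_simp) <;> ring
  · have hlt : ∀ {x t : ℚ_[p]}, t ≠ 0 → ‖x‖ < ‖t‖ → ‖x / t‖ < 1 := fun ht hx => by
      rw [norm_div]; exact (div_lt_one (norm_pos_iff.2 ht)).2 hx
    rcases le_total ‖b‖ ‖a‖ with hab | hab
    · rw [max_eq_left hab] at hB
      have hc := (le_max_left _ _).trans_lt hB
      have hd := (le_max_right _ _).trans_lt hB
      have ht : a ≠ 0 := hz le_rfl hc.le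
      have := QB.of_scale h ht (hδeq a)
        (hK2 i hi 1 (b / a) 0 1 ((a * d - b * c) / a ^ 2) (c / a) h11
        (hdivle ht hab) h01 h11 (by simp) (hδ0 ht) (hδle ht le_rfl hab hc.le hd.le) (hlt ht hc))
      convert hq2 this using 3 <;> (try field_simp) <;> ring
    · rw [max_eq_right hab] at hB
      have hc := (le_max_left _ _).trans_lt hB
      have hd := (le_max_right _ _).trans_lt hB
      have ht : b ≠ 0 := hz hab hc.le
      have := QB.of_scale h ht ((norm_neg _).trans (hδeq b))
        (hK2 i hi (a / b) 1 1 0 (-((a * d - b * c) / b ^ 2)) (d / b)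
        (hdivle ht hab) h11 h11 h01 (by simp) (neg_ne_zero.2 (hδ0 ht))
        (by rw [norm_neg]; exact hδle ht hab le_rfl hc.le hd.le) (hlt ht hd))
      convert hq2 this using 3 <;> (try field_simp) <;> ring

theorem norm_zpow_neg_valuation (h : Adm p L k α β) {t : ℚ_[p]} (ht : t ≠ 0) :
    ‖α ^ (-t.valuation)‖ = (‖t‖ ^ valL p L α)⁻¹ := by
  rw [zpow_neg, norm_inv, norm_zpow_valuation h.left_ne ht]

/-- The orbit of an element of `π(α)` is bounded modulo `L(α)`. -/
theorem exists_qb_act (h : Adm p L k α β) {F : ℚ_[p] → ℚ_[p] → L} (hF : F ∈ W2 k α β) :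
    ∃ C : ℝ, ∀ m : Matrix (Fin 2) (Fin 2) ℚ_[p], det2 p m ≠ 0 →
      QB k α β C (ev (act α m F)) := by
  induction hF using Submodule.span_induction with
  | mem F hF =>
    obtain ⟨i, a, b, c, d, hi, hdet, rfl⟩ := hF
    obtain ⟨K, -, hK⟩ := exists_qb_cutF h
    refine ⟨K * ‖a * d - b * c‖ ^ valL p L α, fun m hm => ?_⟩
    have h1 := hK i hi _ _ _ _ (by rw [det_comp a b c d m]; exact mul_ne_zero hdet hm)
    have h2 := h1.smul (α ^ (-(det2 p m).valuation))
    rw [← map_smul, ← act_cutF, det_comp, norm_zpow_neg_valuation h hm, norm_mul,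
      Real.mul_rpow (norm_nonneg _) (norm_nonneg _)] at h2
    have hpos : 0 < ‖det2 p m‖ ^ valL p L α := Real.rpow_pos_of_pos (norm_pos_iff.2 hm) _
    exact h2.mono (le_of_eq (by field_simp))
  | zero => exact ⟨0, fun m _ => by rw [map_zero, map_zero]; exact qb_zero⟩
  | add F G _ _ hF hG =>
    obtain ⟨C, hC⟩ := hF
    obtain ⟨C', hC'⟩ := hG
    refine ⟨max C C', fun m hm => ?_⟩
    rw [map_add, map_add]
    exact ((hC m hm).mono (le_max_left _ _)).add ((hC' m hm).mono (le_max_right _ _))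
  | smul c F _ hF =>
    obtain ⟨C, hC⟩ := hF
    refine ⟨‖c‖ * C, fun m hm => ?_⟩
    rw [map_smul, map_smul]
    exact (hC m hm).smul c

end Upper

section Glue

set_option linter.unusedSectionVars false

variable {p} {L} [IsUltrametricDist L] [CompleteSpace L]

variable {k : ℕ} {α β : L}

/-- A `p`-adic number of norm at most `1`, as a `p`-adic integer. -/
def toZp (x : ℚ_[p]) : ℤ_[p] := if h : ‖x‖ ≤ 1 then ⟨x, h⟩ else 0

theorem coe_toZp {x : ℚ_[p]} (hx : ‖x‖ ≤ 1) : ((toZp x : ℤ_[p]) : ℚ_[p]) = x :=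
  congrArg (fun z : ℤ_[p] => (z : ℚ_[p])) (dif_pos hx)

theorem toZp_coe (z : ℤ_[p]) : toZp (z : ℚ_[p]) = z := dif_pos z.2

variable (k α β) in
/-- The homogeneous function attached to a function on the disc `‖x‖ ≤ ‖y‖`. -/
def T2 : (ℤ_[p] → L) →ₗ[L] (ℚ_[p] → ℚ_[p] → L) where
  toFun φ x y := if y ≠ 0 ∧ ‖x‖ ≤ ‖y‖ then wt p k α β y * φ (toZp (x / y)) else 0
  map_add' φ ψ := by
    funext x y
    simp only [Pi.add_apply]
    split_ifs <;> ring
  map_smul' c φ := by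
    funext x y
    simp only [Pi.smul_apply, smul_eq_mul, RingHom.id_apply]
    split_ifs <;> ring

theorem T2_apply (φ : ℤ_[p] → L) (x y : ℚ_[p]) :
    T2 k α β φ x y = if y ≠ 0 ∧ ‖x‖ ≤ ‖y‖ then wt p k α β y * φ (toZp (x / y)) else 0 := rfl

theorem norm_p_pow (N : ℕ) : ‖(p : ℚ_[p]) ^ N‖ = (p : ℝ) ^ (-(N : ℤ)) := by
  rw [norm_pow, Padic.norm_p, zpow_neg, zpow_natCast, inv_pow]

theorem T2_binBall (h : Adm p L k α β) (N b j : ℕ) (x y : ℚ_[p]) :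
    T2 k α β (binBall p L N b j) x y = (wt p k α β (p ^ N))⁻¹ *
      ∑ i ∈ Finset.range (j + 1), (binPoly L j).coeff i *
        cut p k α β (· ≤ ·) i (x - b * y) (p ^ N * y) := by
  have hpN : (p : ℚ_[p]) ^ N ≠ 0 := pow_ne_zero N p_ne_zero
  rcases eq_or_ne y 0 with rfl | hy
  · simp [T2_apply, cut]
  have hy0 : 0 < ‖y‖ := norm_pos_iff.2 hy
  have hxy : x / y - b = (x - b * y) / y := by field_simp
  have hiff : ‖x - b * y‖ ≤ ‖(p : ℚ_[p]) ^ N * y‖ ↔ ‖x / y - b‖ ≤ (p : ℝ) ^ (-(N : ℤ)) := by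
    rw [hxy, norm_div, norm_mul, norm_p_pow, div_le_iff₀ hy0]
  have hb : ‖(b : ℚ_[p])‖ ≤ 1 := by exact_mod_cast (PadicInt.norm_le_one (b : ℤ_[p]))
  have hle1 : (p : ℝ) ^ (-(N : ℤ)) ≤ 1 := by
    rw [← norm_p_pow, norm_pow]
    exact pow_le_one₀ (norm_nonneg _) Padic.norm_p_lt_one.le
  simp only [cut, hiff]
  by_cases hc : ‖x / y - b‖ ≤ (p : ℝ) ^ (-(N : ℤ))
  · have hx1 : ‖x / y‖ ≤ 1 := by
      have := norm_add_le_max (x / y - (b : ℚ_[p])) (b : ℚ_[p])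
      rw [sub_add_cancel] at this
      exact this.trans (max_le (hc.trans hle1) hb)
    have hxy' : ‖x‖ ≤ ‖y‖ := by rwa [norm_div, div_le_one hy0] at hx1
    have hball : ‖toZp (x / y) - (b : ℤ_[p])‖ ≤ (p : ℝ) ^ (-(N : ℤ)) := by
      rw [PadicInt.norm_def]
      push_cast
      rwa [coe_toZp hx1]
    have hval : (iotaL p L (toZp (x / y)) - b) / (p : L) ^ N =
        iotaL p L ((x - b * y) / (p ^ N * y)) := by
      rw [coe_toZp hx1, show (x - b * y) / ((p : ℚ_[p]) ^ N * y) = (x / y - b) / p ^ N by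
        field_simp]
      simp [iotaL]
    rw [T2_apply, if_pos ⟨hy, hxy'⟩, binBall, if_pos hball, hval,
      Polynomial.eval_eq_sum_range' (Nat.lt_succ_of_le (binPoly_natDegree_le j)),
      Finset.mul_sum, Finset.mul_sum]
    refine Finset.sum_congr rfl fun i _ => ?_
    rw [if_pos ⟨mul_ne_zero hpN hy, hc⟩, wt_mul h hpN hy]
    have := wt_ne h hpN
    field_simp
  · rw [T2_apply, Finset.sum_eq_zero (fun i _ => by rw [if_neg (fun h => hc h.2), mul_zero]),
      mul_zero]
    split_ifs with hc2
    · have hx1 : ‖x / y‖ ≤ 1 := by rw [norm_div, div_le_one hy0]; exact hc2.2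
      rw [binBall, if_neg, mul_zero]
      rw [PadicInt.norm_def]
      push_cast
      rwa [coe_toZp hx1]
    · rfl

variable (k α β) in
/-- Extension by zero from the chart around `0`. -/
def glZero : (ℤ_[p] → L) →ₗ[L] (ℚ_[p] → ℚ_[p] → L) where
  toFun φ x y := T2 k α β φ (x / p) y
  map_add' φ ψ := by rw [map_add]; rfl
  map_smul' c φ := by rw [map_smul]; rfl

variable (k α β) in
/-- Extension by zero from the chart around `∞`. -/
def glInf : (ℤ_[p] → L) →ₗ[L] (ℚ_[p] → ℚ_[p] → L) where
  toFun φ x y := T2 k α β φ y x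
  map_add' φ ψ := by rw [map_add]; rfl
  map_smul' c φ := by rw [map_smul]; rfl

theorem glZero_apply (φ : ℤ_[p] → L) (x y : ℚ_[p]) :
    glZero k α β φ x y = T2 k α β φ (x / p) y := rfl

theorem glInf_apply (φ : ℤ_[p] → L) (x y : ℚ_[p]) : glInf k α β φ x y = T2 k α β φ y x := rfl

theorem glZero_binBall (h : Adm p L k α β) (N b j : ℕ) :
    glZero k α β (binBall p L N b j) = (wt p k α β (p ^ N))⁻¹ •
      ∑ i ∈ Finset.range (j + 1), (binPoly L j).coeff i •
        cutF k α β (· ≤ ·) i (p : ℚ_[p])⁻¹ (-b) 0 (p ^ N) := by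
  funext x y
  rw [glZero_apply, T2_binBall h]
  simp only [Pi.smul_apply, Finset.sum_apply, smul_eq_mul, cutF]
  congr 1
  refine Finset.sum_congr rfl fun i _ => ?_
  congr 2 <;> ring

theorem glInf_binBall (h : Adm p L k α β) (N b j : ℕ) :
    glInf k α β (binBall p L N b j) = (wt p k α β (p ^ N))⁻¹ •
      ∑ i ∈ Finset.range (j + 1), (binPoly L j).coeff i •
        cutF k α β (· ≤ ·) i (-b) 1 (p ^ N) 0 := by
  funext x y
  rw [glInf_apply, T2_binBall h]
  simp only [Pi.smul_apply, Finset.sum_apply, smul_eq_mul, cutF]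
  congr 1
  refine Finset.sum_congr rfl fun i _ => ?_
  congr 2 <;> ring

theorem map_mem_of_lp {E : Type*} [AddCommGroup E] [Module L E] (T : (ℤ_[p] → L) →ₗ[L] E)
    {W : Submodule L E} {d N : ℕ}
    (hT : ∀ b j : ℕ, j ≤ d → T (binBall p L N b j) ∈ W) {φ : ℤ_[p] → L} (hφ : LP d N φ) :
    T φ ∈ W := by
  rw [← hφ.lpProj_eq, lpProj, map_sum]
  refine Submodule.sum_mem _ fun b _ => ?_
  rw [map_sum]
  refine Submodule.sum_mem _ fun j hj => ?_
  rw [map_smul]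
  exact Submodule.smul_mem _ _ (hT b j (Nat.lt_succ_iff.1 (Finset.mem_range.1 hj)))

theorem glZero_mem_W2 (h : Adm p L k α β) {N : ℕ} {φ : ℤ_[p] → L} (hφ : LP (k - 2) N φ) :
    glZero k α β φ ∈ W2 k α β := by
  refine map_mem_of_lp _ (fun b j hj => ?_) hφ
  rw [glZero_binBall h]
  refine Submodule.smul_mem _ _ (Submodule.sum_mem _ fun i hi => Submodule.smul_mem _ _
    (cutF_mem_W2 ?_ ?_))
  · have := Finset.mem_range.1 hi
    omega
  · simp [(Fact.out : p.Prime).ne_zero]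

theorem glInf_mem_W2 (h : Adm p L k α β) {N : ℕ} {φ : ℤ_[p] → L} (hφ : LP (k - 2) N φ) :
    glInf k α β φ ∈ W2 k α β := by
  refine map_mem_of_lp _ (fun b j hj => ?_) hφ
  rw [glInf_binBall h]
  refine Submodule.smul_mem _ _ (Submodule.sum_mem _ fun i hi => Submodule.smul_mem _ _
    (cutF_mem_W2 ?_ ?_))
  · have := Finset.mem_range.1 hi
    omega
  · simp [(Fact.out : p.Prime).ne_zero]

theorem norm_p_mul_lt_one (z : ℤ_[p]) : ‖(p : ℚ_[p]) * z‖ < 1 := by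
  rw [norm_mul]
  exact mul_lt_one_of_nonneg_of_lt_one_left (norm_nonneg _) Padic.norm_p_lt_one z.2

theorem one_lt_norm_one_div_p : 1 < ‖1 / (p : ℚ_[p])‖ := by
  rw [norm_div, norm_one, Padic.norm_p, one_div, inv_inv]
  exact one_lt_p

theorem glue_chart_zero (φ ψ : ℤ_[p] → L) (z : ℤ_[p]) :
    (glZero k α β φ + glInf k α β ψ) (p * z) 1 = φ z := by
  rw [Pi.add_apply, Pi.add_apply, glZero_apply, glInf_apply, T2_apply, T2_apply,
    mul_div_cancel_left₀ _ p_ne_zero, div_one, toZp_coe, norm_one, if_pos ⟨one_ne_zero, z.2⟩,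
    if_neg fun hc => not_le.2 (norm_p_mul_lt_one z) hc.2, wt_one, one_mul, add_zero]

theorem glue_chart_infty (φ ψ : ℤ_[p] → L) (z : ℤ_[p]) :
    (glZero k α β φ + glInf k α β ψ) 1 z = ψ z := by
  rw [Pi.add_apply, Pi.add_apply, glZero_apply, glInf_apply, T2_apply, T2_apply, div_one,
    toZp_coe, if_neg fun hc => not_le.2 (one_lt_norm_one_div_p) (hc.2.trans z.2), norm_one,
    if_pos ⟨one_ne_zero, z.2⟩, wt_one, one_mul, zero_add]

theorem ev_glue (h : Adm p L k α β) {f : ℚ_[p] → L} {g : ℤ_[p] → L}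
    (hg : ∀ z : ℤ_[p], z ≠ 0 → g z = wt p k α β (z : ℚ_[p]) * f (z : ℚ_[p])⁻¹) :
    ev (glZero k α β (chart f) + glInf k α β g) = f := by
  funext x
  have hp := p_pos (p := p)
  rw [ev_apply, Pi.add_apply, Pi.add_apply, glZero_apply, glInf_apply, T2_apply, T2_apply,
    div_one, norm_one, norm_div, Padic.norm_p, div_inv_eq_mul]
  rcases lt_or_ge ‖x‖ 1 with hx | hx
  · have hx' : ‖x‖ * p ≤ 1 := by
      have h1 : ‖x / (p : ℚ_[p])‖ ≤ 1 := by
        have h2 : ‖x‖ ≤ (p : ℝ) ^ (-1 : ℤ) := by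
          have := (Padic.norm_le_pow_iff_norm_lt_pow_add_one x (-1)).2 (by simpa using hx)
          exact this
        rw [norm_div, Padic.norm_p, div_inv_eq_mul]
        rw [zpow_neg_one] at h2
        calc ‖x‖ * p ≤ (p : ℝ)⁻¹ * p := by gcongr
          _ = 1 := inv_mul_cancel₀ hp.ne'
      rwa [norm_div, Padic.norm_p, div_inv_eq_mul] at h1
    have h3 : ‖x / (p : ℚ_[p])‖ ≤ 1 := by rwa [norm_div, Padic.norm_p, div_inv_eq_mul]
    rw [if_pos ⟨one_ne_zero, hx'⟩, if_neg fun hc => not_le.2 hx hc.2, wt_one, one_mul, add_zero,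
      chart, coe_toZp h3, mul_div_cancel₀ _ p_ne_zero]
  · have hx0 : x ≠ 0 := norm_pos_iff.1 (one_pos.trans_le hx)
    have hx1 : ‖1 / x‖ ≤ 1 := by
      rw [norm_div, norm_one]
      exact div_le_one_of_le₀ hx (norm_nonneg _)
    have hlt : ¬ ‖x‖ * p ≤ 1 := by
      have := one_lt_p (p := p)
      nlinarith
    have hne : toZp (1 / x) ≠ 0 := fun h0 => by
      refine one_div_ne_zero hx0 ?_
      rw [← coe_toZp hx1, h0]
      rfl
    rw [if_neg fun hc => hlt hc.2, if_pos ⟨hx0, hx⟩, zero_add, hg _ hne, coe_toZp hx1,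
      ← mul_assoc, ← wt_mul h hx0 (one_div_ne_zero hx0), mul_one_div_cancel hx0, wt_one, one_mul,
      one_div, inv_inv]

end Glue

section PiRep

set_option linter.unusedSectionVars false

variable {p} {L} [IsUltrametricDist L] [CompleteSpace L]

variable {k : ℕ} {α β : L}

theorem exists_uniform_level {φ : ℤ_[p] → L}
    (hφ : ∀ x : ℤ_[p], ∃ n : ℕ, ∀ y : ℤ_[p], ‖y - x‖ ≤ (p : ℝ) ^ (-(n : ℤ)) → φ y = φ x) :
    ∃ N : ℕ, ∀ z z' : ℤ_[p], ‖z - z'‖ ≤ (p : ℝ) ^ (-(N : ℤ)) → φ z = φ z' := by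
  have hp := p_pos (p := p)
  have hopen : ∀ v : L, IsOpen (φ ⁻¹' {v}) := fun v => by
    rw [Metric.isOpen_iff]
    intro x hx
    obtain ⟨n, hn⟩ := hφ x
    refine ⟨(p : ℝ) ^ (-(n : ℤ)), by positivity, fun y hy => ?_⟩
    rw [Metric.mem_ball, dist_eq_norm] at hy
    rw [Set.mem_preimage, hn y hy.le]
    exact hx
  obtain ⟨δ, hδ, hball⟩ := lebesgue_number_lemma_of_metric (isCompact_univ (X := ℤ_[p])) hopen
    (fun x _ => Set.mem_iUnion.2 ⟨φ x, rfl⟩)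
  obtain ⟨N, hN⟩ := PadicInt.exists_pow_neg_lt p hδ
  refine ⟨N, fun z z' hz => ?_⟩
  obtain ⟨v, hv⟩ := hball z' trivial
  have h1 : φ z = v := hv (by rw [Metric.mem_ball, dist_eq_norm]; exact hz.trans_lt hN)
  have h2 : φ z' = v := hv (Metric.mem_ball_self hδ)
  rw [h1, h2]

theorem LocConst.exists_level {h : ℚ_[p] → L} (hh : LocConst p L h) {u : ℚ_[p]} (hu : ‖u‖ ≤ 1) :
    ∃ N : ℕ, ∀ z z' : ℤ_[p], ‖z - z'‖ ≤ (p : ℝ) ^ (-(N : ℤ)) → h (u * z) = h (u * z') := by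
  refine exists_uniform_level (φ := fun z : ℤ_[p] => h (u * z)) fun x => ?_
  obtain ⟨n, hn⟩ := hh (u * x)
  refine ⟨n, fun y hy => hn _ ?_⟩
  rw [← mul_sub, norm_mul]
  exact (mul_le_of_le_one_left (norm_nonneg _) hu).trans hy

theorem mem_map_of_mem_piGen (h : Adm p L k α β) {f : ℚ_[p] → L} (hf : f ∈ piGen p L k α β) :
    f ∈ (W2 k α β).map ev := by
  obtain ⟨P, hh, hP, ⟨h1, h', h2, h3⟩, rfl⟩ := hf
  obtain ⟨N1, hN1⟩ := h1.exists_level (u := (p : ℚ_[p])) (Padic.norm_p_lt_one).le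
  obtain ⟨N2, hN2⟩ := h2.exists_level (u := 1) (by simp)
  simp only [one_mul] at hN2
  have hlp1 := lp_locConst_mul_eval (d := k - 2) hN1
    (P := P.comp (Polynomial.C (p : L) * Polynomial.X)) (by
      refine Polynomial.natDegree_comp_le.trans ?_
      exact (Nat.mul_le_mul hP ((Polynomial.natDegree_C_mul_le _ _).trans
        Polynomial.natDegree_X_le)).trans (Nat.mul_one _).le)
  have hlp2 := lp_locConst_mul_eval (d := k - 2) hN2 (P := P.reflect (k - 2)) (by
    exact Polynomial.natDegree_reflect_le.trans (max_le le_rfl hP))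
  have hchart : (fun z : ℤ_[p] => hh (p * z) *
      (P.comp (Polynomial.C (p : L) * Polynomial.X)).eval (iotaL p L z)) =
      chart fun z => P.eval (iotaL p L z) * hh z := by
    funext z
    rw [chart, Polynomial.eval_comp]
    simp [iotaL, mul_comm]
  rw [hchart] at hlp1
  refine ⟨_, Submodule.add_mem _ (glZero_mem_W2 h hlp1) (glInf_mem_W2 h hlp2),
    ev_glue h fun z hz => ?_⟩
  have hz' : (z : ℚ_[p]) ≠ 0 := fun h0 => hz (Subtype.ext h0)
  have hinv : iotaL p L (z : ℚ_[p])⁻¹ = (iotaL p L z)⁻¹ := map_inv₀ (algebraMap ℚ_[p] L) _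
  have hι := iotaL_ne (L := L) hz'
  let _ := invertibleOfNonzero (inv_ne_zero hι)
  have hu := Polynomial.eval₂_reflect_mul_pow (RingHom.id L) (iotaL p L z)⁻¹ (k - 2) P hP
  rw [invOf_eq_inv, inv_inv, ← Polynomial.eval, ← Polynomial.eval] at hu
  rw [h3 z hz', hinv, ← hu, wt, inv_pow]
  field_simp

variable (p α β) in
/-- The locally constant function `(αp/β)^{val y}` on the domain `y ≠ 0`, `‖x‖ ≤ ‖y‖`. -/
def cutH (x y : ℚ_[p]) : L :=
  if y ≠ 0 ∧ ‖x‖ ≤ ‖y‖ then (α * (p : L) / β) ^ y.valuation else 0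

theorem cutH_congr {x y x' y' : ℚ_[p]} (hx : ‖x' - x‖ < max ‖x‖ ‖y‖)
    (hy : ‖y' - y‖ < max ‖x‖ ‖y‖) : cutH p α β x' y' = cutH p α β x y := by
  rcases le_or_gt ‖x‖ ‖y‖ with h | h
  · rw [max_eq_right h] at hx hy
    have hy0 : 0 < ‖y‖ := (norm_nonneg _).trans_lt hy
    have h1 := norm_eq_of_sub_lt hy
    have h2 : ‖x'‖ ≤ ‖y'‖ := by rw [h1]; exact (norm_le_iff_of_sub_lt hx).2 h
    rw [cutH, cutH, if_pos ⟨norm_pos_iff.1 (h1 ▸ hy0), h2⟩, if_pos ⟨norm_pos_iff.1 hy0, h⟩,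
      valuation_congr h1]
  · rw [max_eq_left h.le] at hx hy
    have h1 := norm_eq_of_sub_lt hx
    have h2 : ‖y'‖ < ‖x'‖ := by
      have := norm_add_le_max (y' - y) y
      rw [sub_add_cancel] at this
      rw [h1]
      exact this.trans_lt (max_lt hy h)
    rw [cutH, cutH, if_neg fun hc => not_le.2 h2 hc.2, if_neg fun hc => not_le.2 h hc.2]

theorem locConst_cutH {a b c d : ℚ_[p]} (hdet : a * d - b * c ≠ 0) :
    LocConst p L fun z => cutH p α β (a * z + b) (c * z + d) := by
  have hp := p_pos (p := p)
  intro x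
  have hpos : 0 < max ‖a * x + b‖ ‖c * x + d‖ := by
    by_contra hc
    rw [not_lt, max_le_iff, norm_le_zero_iff, norm_le_zero_iff] at hc
    refine hdet ?_
    linear_combination a * hc.2 - c * hc.1
  have hM : 0 < max ‖a * x + b‖ ‖c * x + d‖ / (‖a‖ + ‖c‖ + 1) := by positivity
  obtain ⟨n, hn⟩ := PadicInt.exists_pow_neg_lt p hM
  rw [lt_div_iff₀ (by positivity)] at hn
  have key : ∀ (u v : ℚ_[p]), ‖u‖ ≤ ‖a‖ + ‖c‖ + 1 → ∀ y : ℚ_[p],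
      ‖y - x‖ ≤ (p : ℝ) ^ (-(n : ℤ)) → ‖u * y + v - (u * x + v)‖ <
        max ‖a * x + b‖ ‖c * x + d‖ := fun u v hu y hy => by
    rw [show u * y + v - (u * x + v) = (y - x) * u by ring, norm_mul]
    exact (mul_le_mul hy hu (norm_nonneg _) (by positivity)).trans_lt hn
  have h1 := norm_nonneg a
  have h2 := norm_nonneg c
  exact ⟨n, fun y hy => cutH_congr (key a b (by linarith) y hy) (key c d (by linarith) y hy)⟩

theorem cutH_mul (h : Adm p L k α β) {t : ℚ_[p]} (ht : t ≠ 0) (x y : ℚ_[p]) :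
    cutH p α β (t * x) (t * y) = (α * (p : L) / β) ^ t.valuation * cutH p α β x y := by
  have ht' : 0 < ‖t‖ := norm_pos_iff.2 ht
  have hiff : ‖t * x‖ ≤ ‖t * y‖ ↔ ‖x‖ ≤ ‖y‖ := by
    rw [norm_mul, norm_mul, mul_le_mul_iff_right₀ ht']
  simp only [cutH, hiff]
  by_cases hy : y = 0
  · simp [hy]
  · simp only [ne_eq, mul_eq_zero, ht, hy, or_self, not_false_eq_true, true_and]
    split_ifs
    · rw [Padic.valuation_mul ht hy, zpow_add₀ h.lam_ne]
    · rw [mul_zero]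

theorem ev_cutF_mem_piRep (h : Adm p L k α β) {i : ℕ} (hi : i ≤ k - 2) {a b c d : ℚ_[p]}
    (hdet : a * d - b * c ≠ 0) : ev (cutF k α β (· ≤ ·) i a b c d) ∈ piRep p L k α β := by
  refine Submodule.subset_span ⟨
    (Polynomial.C (iotaL p L a) * Polynomial.X + Polynomial.C (iotaL p L b)) ^ i *
    (Polynomial.C (iotaL p L c) * Polynomial.X + Polynomial.C (iotaL p L d)) ^ (k - 2 - i),
    fun z => cutH p α β (a * z + b) (c * z + d), ?_, ⟨locConst_cutH hdet,
      fun z => cutH p α β (b * z + a) (d * z + c), locConst_cutH ?_, fun z hz => ?_⟩, ?_⟩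
  · refine Polynomial.natDegree_mul_le.trans ?_
    have h1 := Polynomial.natDegree_pow_le_of_le i
      (Polynomial.natDegree_linear_le (a := iotaL p L a) (b := iotaL p L b))
    have h2 := Polynomial.natDegree_pow_le_of_le (k - 2 - i)
      (Polynomial.natDegree_linear_le (a := iotaL p L c) (b := iotaL p L d))
    omega
  · rwa [← neg_sub, neg_ne_zero] at hdet
  · beta_reduce
    rw [← cutH_mul h hz]
    congr 1 <;> field_simp <;> ring
  · funext z
    simp only [ev_apply, cutF, cut, cutH, mul_one]
    split_ifs with hc
    · have hy := iotaL_ne (L := L) hc.1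
      have hs : iotaL p L (c * z + d) ^ (k - 2) =
          iotaL p L (c * z + d) ^ (k - 2 - i) * iotaL p L (c * z + d) ^ i := by
        rw [← pow_add, Nat.sub_add_cancel hi]
      rw [wt, iotaL_div, div_pow, hs]
      simp only [Polynomial.eval_mul, Polynomial.eval_pow, Polynomial.eval_add,
        Polynomial.eval_C, Polynomial.eval_X, ← iotaL_mul, ← iotaL_add]
      field_simp
    · rw [mul_zero]

theorem piRep_eq_map (h : Adm p L k α β) : piRep p L k α β = (W2 k α β).map ev := by
  refine le_antisymm (Submodule.span_le.2 fun f hf => mem_map_of_mem_piGen h hf) ?_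
  rw [W2, Submodule.map_span, Submodule.span_le]
  rintro _ ⟨F, ⟨i, a, b, c, d, hi, hdet, rfl⟩, rfl⟩
  exact ev_cutF_mem_piRep h hi hdet

end PiRep

section Gauge

set_option linter.unusedSectionVars false

variable {p} {L} [IsUltrametricDist L] [CompleteSpace L]

variable {k : ℕ} {α β : L}

/-- `f` lies in `c • π⁰` for some scalar `c` of norm at most `M`. -/
def GB (π0 : Set (ℚ_[p] → L)) (M : ℝ) (f : ℚ_[p] → L) : Prop :=
  ∃ c : L, ‖c‖ ≤ M ∧ ∃ g ∈ π0, f = c • g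

variable {π0 : Set (ℚ_[p] → L)}

theorem GB.mono {M M' : ℝ} (hM : M ≤ M') {f : ℚ_[p] → L} (hf : GB π0 M f) : GB π0 M' f :=
  hf.imp fun _ h => ⟨h.1.trans hM, h.2⟩

theorem GB.smul {M : ℝ} {f : ℚ_[p] → L} (hf : GB π0 M f) (c : L) :
    GB π0 (‖c‖ * M) (c • f) := by
  obtain ⟨c', hc', g, hg, rfl⟩ := hf
  refine ⟨c * c', ?_, g, hg, smul_smul _ _ _⟩
  rw [norm_mul]
  gcongr

theorem gb_zero (h : PiZeroOk p L k α β π0) : GB π0 0 (0 : ℚ_[p] → L) :=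
  ⟨0, by simp, 0, h.2.1, by simp⟩

theorem GB.add (h : PiZeroOk p L k α β π0) {M : ℝ} {f f' : ℚ_[p] → L} (hf : GB π0 M f)
    (hf' : GB π0 M f') : GB π0 M (f + f') := by
  obtain ⟨-, h0, hadd, hsmul, -⟩ := h
  have key : ∀ {c c' : L} {g g' : ℚ_[p] → L}, ‖c'‖ ≤ ‖c‖ → ‖c‖ ≤ M → g ∈ π0 → g' ∈ π0 →
      GB π0 M (c • g + c' • g') := fun {c c' g g'} hcc hc hg hg' => by
    rcases eq_or_ne c 0 with rfl | hc0
    · rw [norm_zero, norm_le_zero_iff] at hcc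
      exact ⟨0, hc, 0, h0, by simp [hcc]⟩
    · refine ⟨c, hc, g + (c' / c) • g', hadd _ hg _ (hsmul _ ?_ _ hg'), ?_⟩
      · rw [norm_div]
        exact div_le_one_of_le₀ hcc (norm_nonneg _)
      · rw [smul_add, smul_smul, mul_div_cancel₀ _ hc0]
  obtain ⟨c, hc, g, hg, rfl⟩ := hf
  obtain ⟨c', hc', g', hg', rfl⟩ := hf'
  rcases le_total ‖c'‖ ‖c‖ with hcc | hcc
  · exact key hcc hc hg hg'
  · rw [add_comm]
    exact key hcc hc' hg' hg

theorem GB.sum (h : PiZeroOk p L k α β π0) {ι : Type*} {M : ℝ} (hM : 0 ≤ M) (s : Finset ι)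
    {f : ι → ℚ_[p] → L} (hf : ∀ i ∈ s, GB π0 M (f i)) : GB π0 M (∑ i ∈ s, f i) :=
  Finset.sum_induction _ (GB π0 M) (fun _ _ h1 h2 => h1.add h h2) ((gb_zero h).mono hM) hf

theorem GB.gaugeN_le {M : ℝ} {f : ℚ_[p] → L} (hf : GB π0 M f) : gaugeN p L π0 f ≤ M := by
  obtain ⟨c, hc, hg⟩ := hf
  refine le_trans (csInf_le ⟨0, ?_⟩ ⟨c, rfl, hg⟩) hc
  rintro x ⟨c, rfl, -⟩
  exact norm_nonneg c

theorem det2_swap (a b c d : ℚ_[p]) : det2 p !![d, -b; -c, a] = a * d - b * c := by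
  simp [det2]
  ring

theorem one_det_ne : (1 : ℚ_[p]) * 1 - 0 * 0 ≠ 0 := by simp

theorem gAct_ev_cutF_one (h : Adm p L k α β) {i : ℕ} (hi : i ≤ k - 2) {a b c d : ℚ_[p]}
    (hdet : a * d - b * c ≠ 0) :
    gAct p L k α β !![d, -b; -c, a] (ev (cutF k α β (· ≤ ·) i 1 0 0 1)) =
      α ^ (-(a * d - b * c).valuation) • ev (cutF k α β (· ≤ ·) i a b c d) := by
  rw [gAct_ev_of_mem_W2 h (cutF_mem_W2 hi one_det_ne) (by rwa [det2_swap]), act_cutF, map_smul,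
    det2_swap]
  simp

theorem exists_gb_cutF (h : Adm p L k α β) (hπ : PiZeroOk p L k α β π0) :
    ∃ C : ℝ, 0 ≤ C ∧ ∀ i : ℕ, i ≤ k - 2 → ∀ a b c d : ℚ_[p], a * d - b * c ≠ 0 →
      GB π0 (C * ‖a * d - b * c‖ ^ valL p L α) (ev (cutF k α β (· ≤ ·) i a b c d)) := by
  have hex : ∀ i : ℕ, ∃ u : L, i ≤ k - 2 → u ≠ 0 ∧ u • ev (cutF k α β (· ≤ ·) i 1 0 0 1) ∈ π0 :=
    fun i => by
      by_cases hi : i ≤ k - 2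
      · obtain ⟨u, hu⟩ := hπ.2.2.2.2.1 _ (ev_cutF_mem_piRep h hi one_det_ne)
        exact ⟨u, fun _ => hu⟩
      · exact ⟨0, fun hi' => absurd hi' hi⟩
  choose u hu using hex
  refine ⟨∑ i ∈ Finset.range (k - 2 + 1), ‖(u i)⁻¹‖, Finset.sum_nonneg fun _ _ => norm_nonneg _,
    fun i hi a b c d hdet => ?_⟩
  obtain ⟨hu0, hmem⟩ := hu i hi
  have hg := hπ.2.2.2.2.2.1 !![d, -b; -c, a] (by rwa [det2_swap]) _ hmem
  rw [(memB_ev_of_mem_W2 h (cutF_mem_W2 hi one_det_ne)).gAct_smul h, gAct_ev_cutF_one h hi hdet,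
    smul_smul] at hg
  refine ⟨(u i * α ^ (-(a * d - b * c).valuation))⁻¹, ?_, _, hg, ?_⟩
  · rw [mul_inv, norm_mul, norm_inv (α ^ _), norm_zpow_neg_valuation h hdet, inv_inv]
    gcongr
    exact Finset.single_le_sum (f := fun i => ‖(u i)⁻¹‖) (fun _ _ => norm_nonneg _)
      (Finset.mem_range.2 (Nat.lt_succ_of_le hi))
  · rw [inv_smul_smul₀ (mul_ne_zero hu0 (zpow_ne_zero _ h.left_ne))]

theorem exists_norm_coeff_binPoly_le (d : ℕ) :
    ∃ A : ℝ, 0 ≤ A ∧ ∀ j ≤ d, ∀ i ≤ j, ‖(binPoly L j).coeff i‖ ≤ A := by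
  refine ⟨∑ j ∈ Finset.range (d + 1), ∑ i ∈ Finset.range (d + 1), ‖(binPoly L j).coeff i‖,
    by positivity, fun j hj i hi => ?_⟩
  refine le_trans ?_ (Finset.single_le_sum
    (f := fun j => ∑ i ∈ Finset.range (d + 1), ‖(binPoly L j).coeff i‖)
    (fun _ _ => by positivity) (Finset.mem_range.2 (Nat.lt_succ_of_le hj)))
  exact Finset.single_le_sum (f := fun i => ‖(binPoly L j).coeff i‖)
    (fun _ _ => norm_nonneg _) (Finset.mem_range.2 (Nat.lt_succ_of_le (hi.trans hj)))

theorem norm_wt_inv_mul (h : Adm p L k α β) (N : ℕ) :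
    ‖(wt p k α β ((p : ℚ_[p]) ^ N))⁻¹‖ * ‖(p : ℚ_[p]) ^ N‖ ^ valL p L α =
      (p : ℝ) ^ ((N : ℝ) * valL p L α) := by
  have hp := p_pos (p := p)
  rw [norm_inv, norm_wt h (pow_ne_zero N p_ne_zero), norm_p_pow, ← Real.rpow_intCast,
    ← Real.rpow_mul hp.le, ← Real.rpow_mul hp.le, ← Real.rpow_neg hp.le, ← Real.rpow_add hp]
  congr 1
  push_cast
  ring

/-- On `π(α)`, the gauge of `π⁰` is bounded by the norm of `B(α)`. -/
theorem exists_gb_of_bbd (h : Adm p L k α β) (hπ : PiZeroOk p L k α β π0) :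
    ∃ C : ℝ, 1 ≤ C ∧ ∀ f ∈ piRep p L k α β, ∀ M : ℝ, BBd k α β M f → GB π0 (C * M) f := by
  have hp := p_pos (p := p)
  obtain ⟨K, hK0, hK⟩ := exists_gb_cutF h hπ
  obtain ⟨A, hA0, hA⟩ := exists_norm_coeff_binPoly_le (L := L) (k - 2)
  have hr := h.pos_left.le
  have hpr : 1 ≤ (p : ℝ) ^ valL p L α := Real.one_le_rpow (one_lt_p (p := p)).le hr
  set C : ℝ := A * K * (p : ℝ) ^ valL p L α with hC
  have hC0 : 0 ≤ C := by positivity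
  have hsum : ∀ (N j : ℕ), j ≤ k - 2 → ∀ F : ℕ → ℚ_[p] → ℚ_[p] → L,
      (∀ i ≤ k - 2, GB π0 (K * (‖(p : ℚ_[p]) ^ N‖ ^ valL p L α * (p : ℝ) ^ valL p L α))
        (ev (F i))) →
      GB π0 (C * (p : ℝ) ^ ((N : ℝ) * valL p L α)) (ev ((wt p k α β ((p : ℚ_[p]) ^ N))⁻¹ •
        ∑ i ∈ Finset.range (j + 1), (binPoly L j).coeff i • F i)) := by
    intro N j hj F hF
    simp only [map_smul, map_sum]
    have h1 := (GB.sum hπ (M := A * (K * (‖(p : ℚ_[p]) ^ N‖ ^ valL p L α *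
      (p : ℝ) ^ valL p L α))) (by positivity) (Finset.range (j + 1))
      (f := fun i => (binPoly L j).coeff i • ev (F i)) fun i hi => by
        have hij := Nat.lt_succ_iff.1 (Finset.mem_range.1 hi)
        refine ((hF i (hij.trans hj)).smul _).mono ?_
        gcongr
        exact hA j hj i hij).smul (wt p k α β ((p : ℚ_[p]) ^ N))⁻¹
    refine h1.mono (le_of_eq ?_)
    rw [← norm_wt_inv_mul h N, hC]
    ring
  have hzero : ∀ N b j : ℕ, j ≤ k - 2 → GB π0 (C * (p : ℝ) ^ ((N : ℝ) * valL p L α))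
      ((ev ∘ₗ glZero k α β) (binBall p L N b j)) := fun N b j hj => by
    rw [LinearMap.comp_apply, glZero_binBall h]
    refine hsum N j hj _ fun i hi => ?_
    have hdet : (p : ℚ_[p])⁻¹ * p ^ N - -b * 0 = p ^ N / p := by
      rw [mul_zero, sub_zero, div_eq_inv_mul]
    have h1 := hK i hi (p : ℚ_[p])⁻¹ (-b) 0 (p ^ N)
      (by rw [hdet]; exact div_ne_zero (pow_ne_zero N p_ne_zero) p_ne_zero)
    refine h1.mono (le_of_eq ?_)
    rw [hdet, norm_div, Padic.norm_p, div_inv_eq_mul, Real.mul_rpow (norm_nonneg _) hp.le]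
  have hinf : ∀ N b j : ℕ, j ≤ k - 2 → GB π0 (C * (p : ℝ) ^ ((N : ℝ) * valL p L α))
      ((ev ∘ₗ glInf k α β) (binBall p L N b j)) := fun N b j hj => by
    rw [LinearMap.comp_apply, glInf_binBall h]
    refine hsum N j hj _ fun i hi => ?_
    have hdet : -(b : ℚ_[p]) * 0 - 1 * p ^ N = -(p ^ N) := by ring
    have h1 := hK i hi (-b : ℚ_[p]) 1 (p ^ N) 0
      (by rw [hdet]; exact neg_ne_zero.2 (pow_ne_zero N p_ne_zero))
    refine h1.mono ?_
    rw [hdet, norm_neg]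
    gcongr
    exact le_mul_of_one_le_right (by positivity) hpr
  refine ⟨max 1 (C * (p : ℝ) ^ valL p L α), le_max_left _ _, fun f hf M hM => ?_⟩
  have hM0 := hM.nonneg
  rw [piRep_eq_map h] at hf
  obtain ⟨F, hF, rfl⟩ := hf
  obtain ⟨N, h1, h2⟩ := exists_lp_of_mem_W2 h hF
  have hext := (homog_of_mem_W2 h hF).ext2 (h2.isCr hr)
  obtain ⟨-, hb1, g, hg, hb2⟩ := hM
  rw [hg.eq h hext] at hb2
  have hbd : ∀ T : (ℤ_[p] → L) →ₗ[L] (ℚ_[p] → L), (∀ N b j : ℕ, j ≤ k - 2 →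
      GB π0 (C * (p : ℝ) ^ ((N : ℝ) * valL p L α)) (T (binBall p L N b j))) →
      ∀ φ : ℤ_[p] → L, LP (k - 2) N φ → MahlerBound (valL p L α) φ M →
      GB π0 (max 1 (C * (p : ℝ) ^ valL p L α) * M) (T φ) := fun T hT φ hφ hφM =>
    (LP.gauge_bound T (GB π0) (fun _ _ _ ha hb => ha.add hπ hb) (fun _ c _ ha => ha.smul c)
      (fun _ _ _ hle ha => ha.mono hle) (gb_zero hπ) hr h.valL_lt.le hC0 hT hφ hφM).mono
      (by gcongr; exact le_max_right _ _)
  rw [← ev_glue h (f := ev F) hext.2, map_add]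
  exact (hbd _ hzero _ h1 hb1).add hπ (hbd _ hinf _ h2 hb2)

theorem exists_norm_rpow_lt {s η : ℝ} (hs : 0 < s) (hη : 0 < η) :
    ∃ δ : ℚ_[p], δ ≠ 0 ∧ ‖δ‖ ≤ 1 ∧ ‖δ‖ ^ s < η := by
  have hpos : 0 < min 1 (η ^ s⁻¹) := by positivity
  obtain ⟨δ, hδ0, hδ⟩ := NormedField.exists_norm_lt ℚ_[p] hpos
  refine ⟨δ, norm_pos_iff.1 hδ0, (hδ.trans_le (min_le_left _ _)).le, ?_⟩
  have := Real.rpow_lt_rpow (norm_nonneg _) (hδ.trans_le (min_le_right _ _)) hs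
  rwa [← Real.rpow_mul hη.le, inv_mul_cancel₀ hs.ne', Real.rpow_one] at this

theorem cutF_true_mul (j : ℕ) (a b c d δ : ℚ_[p]) :
    cutF k α β (fun _ _ => True) j (δ * a) (δ * b) c d =
      iotaL p L δ ^ j • cutF k α β (fun _ _ => True) j a b c d := by
  funext x y
  rw [Pi.smul_apply, Pi.smul_apply, smul_eq_mul, cutF, cutF, cut, cut,
    show δ * a * x + δ * b * y = δ * (a * x + b * y) by ring]
  split_ifs
  · rw [mul_div_assoc, iotaL_mul, mul_pow]
    ring
  · rw [mul_zero]

/-- The elements of the span of the generators of `L(α)` are limits in `B(α)` of elements of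
`π(α)` whose gauge tends to `0`. -/
theorem exists_approx_of_mem_span_lGen (h : Adm p L k α β) (hπ : PiZeroOk p L k α β π0)
    {g : ℚ_[p] → L} (hg : g ∈ Submodule.span L (lGen p L k α β)) :
    ∀ ε : ℝ, 0 < ε → ∃ l ∈ piRep p L k α β, GB π0 ε l ∧ BBd k α β ε (g - l) := by
  induction hg using Submodule.span_induction with
  | mem f hf =>
    intro ε hε
    obtain ⟨j, a, b, c, d, hj, hdet, ha, hb, hc, hd, u, rfl⟩ := exists_eq_ev_of_mem_lGen h hf
    obtain ⟨K, hK0, hK⟩ := exists_bbd_true_sub_le h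
    obtain ⟨C, hC0, hC⟩ := exists_gb_cutF h hπ
    set B : ℝ := ‖u‖ * (K + C * ‖a * d - b * c‖ ^ valL p L α) + 1 with hB
    have hB0 : 0 < B := by positivity
    obtain ⟨δ, hδ0, hδ1, hδ⟩ := exists_norm_rpow_lt (p := p) (sub_pos.2 hj) (div_pos hε hB0)
    have hδpos := norm_pos_iff.2 hδ0
    have hι : iotaL p L δ ^ j ≠ 0 := pow_ne_zero _ (iotaL_ne hδ0)
    have hdet' : δ * a * d - δ * b * c = δ * (a * d - b * c) := by ring
    have hnorm : ‖u * (iotaL p L δ ^ j)⁻¹‖ * ‖δ‖ ^ valL p L α =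
        ‖u‖ * ‖δ‖ ^ (valL p L α - j) := by
      rw [norm_mul, norm_inv, norm_pow, norm_iotaL, Real.rpow_sub hδpos, Real.rpow_natCast]
      ring
    have hBε : B * ‖δ‖ ^ (valL p L α - j) ≤ ε := by
      rw [lt_div_iff₀ hB0] at hδ
      linarith
    have hs : 0 ≤ ‖δ‖ ^ (valL p L α - j) := by positivity
    have hKle : ‖u‖ * K ≤ B := by
      rw [hB]
      have : 0 ≤ ‖u‖ * (C * ‖a * d - b * c‖ ^ valL p L α) := by positivity
      nlinarith
    have hCle : ‖u‖ * (C * ‖a * d - b * c‖ ^ valL p L α) ≤ B := by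
      rw [hB]
      have : 0 ≤ ‖u‖ * K := by positivity
      nlinarith
    refine ⟨(u * (iotaL p L δ ^ j)⁻¹) • ev (cutF k α β (· ≤ ·) j (δ * a) (δ * b) c d),
      Submodule.smul_mem _ _ (ev_cutF_mem_piRep h (h.le_of_lt hj)
        (by rw [hdet']; exact mul_ne_zero hδ0 hdet)), ?_, ?_⟩
    · refine ((hC j (h.le_of_lt hj) _ _ _ _
        (by rw [hdet']; exact mul_ne_zero hδ0 hdet)).smul _).mono (le_trans (le_of_eq ?_)
        ((mul_le_mul_of_nonneg_right hCle hs).trans hBε))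
      rw [hdet', norm_mul δ, Real.mul_rpow (norm_nonneg _) (norm_nonneg _)]
      linear_combination (C * ‖a * d - b * c‖ ^ valL p L α) * hnorm
    · have h1 := (hK j hj a b c d δ ha hb hc hd hdet hδ0 hδ1).smul (u * (iotaL p L δ ^ j)⁻¹)
      rw [smul_sub, cutF_true_mul, map_smul, smul_smul, inv_mul_cancel_right₀ hι] at h1
      refine h1.mono (le_trans (le_of_eq ?_) ((mul_le_mul_of_nonneg_right hKle hs).trans hBε))
      linear_combination K * hnorm
  | zero =>
    intro ε hε
    exact ⟨0, Submodule.zero_mem _, (gb_zero hπ).mono hε.le,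
      by rw [sub_zero]; exact bbd_zero.mono hε.le⟩
  | add f g _ _ hf hg =>
    intro ε hε
    obtain ⟨l, hl, h1, h2⟩ := hf ε hε
    obtain ⟨l', hl', h1', h2'⟩ := hg ε hε
    refine ⟨l + l', Submodule.add_mem _ hl hl', h1.add hπ h1', ?_⟩
    rw [add_sub_add_comm]
    exact h2.add h2'
  | smul c f _ hf =>
    intro ε hε
    obtain ⟨l, hl, h1, h2⟩ := hf (ε / (‖c‖ + 1)) (by positivity)
    have hle : ‖c‖ * (ε / (‖c‖ + 1)) ≤ ε := by
      rw [mul_div_assoc', div_le_iff₀ (by positivity)]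
      nlinarith [norm_nonneg c]
    refine ⟨c • l, Submodule.smul_mem _ _ hl, (h1.smul c).mono hle, ?_⟩
    rw [← smul_sub]
    exact (h2.smul c).mono hle

theorem memB_of_mem_piRep (h : Adm p L k α β) {f : ℚ_[p] → L} (hf : f ∈ piRep p L k α β) :
    MemB p L k α β f := by
  rw [piRep_eq_map h] at hf
  obtain ⟨F, hF, rfl⟩ := hf
  exact memB_ev_of_mem_W2 h hF

theorem MemB.sub (h : Adm p L k α β) {f g : ℚ_[p] → L} (hf : MemB p L k α β f)
    (hg : MemB p L k α β g) : MemB p L k α β (f - g) :=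
  (((hf.bbd h).mono (le_max_left _ _)).sub ((hg.bbd h).mono (le_max_right _ _))).memB

theorem exists_gaugeN_le_qNorm (h : Adm p L k α β) (hπ : PiZeroOk p L k α β π0) :
    ∃ C : ℝ, 0 < C ∧ ∀ f ∈ piRep p L k α β, C * gaugeN p L π0 f ≤ qNorm p L k α β f := by
  obtain ⟨C, hC1, hC⟩ := exists_gb_of_bbd h hπ
  have hC0 : 0 < C := one_pos.trans_le hC1
  refine ⟨C⁻¹, inv_pos.2 hC0, fun f hf => le_csInf ?_ ?_⟩
  · exact ⟨_, 0, memLalpha_of_mem_span_lGen h (Submodule.zero_mem _), rfl⟩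
  rintro x ⟨g, ⟨hgB, hg⟩, rfl⟩
  rw [inv_mul_le_iff₀ hC0]
  refine le_of_forall_pos_le_add fun η hη => ?_
  have hε : 0 < η / C := div_pos hη hC0
  obtain ⟨g', hg', hlt⟩ := hg _ hε
  obtain ⟨l, hl, hGl, hBl⟩ := exists_approx_of_mem_span_lGen h hπ hg' _ hε
  have hfg := ((memB_of_mem_piRep h hf).sub h hgB).bbd h
  have hgg := (hgB.sub h (memB_of_mem_span_lGen h hg')).bbd h
  set x := bNorm p L k α β (f - g)
  have hx := hfg.nonneg
  have hle1 : x ≤ x + η / C := by linarith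
  have hle2 : η / C ≤ x + η / C := by linarith
  have hsum := ((hfg.mono hle1).add (hgg.mono (hlt.le.trans hle2))).add (hBl.mono hle2)
  rw [sub_add_sub_cancel, sub_add_sub_cancel] at hsum
  have hG := (hC _ (Submodule.sub_mem _ hf hl) _ hsum).add hπ
    (hGl.mono (hle2.trans (le_mul_of_one_le_left (by linarith) hC1)))
  rw [sub_add_cancel] at hG
  refine hG.gaugeN_le.trans (le_of_eq ?_)
  field_simp

theorem QB.qNorm_le (h : Adm p L k α β) {M : ℝ} {f : ℚ_[p] → L} (hf : MemB p L k α β f)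
    (hM : QB k α β M f) : qNorm p L k α β f ≤ M := by
  obtain ⟨g, hg, h1⟩ := hM
  refine le_trans (csInf_le ⟨0, ?_⟩ ⟨g, memLalpha_of_mem_span_lGen h hg, rfl⟩) (h1.bNorm_le h)
  rintro x ⟨g, hg, rfl⟩
  exact ((hf.sub h hg.1).bbd h).nonneg

theorem exists_qNorm_le_gaugeN (h : Adm p L k α β) (hπ : PiZeroOk p L k α β π0) :
    ∃ C : ℝ, 0 < C ∧ ∀ f ∈ piRep p L k α β, qNorm p L k α β f ≤ C * gaugeN p L π0 f := by
  obtain ⟨hsub, -, -, -, hgen, -, s, hs, hfin⟩ := hπ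
  have hex : ∀ g : ℚ_[p] → L, ∃ C : ℝ, g ∈ s → ∀ m : Matrix (Fin 2) (Fin 2) ℚ_[p],
      det2 p m ≠ 0 → QB k α β C (gAct p L k α β m g) := fun g => by
    by_cases hg : g ∈ s
    · have hgp := hsub g (hs hg)
      rw [piRep_eq_map h] at hgp
      obtain ⟨F, hF, rfl⟩ := hgp
      obtain ⟨C, hC⟩ := exists_qb_act h hF
      refine ⟨C, fun _ m hm => ?_⟩
      rw [gAct_ev_of_mem_W2 h hF hm]
      exact hC m hm
    · exact ⟨0, fun hg' => absurd hg' hg⟩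
  choose C hC using hex
  have hC0 : ∀ g ∈ s, 0 ≤ C g := fun g hg => (hC g hg 1 (by simp [det2])).nonneg
  have hB0 : 0 ≤ ∑ g ∈ s, C g := Finset.sum_nonneg hC0
  have hBpos : 0 < ∑ g ∈ s, C g + 1 := by linarith
  refine ⟨∑ g ∈ s, C g + 1, hBpos, fun f hf => ?_⟩
  rw [← div_le_iff₀' hBpos]
  refine le_csInf ?_ ?_
  · obtain ⟨c, hc, hcf⟩ := hgen f hf
    exact ⟨_, c⁻¹, rfl, _, hcf, by rw [inv_smul_smul₀ hc]⟩
  rintro x ⟨c, rfl, g, hg, rfl⟩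
  rw [div_le_iff₀' hBpos]
  obtain ⟨nn, u, mm, gg, hu, hm, hgg, rfl⟩ := hfin g hg
  have hq : QB k α β (∑ g ∈ s, C g) (∑ i, u i • gAct p L k α β (mm i) (gg i)) :=
    QB.sum_smul hB0 _ (fun i _ => hu i) fun i _ => (hC _ (hgg i) _ (hm i)).mono
      (Finset.single_le_sum hC0 (hgg i))
  refine ((hq.smul c).qNorm_le h (memB_of_mem_piRep h hf)).trans ?_
  nlinarith [norm_nonneg c]

theorem exists_qNorm_sub_lt (h : Adm p L k α β) {F : ℚ_[p] → L} (hF : MemB p L k α β F) {ε : ℝ}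
    (hε : 0 < ε) : ∃ f ∈ piRep p L k α β, qNorm p L k α β (F - f) < ε := by
  obtain ⟨h1, g, hg⟩ := hF
  have hr := h.pos_left.le
  obtain ⟨N1, φ, hφ, hφ'⟩ := h1.exists_lp_approx hr h.valL_lt (half_pos hε)
  obtain ⟨N2, ψ, hψ, hψ'⟩ := hg.1.exists_lp_approx hr h.valL_lt (half_pos hε)
  have hW := Submodule.add_mem _ (glZero_mem_W2 h hφ) (glInf_mem_W2 h hψ)
  have hext := (homog_of_mem_W2 h hW).ext2 (by
    simp only [glue_chart_infty]
    exact hψ.isCr hr)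
  simp only [glue_chart_infty] at hext
  have hchart : chart (ev (glZero k α β φ + glInf k α β ψ)) = φ := by
    funext z
    exact glue_chart_zero φ ψ z
  have hb : BBd k α β (ε / 2) (F - ev (glZero k α β φ + glInf k α β ψ)) := by
    have hc : chart (F - ev (glZero k α β φ + glInf k α β ψ)) = chart F - φ := by
      funext z
      exact congrArg (F (p * z) - ·) (congrFun hchart z)
    refine ⟨?_, ?_, g - ψ, ?_, hψ'⟩
    · rw [hc]
      exact IsCr.sub h1 (hφ.isCr hr)
    · rw [hc]
      exact hφ'
    · refine ⟨hg.1.sub hext.1, fun z hz => ?_⟩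
      have hz' := hext.2 z hz
      beta_reduce at hz'
      rw [Pi.sub_apply, Pi.sub_apply, hg.2 z hz, hz', mul_sub]
  refine ⟨_, ?_, (hb.qb.qNorm_le h hb.memB).trans_lt (half_lt_self hε)⟩
  rw [piRep_eq_map h]
  exact Submodule.mem_map_of_mem hW

end Gauge

section Existence

set_option linter.unusedSectionVars false

variable {p} {L} [IsUltrametricDist L] [CompleteSpace L]

variable {k : ℕ} {α β : L}

theorem det2_mul (m m' : Matrix (Fin 2) (Fin 2) ℚ_[p]) :
    det2 p (m * m') = det2 p m * det2 p m' := by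
  simp only [det2, Matrix.mul_apply, Fin.sum_univ_two]
  ring

theorem act_act (h : Adm p L k α β) {m m' : Matrix (Fin 2) (Fin 2) ℚ_[p]} (hm : det2 p m ≠ 0)
    (hm' : det2 p m' ≠ 0) (F : ℚ_[p] → ℚ_[p] → L) :
    act α m (act α m' F) = act α (m * m') F := by
  funext x y
  rw [act_apply, act_apply, act_apply, det2_mul, Padic.valuation_mul hm hm', neg_add,
    zpow_add₀ h.left_ne, mul_assoc]
  simp only [Matrix.mul_apply, Fin.sum_univ_two]
  congr 3 <;> ring

theorem act_one (F : ℚ_[p] → ℚ_[p] → L) : act α 1 F = F := by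
  funext x y
  simp [act_apply, det2]

variable (p k α β) in
/-- The integral multiples of the translates of the functions `1_{ℤ_p} z^i`, `i ≤ k - 2`. -/
def latticeGen : Set (ℚ_[p] → L) :=
  {f | ∃ (c : L) (i : ℕ) (m : Matrix (Fin 2) (Fin 2) ℚ_[p]), ‖c‖ ≤ 1 ∧ i ≤ k - 2 ∧
    det2 p m ≠ 0 ∧ f = c • gAct p L k α β m (ev (cutF k α β (· ≤ ·) i 1 0 0 1))}

variable (p k α β) in
/-- The `𝒪_L[GL₂(ℚ_p)]`-submodule of `π(α)` generated by the functions `1_{ℤ_p} z^i`. -/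
def stdLattice : AddSubmonoid (ℚ_[p] → L) := AddSubmonoid.closure (latticeGen p k α β)

theorem mem_piRep_of_mem_stdLattice (h : Adm p L k α β) {f : ℚ_[p] → L}
    (hf : f ∈ stdLattice p k α β) : f ∈ piRep p L k α β := by
  induction hf using AddSubmonoid.closure_induction with
  | mem f hf =>
    obtain ⟨c, i, m, -, hi, hm, rfl⟩ := hf
    have hW := cutF_mem_W2 (p := p) (L := L) (α := α) (β := β) hi one_det_ne
    rw [piRep_eq_map h, gAct_ev_of_mem_W2 h hW hm]
    exact Submodule.smul_mem _ _ (Submodule.mem_map_of_mem (act_mem_W2 hW hm))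
  | zero => exact Submodule.zero_mem _
  | add f g _ _ hf hg => exact Submodule.add_mem _ hf hg

theorem smul_mem_stdLattice {c : L} (hc : ‖c‖ ≤ 1) {f : ℚ_[p] → L}
    (hf : f ∈ stdLattice p k α β) : c • f ∈ stdLattice p k α β := by
  induction hf using AddSubmonoid.closure_induction with
  | mem f hf =>
    obtain ⟨c', i, m, hc', hi, hm, rfl⟩ := hf
    refine AddSubmonoid.subset_closure ⟨c * c', i, m, ?_, hi, hm, smul_smul _ _ _⟩
    rw [norm_mul]
    exact mul_le_one₀ hc (norm_nonneg _) hc'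
  | zero => rw [smul_zero]; exact AddSubmonoid.zero_mem _
  | add f g _ _ hf hg => rw [smul_add]; exact AddSubmonoid.add_mem _ hf hg

theorem gAct_mem_stdLattice (h : Adm p L k α β) {m : Matrix (Fin 2) (Fin 2) ℚ_[p]}
    (hm : det2 p m ≠ 0) {f : ℚ_[p] → L} (hf : f ∈ stdLattice p k α β) :
    gAct p L k α β m f ∈ stdLattice p k α β := by
  induction hf using AddSubmonoid.closure_induction with
  | mem f hf =>
    obtain ⟨c, i, m', hc, hi, hm', rfl⟩ := hf
    have hmm : det2 p (m * m') ≠ 0 := by rw [det2_mul]; exact mul_ne_zero hm hm'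
    have hW := cutF_mem_W2 (p := p) (L := L) (α := α) (β := β) hi one_det_ne
    have hW' := act_mem_W2 hW hm'
    refine AddSubmonoid.subset_closure ⟨c, i, m * m', hc, hi, hmm, ?_⟩
    rw [gAct_ev_of_mem_W2 h hW hm', (memB_ev_of_mem_W2 h hW').gAct_smul h,
      gAct_ev_of_mem_W2 h hW' hm, gAct_ev_of_mem_W2 h hW hmm, act_act h hm hm']
  | zero =>
    have := (bbd_zero (k := k) (α := α) (β := β)).memB.gAct_smul h 0 m
    rw [zero_smul, zero_smul] at this
    rw [this]
    exact AddSubmonoid.zero_mem _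
  | add f g hf' hg' hf hg =>
    rw [(memB_of_mem_piRep h (mem_piRep_of_mem_stdLattice h hf')).gAct_add h
      (memB_of_mem_piRep h (mem_piRep_of_mem_stdLattice h hg'))]
    exact AddSubmonoid.add_mem _ hf hg

theorem exists_smul_mem_stdLattice (h : Adm p L k α β) {F : ℚ_[p] → ℚ_[p] → L}
    (hF : F ∈ W2 k α β) : ∃ c : L, c ≠ 0 ∧ c • ev F ∈ stdLattice p k α β := by
  induction hF using Submodule.span_induction with
  | mem F hF =>
    obtain ⟨i, a, b, c, d, hi, hdet, rfl⟩ := hF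
    refine ⟨_, zpow_ne_zero (-(a * d - b * c).valuation) h.left_ne,
      AddSubmonoid.subset_closure ⟨1, i, !![d, -b; -c, a], by simp, hi, ?_, ?_⟩⟩
    · rwa [det2_swap]
    · rw [one_smul, gAct_ev_cutF_one h hi hdet]
  | zero => exact ⟨1, one_ne_zero, by rw [map_zero, smul_zero]; exact AddSubmonoid.zero_mem _⟩
  | add F G _ _ hF hG =>
    obtain ⟨c, hc, hcF⟩ := hF
    obtain ⟨c', hc', hcG⟩ := hG
    obtain ⟨t, ht0, ht⟩ := NormedField.exists_norm_lt L
      (show 0 < (‖c‖ + ‖c'‖ + 1)⁻¹ by positivity)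
    have key : ∀ x : L, ‖x‖ ≤ ‖c‖ + ‖c'‖ + 1 → ‖t * x‖ ≤ 1 := fun x hx => by
      rw [norm_mul]
      refine (mul_le_mul ht.le hx (norm_nonneg _) (by positivity)).trans (le_of_eq ?_)
      exact inv_mul_cancel₀ (by positivity)
    refine ⟨t * c * c', mul_ne_zero (mul_ne_zero (norm_pos_iff.1 ht0) hc) hc', ?_⟩
    rw [map_add, smul_add, mul_right_comm, mul_smul (t * c'), mul_right_comm, mul_smul (t * c)]
    have h1 := norm_nonneg c
    have h2 := norm_nonneg c'
    exact AddSubmonoid.add_mem _ (smul_mem_stdLattice (key _ (by linarith)) hcF)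
      (smul_mem_stdLattice (key _ (by linarith)) hcG)
  | smul a F _ hF =>
    obtain ⟨c, hc, hcF⟩ := hF
    rcases eq_or_ne a 0 with rfl | ha
    · exact ⟨1, one_ne_zero, by
        rw [zero_smul, map_zero, smul_zero]; exact AddSubmonoid.zero_mem _⟩
    · refine ⟨c / a, div_ne_zero hc ha, ?_⟩
      rwa [map_smul, smul_smul, div_mul_cancel₀ _ ha]

theorem exists_sum_of_mem_stdLattice {f : ℚ_[p] → L} (hf : f ∈ stdLattice p k α β) :
    ∃ (nn : ℕ) (c : Fin nn → L) (mm : Fin nn → Matrix (Fin 2) (Fin 2) ℚ_[p])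
      (gg : Fin nn → (ℚ_[p] → L)), (∀ i, ‖c i‖ ≤ 1) ∧ (∀ i, det2 p (mm i) ≠ 0) ∧
      (∀ i, gg i ∈ (Finset.range (k - 2 + 1)).image
        fun i => ev (cutF k α β (· ≤ ·) i 1 0 0 1)) ∧
      f = ∑ i, c i • gAct p L k α β (mm i) (gg i) := by
  induction hf using AddSubmonoid.closure_induction with
  | mem f hf =>
    obtain ⟨c, i, m, hc, hi, hm, rfl⟩ := hf
    exact ⟨1, fun _ => c, fun _ => m, fun _ => _, fun _ => hc, fun _ => hm,
      fun _ => Finset.mem_image_of_mem _ (Finset.mem_range.2 (Nat.lt_succ_of_le hi)), by simp⟩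
  | zero => exact ⟨0, Fin.elim0, Fin.elim0, Fin.elim0, fun i => i.elim0, fun i => i.elim0,
      fun i => i.elim0, by simp⟩
  | add f g _ _ hf hg =>
    obtain ⟨n, c, mm, gg, h1, h2, h3, rfl⟩ := hf
    obtain ⟨n', c', mm', gg', h1', h2', h3', rfl⟩ := hg
    refine ⟨n + n', Fin.append c c', Fin.append mm mm', Fin.append gg gg', ?_, ?_, ?_, ?_⟩
    · exact fun i => Fin.addCases (fun i => by simpa using h1 i) (fun i => by simpa using h1' i) i
    · exact fun i => Fin.addCases (fun i => by simpa using h2 i) (fun i => by simpa using h2' i) i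
    · refine fun i => Fin.addCases (fun i => ?_) (fun i => ?_) i
      · rw [Fin.append_left]; exact h3 i
      · rw [Fin.append_right]; exact h3' i
    · simp [Fin.sum_univ_add]

theorem piZeroOk_stdLattice (h : Adm p L k α β) :
    PiZeroOk p L k α β (stdLattice p k α β : Set (ℚ_[p] → L)) := by
  refine ⟨fun f hf => mem_piRep_of_mem_stdLattice h hf, AddSubmonoid.zero_mem _,
    fun f hf g hg => AddSubmonoid.add_mem _ hf hg, fun c hc f hf => smul_mem_stdLattice hc hf,
    fun f hf => ?_, fun m hm f hf => gAct_mem_stdLattice h hm hf, _, fun f hf => ?_,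
    fun f hf => exists_sum_of_mem_stdLattice hf⟩
  · rw [piRep_eq_map h] at hf
    obtain ⟨F, hF, rfl⟩ := hf
    exact exists_smul_mem_stdLattice h hF
  · obtain ⟨i, hi, rfl⟩ := Finset.mem_image.1 hf
    have hi' := Nat.lt_succ_iff.1 (Finset.mem_range.1 hi)
    have hdet : det2 p 1 ≠ 0 := by simp [det2]
    refine AddSubmonoid.subset_closure ⟨1, i, 1, by simp, hi', hdet, ?_⟩
    rw [one_smul, gAct_ev_of_mem_W2 h (cutF_mem_W2 hi' one_det_ne) hdet, act_one]

/-- The gauge of `π⁰` and the quotient norm of `B(α)/L(α)` are equivalent on `π(α)`, whose image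
in the quotient is dense. -/
theorem completion_iso (h : Adm p L k α β) :
    (∃ π0 : Set (ℚ_[p] → L), PiZeroOk p L k α β π0) ∧
    (∀ π0 : Set (ℚ_[p] → L), PiZeroOk p L k α β π0 →
      ∃ c₁ : ℝ, 0 < c₁ ∧ ∃ c₂ : ℝ, 0 < c₂ ∧
        (∀ f ∈ piRep p L k α β,
          c₁ * gaugeN p L π0 f ≤ qNorm p L k α β f ∧
            qNorm p L k α β f ≤ c₂ * gaugeN p L π0 f) ∧
        (∀ F : ℚ_[p] → L, MemB p L k α β F → ∀ ε : ℝ, 0 < ε →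
          ∃ f ∈ piRep p L k α β, qNorm p L k α β (F - f) < ε)) := by
  refine ⟨⟨_, piZeroOk_stdLattice h⟩, fun π0 hπ => ?_⟩
  obtain ⟨c₁, hc₁, h1⟩ := exists_gaugeN_le_qNorm h hπ
  obtain ⟨c₂, hc₂, h2⟩ := exists_qNorm_le_gaugeN h hπ
  exact ⟨c₁, hc₁, c₂, hc₂, fun f hf => ⟨h1 f hf, h2 f hf⟩,
    fun F hF ε hε => exists_qNorm_sub_lt h hF hε⟩

end Existence

/-- The canonical map `π(α) → B(α)/L(α)` extends to a `GL₂(ℚ_p)`-equivariant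
topological isomorphism between the completion of `π(α)` with respect to any
generating `GL₂(ℚ_p)`-stable `𝒪_L[GL₂(ℚ_p)]`-finitely generated submodule `π⁰`
(and such `π⁰` exist) and `B(α)/L(α)`.  Concretely: the gauge of `π⁰` and the
quotient norm of `B(α)/L(α)` are equivalent on `π(α)`, and the image of `π(α)`
is dense in `B(α)/L(α)`.  The same holds with `β` in place of `α`. -/
theorem statement8 (p : ℕ) [Fact p.Prime] (L : Type) [NontriviallyNormedField L]
    [NormedAlgebra ℚ_[p] L] [FiniteDimensional ℚ_[p] L] [IsUltrametricDist L]
    (k : ℕ) (α β : L) (h : Hyps p L k α β) :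
    (∃ π0 : Set (ℚ_[p] → L), PiZeroOk p L k α β π0) ∧
    (∀ π0 : Set (ℚ_[p] → L), PiZeroOk p L k α β π0 →
      ∃ c₁ : ℝ, 0 < c₁ ∧ ∃ c₂ : ℝ, 0 < c₂ ∧
        (∀ f ∈ piRep p L k α β,
          c₁ * gaugeN p L π0 f ≤ qNorm p L k α β f ∧
            qNorm p L k α β f ≤ c₂ * gaugeN p L π0 f) ∧
        (∀ F : ℚ_[p] → L, MemB p L k α β F → ∀ ε : ℝ, 0 < ε →
          ∃ f ∈ piRep p L k α β, qNorm p L k α β (F - f) < ε)) ∧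
    (∃ π0 : Set (ℚ_[p] → L), PiZeroOk p L k β α π0) ∧
    (∀ π0 : Set (ℚ_[p] → L), PiZeroOk p L k β α π0 →
      ∃ c₁ : ℝ, 0 < c₁ ∧ ∃ c₂ : ℝ, 0 < c₂ ∧
        (∀ f ∈ piRep p L k β α,
          c₁ * gaugeN p L π0 f ≤ qNorm p L k β α f ∧
            qNorm p L k β α f ≤ c₂ * gaugeN p L π0 f) ∧
        (∀ F : ℚ_[p] → L, MemB p L k β α F → ∀ ε : ℝ, 0 < ε →
          ∃ f ∈ piRep p L k β α, qNorm p L k β α (F - f) < ε)) := by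
  have : CompleteSpace L := FiniteDimensional.complete ℚ_[p] L
  obtain ⟨hk, -, hα, hβ, hsum, -⟩ := h
  obtain ⟨h1, h2⟩ := completion_iso (p := p) (L := L) (⟨hk, hα, hβ, hsum⟩ : Adm p L k α β)
  obtain ⟨h3, h4⟩ := completion_iso (p := p) (L := L)
    (⟨hk, hβ, hα, by rw [add_comm]; exact hsum⟩ : Adm p L k β α)
  exact ⟨h1, h2, h3, h4⟩

end Paper

end
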